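/- For every c₁ > 0 there exist positive constants κ and C such that the following holds. Let Z ≥ 1, α > 0 with Zα² ≤ κ, D ≥ 1, and δ with C·Z^{−2/3} ≤ δ ≤ D; set d = δ·Z^{−1/3} and r = D·Z^{−1/3}. Then for every pair of admissible cutoffs θ₀, θ₁ (with gradient constant c₁), every N ≥ 1, every divergence-free A ∈ C_c^∞(ℝ³,ℝ³), and every normalized N-electron wave function Ψ: 𝓔¹_N[Ψ,A] ≥ −C·Z^{7/3}·δ^{1/2} − C·Z^{2/3}·δ^{−2}. -/

import Mathlib

open MeasureTheory

noncomputable section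

/-- Euclidean norm on ℝ³ (encoded as `Fin 3 → ℝ`). -/
def enorm3 (x : Fin 3 → ℝ) : ℝ := Real.sqrt (∑ k, x k ^ 2)

/-- The Pauli matrices σ₁, σ₂, σ₃. -/
def pauli : Fin 3 → Matrix (Fin 2) (Fin 2) ℂ :=
  ![!![0, 1; 1, 0], !![0, -Complex.I; Complex.I, 0], !![1, 0; 0, -1]]

/-- The partial derivative ∂ᵢ Aⱼ of a vector field on ℝ³. -/
def pdVec (A : (Fin 3 → ℝ) → Fin 3 → ℝ) (i j : Fin 3) (x : Fin 3 → ℝ) : ℝ :=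
  fderiv ℝ A x (Pi.single i 1) j

/-- The curl ∇×A of a vector field on ℝ³. -/
def curl3 (A : (Fin 3 → ℝ) → Fin 3 → ℝ) (x : Fin 3 → ℝ) : Fin 3 → ℝ :=
  ![pdVec A 1 2 x - pdVec A 2 1 x, pdVec A 2 0 x - pdVec A 0 2 x,
    pdVec A 0 1 x - pdVec A 1 0 x]

/-- |∇×A|²(x). -/
def curlSq (A : (Fin 3 → ℝ) → Fin 3 → ℝ) (x : Fin 3 → ℝ) : ℝ :=
  ∑ k, (curl3 A x k) ^ 2

/-- |∇⊗A|²(x) = Σᵢⱼ |∂ᵢAⱼ|². -/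
def gradSq (A : (Fin 3 → ℝ) → Fin 3 → ℝ) (x : Fin 3 → ℝ) : ℝ :=
  ∑ i, ∑ j, (pdVec A i j x) ^ 2

/-- A divergence-free smooth compactly supported vector potential. -/
def IsVecPot (A : (Fin 3 → ℝ) → Fin 3 → ℝ) : Prop :=
  ContDiff ℝ (⊤ : ℕ∞) A ∧ HasCompactSupport A ∧ ∀ x, ∑ k, pdVec A k k x = 0

/-- The unit basis vector of the configuration space (ℝ³)^N in direction
(particle j, coordinate k). -/
def eVec (N : ℕ) (j : Fin N) (k : Fin 3) : Fin N → Fin 3 → ℝ :=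
  Pi.single j (Pi.single k 1)

/-- A normalized `N`-electron wave function: smooth, compactly supported,
antisymmetric under simultaneous permutation of position-spin pairs, L²-normalized. -/
structure IsWaveFun (N : ℕ) (Ψ : (Fin N → Fin 3 → ℝ) → (Fin N → Fin 2) → ℂ) : Prop where
  smooth : ∀ s, ContDiff ℝ (⊤ : ℕ∞) fun x => Ψ x s
  compactSupport : ∀ s, HasCompactSupport fun x => Ψ x s
  antisymm : ∀ (π : Equiv.Perm (Fin N)) (x : Fin N → Fin 3 → ℝ) (s : Fin N → Fin 2),
    Ψ (fun i => x (π i)) (fun i => s (π i)) = ((Equiv.Perm.sign π : ℤ) : ℂ) * Ψ x s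
  normalized : ∑ s : Fin N → Fin 2, ∫ x : Fin N → Fin 3 → ℝ, ‖Ψ x s‖ ^ 2 = 1

/-- The expectation ∫ W |Ψ|² of a multiplication operator, including spin summation. -/
def potInt (N : ℕ) (W : (Fin N → Fin 3 → ℝ) → ℝ)
    (Ψ : (Fin N → Fin 3 → ℝ) → (Fin N → Fin 2) → ℂ) : ℝ :=
  ∑ s : Fin N → Fin 2, ∫ x : Fin N → Fin 3 → ℝ, W x * ‖Ψ x s‖ ^ 2

/-- The Pauli kinetic form t_A^{(j)}[Ψ] = ‖σ^{(j)}·(−i∇_{x_j} + A(x_j))Ψ‖². -/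
def pauliKin (N : ℕ) (A : (Fin 3 → ℝ) → Fin 3 → ℝ) (j : Fin N)
    (Ψ : (Fin N → Fin 3 → ℝ) → (Fin N → Fin 2) → ℂ) : ℝ :=
  ∑ s : Fin N → Fin 2, ∫ x : Fin N → Fin 3 → ℝ,
    ‖∑ k : Fin 3, ∑ t : Fin 2, pauli k (s j) t *
      (-Complex.I * fderiv ℝ (fun y => Ψ y (Function.update s j t)) x (eVec N j k)
        + (A (x j) k : ℂ) * Ψ x (Function.update s j t))‖ ^ 2

/-- The closed ball B_ρ = {x ∈ ℝ³ : |x| ≤ ρ}. -/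
def ball3 (ρ : ℝ) : Set (Fin 3 → ℝ) := {x | enorm3 x ≤ ρ}

/-- The gradient of a scalar function on ℝ³. -/
def grad3 (f : (Fin 3 → ℝ) → ℝ) (x : Fin 3 → ℝ) : Fin 3 → ℝ :=
  fun k => fderiv ℝ f x (Pi.single k 1)

/-- Admissible cutoff pair (θ₀, θ₁) on scale d with gradient constant c₁:
smooth [0,1]-valued, θ₀² + θ₁² ≡ 1, θ₁ supported in B_{2d} and ≡ 1 on B_d,
with |∇θ₀|, |∇θ₁| ≤ c₁/d. -/
structure AdmissibleCutoffs (d c₁ : ℝ) (θ₀ θ₁ : (Fin 3 → ℝ) → ℝ) : Prop where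
  smooth₀ : ContDiff ℝ (⊤ : ℕ∞) θ₀
  smooth₁ : ContDiff ℝ (⊤ : ℕ∞) θ₁
  mem₀ : ∀ x, θ₀ x ∈ Set.Icc (0 : ℝ) 1
  mem₁ : ∀ x, θ₁ x ∈ Set.Icc (0 : ℝ) 1
  partition : ∀ x, θ₀ x ^ 2 + θ₁ x ^ 2 = 1
  support₁ : ∀ x, 2 * d < enorm3 x → θ₁ x = 0
  one₁ : ∀ x, enorm3 x ≤ d → θ₁ x = 1
  grad₀ : ∀ x, enorm3 (grad3 θ₀ x) ≤ c₁ / d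
  grad₁ : ∀ x, enorm3 (grad3 θ₁ x) ≤ c₁ / d

/-- The localized potential W_loc(x) = Z/|x| + |∇θ₀(x)|² + |∇θ₁(x)|². -/
def Wloc (Z : ℝ) (θ₀ θ₁ : (Fin 3 → ℝ) → ℝ) (x : Fin 3 → ℝ) : ℝ :=
  Z / enorm3 x + (∑ k, grad3 θ₀ x k ^ 2) + (∑ k, grad3 θ₁ x k ^ 2)

/-- The wave function Ψ multiplied by the cutoff θ evaluated at the j-th
position variable. -/
def cutMul (N : ℕ) (θ : (Fin 3 → ℝ) → ℝ) (j : Fin N)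
    (Ψ : (Fin N → Fin 3 → ℝ) → (Fin N → Fin 2) → ℂ) :
    (Fin N → Fin 3 → ℝ) → (Fin N → Fin 2) → ℂ :=
  fun x s => (θ (x j) : ℂ) * Ψ x s

/-- The Coulomb-tooth functional 𝓔¹_N[Ψ,A]. -/
def toothEnergy (N : ℕ) (Z α r : ℝ) (θ₀ θ₁ : (Fin 3 → ℝ) → ℝ)
    (A : (Fin 3 → ℝ) → Fin 3 → ℝ)
    (Ψ : (Fin N → Fin 3 → ℝ) → (Fin N → Fin 2) → ℂ) : ℝ :=
  (∑ j : Fin N, (pauliKin N A j (cutMul N θ₁ j Ψ)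
      - potInt N (fun x => Wloc Z θ₀ θ₁ (x j) * θ₁ (x j) ^ 2) Ψ))
    + (16 * Real.pi * α ^ 2)⁻¹ * ∫ x in ball3 (3 * r), gradSq A x

open scoped ENNReal NNReal
open Metric

/-- Physical space `ℝ³`, with its sup norm. -/
abbrev E3 := Fin 3 → ℝ

theorem lintegral_norm_rpow_neg_ball_le {p : ℝ} (hp3 : p < 3) :
    ∃ C : ℝ, 0 < C ∧ ∀ R : ℝ, 0 < R →
      ∫⁻ x in ball (0 : E3) R, ENNReal.ofReal (‖x‖ ^ (-p)) ≤
        ENNReal.ofReal (C * R ^ (3 - p)) := by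
  refine ⟨3 * (volume.real (ball (0 : E3) 1)) * (3 - p)⁻¹, ?_, fun R hR => ?_⟩
  · have : 0 < volume.real (ball (0 : E3) 1) :=
      ENNReal.toReal_pos (measure_ball_pos _ _ one_pos).ne' measure_ball_lt_top.ne
    have := sub_pos.2 hp3
    positivity
  have hdim : Module.finrank ℝ E3 = 3 := by simp
  have hpow : ∀ y : ℝ, 0 < y → y ^ 2 * y ^ (-p) = y ^ (2 - p) := fun y hy => by
    rw [← Real.rpow_natCast y 2, ← Real.rpow_add hy]; norm_num [sub_eq_add_neg]
  have hinteg : IntegrableOn (fun y : ℝ => y ^ 2 • y ^ (-p)) (Set.Ioo 0 R) := by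
    have h := intervalIntegral.intervalIntegrable_rpow' (a := 0) (b := R) (r := 2 - p)
      (by linarith)
    rw [intervalIntegrable_iff_integrableOn_Ioo_of_le hR.le] at h
    exact h.congr_fun (fun y hy => (hpow y hy.1).symm) measurableSet_Ioo
  have hI : IntegrableOn (fun x : E3 => ‖x‖ ^ (-p)) (ball 0 R) := by
    rw [integrableOn_fun_norm_addHaar volume (f := fun y : ℝ => y ^ (-p)), hdim]
    exact hinteg
  rw [← ofReal_integral_eq_lintegral_ofReal hI
    (Filter.Eventually.of_forall fun x => by positivity)]
  apply ENNReal.ofReal_le_ofReal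
  apply le_of_eq
  have h1 : ∫ x in ball (0 : E3) R, ‖x‖ ^ (-p) =
      ∫ x : E3, (Set.Iio R).indicator (fun y : ℝ => y ^ (-p)) ‖x‖ := by
    rw [← integral_indicator measurableSet_ball]
    congr 1 with x
    simp [Set.indicator]
  rw [h1, integral_fun_norm_addHaar, hdim]
  have h2 : ∫ y in Set.Ioi (0 : ℝ), y ^ (3 - 1) • (Set.Iio R).indicator (fun y => y ^ (-p)) y
      = R ^ (3 - p) * (3 - p)⁻¹ := by
    have : ∀ y ∈ Set.Ioi (0 : ℝ), y ^ (3 - 1) • (Set.Iio R).indicator (fun y => y ^ (-p)) y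
        = (Set.Iio R).indicator (fun y => y ^ (2 - p)) y := fun y hy => by
      by_cases h : y < R <;> simp [h, hpow y hy]
    rw [setIntegral_congr_fun measurableSet_Ioi this, integral_indicator measurableSet_Iio,
      Measure.restrict_restrict measurableSet_Iio, Set.Iio_inter_Ioi,
      ← integral_Ioc_eq_integral_Ioo, ← intervalIntegral.integral_of_le hR.le,
      integral_rpow (Or.inl (by linarith)), Real.zero_rpow (by linarith)]
    rw [show 2 - p + 1 = 3 - p by ring]; ring
  rw [h2]
  simp only [nsmul_eq_mul, smul_eq_mul]
  push_cast
  ring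

theorem eLpNorm_six_le_fderiv (F : Type*) [NormedAddCommGroup F] [NormedSpace ℝ F]
    [FiniteDimensional ℝ F] :
    ∃ C : ℝ≥0, ∀ u : E3 → F, ContDiff ℝ 1 u → HasCompactSupport u →
      eLpNorm u 6 volume ≤ C * eLpNorm (fderiv ℝ u) 2 volume := by
  refine ⟨SNormLESNormFDerivOfEqConst F (volume : Measure E3) 2, fun u hu hc => ?_⟩
  have := eLpNorm_le_eLpNorm_fderiv_of_eq (F := F) (volume : Measure E3) hu hc
    (p := 2) (p' := 6) (by norm_num) (by simp) (by simp; norm_num)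
  simpa using this

theorem eLpNorm_two_sq {X F : Type*} [MeasurableSpace X] [NormedAddCommGroup F]
    (μ : Measure X) (f : X → F) : eLpNorm f 2 μ ^ 2 = ∫⁻ x, ‖f x‖ₑ ^ 2 ∂μ := by
  have := eLpNorm_nnreal_pow_eq_lintegral (μ := μ) (f := f) (p := 2) (by norm_num)
  simpa using this

/-- Hölder's inequality combined with the Sobolev inequality. -/
theorem lintegral_mul_sq_le_sobolev :
    ∃ C : ℝ≥0, ∀ (w : E3 → ℝ≥0∞) (u : E3 → ℂ), AEMeasurable w → ContDiff ℝ 1 u →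
      HasCompactSupport u →
      ∫⁻ x, w x * ‖u x‖ₑ ^ 2 ≤
        C * (∫⁻ x, w x ^ (3 / 2 : ℝ)) ^ (2 / 3 : ℝ) * ∫⁻ x, ‖fderiv ℝ u x‖ₑ ^ 2 := by
  obtain ⟨C, hC⟩ := eLpNorm_six_le_fderiv ℂ
  refine ⟨C ^ 2, fun w u hw hu hc => ?_⟩
  have h := ENNReal.lintegral_mul_le_Lp_mul_Lq (volume : Measure E3)
    (p := 3 / 2) (q := 3) ⟨by norm_num, by norm_num, by norm_num⟩ hw
    (g := fun x => ‖u x‖ₑ ^ 2) (hu.continuous.enorm.measurable.pow_const 2 |>.aemeasurable)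
  have h6 : (∫⁻ x, (‖u x‖ₑ ^ 2) ^ (3 : ℝ)) ^ (1 / 3 : ℝ) = eLpNorm u 6 volume ^ 2 := by
    rw [eLpNorm_eq_lintegral_rpow_enorm_toReal (by norm_num) (by norm_num), ← ENNReal.rpow_natCast,
      ← ENNReal.rpow_mul]
    simp only [← ENNReal.rpow_natCast, ← ENNReal.rpow_mul]
    norm_num
  rw [h6] at h
  calc _ ≤ _ := h
    _ ≤ (∫⁻ x, w x ^ (3 / 2 : ℝ)) ^ (2 / 3 : ℝ) * (C * eLpNorm (fderiv ℝ u) 2 volume) ^ 2 := by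
        norm_num
        gcongr
        exact hC u hu hc
    _ = _ := by
        rw [mul_pow, eLpNorm_two_sq]; push_cast; ring

theorem ENNReal.add_sq_le_two_mul (a b : ℝ≥0∞) : (a + b) ^ 2 ≤ 2 * a ^ 2 + 2 * b ^ 2 := by
  rcases eq_or_ne a ⊤ with rfl | ha
  · simp
  rcases eq_or_ne b ⊤ with rfl | hb
  · simp
  lift a to ℝ≥0 using ha
  lift b to ℝ≥0 using hb
  norm_cast
  rw [← NNReal.coe_le_coe]
  push_cast
  nlinarith [sq_nonneg ((a : ℝ) - b)]

theorem sq_lintegral_le_mul_lintegral_sq {X : Type*} [MeasurableSpace X] (μ : Measure X)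
    {f : X → ℝ≥0∞} (hf : AEMeasurable f μ) :
    (∫⁻ x, f x ∂μ) ^ 2 ≤ μ Set.univ * ∫⁻ x, f x ^ 2 ∂μ := by
  have h := ENNReal.lintegral_mul_le_Lp_mul_Lq μ (p := 2) (q := 2)
    ⟨by norm_num, by norm_num, by norm_num⟩ hf (g := fun _ => 1) aemeasurable_const
  simp only [Pi.mul_apply, mul_one, ENNReal.one_rpow, lintegral_const, one_mul] at h
  calc (∫⁻ x, f x ∂μ) ^ 2
      ≤ ((∫⁻ x, f x ^ (2 : ℝ) ∂μ) ^ (1 / 2 : ℝ) * μ Set.univ ^ (1 / 2 : ℝ)) ^ 2 := by gcongr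
    _ = μ Set.univ * ∫⁻ x, f x ^ 2 ∂μ := by
      rw [mul_pow, ← ENNReal.rpow_natCast, ← ENNReal.rpow_mul, ← ENNReal.rpow_natCast,
        ← ENNReal.rpow_mul]
      simp [mul_comm]

theorem enorm_sub_sq_le_lintegral_fderiv {F : Type*} [NormedAddCommGroup F] [NormedSpace ℝ F]
    [CompleteSpace F] {u : E3 → F} (hu : ContDiff ℝ 1 u) (x h : E3) :
    ‖u (x + h) - u x‖ₑ ^ 2 ≤
      ‖h‖ₑ ^ 2 * ∫⁻ t in Set.Ioc (0 : ℝ) 1, ‖fderiv ℝ u (x + t • h)‖ₑ ^ 2 := by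
  have hc : Continuous fun t : ℝ => fderiv ℝ u (x + t • h) :=
    (hu.continuous_fderiv one_ne_zero).comp (by fun_prop)
  have hd : ∀ t : ℝ, HasDerivAt (fun t : ℝ => u (x + t • h)) (fderiv ℝ u (x + t • h) h) t := by
    intro t
    have h1 : HasDerivAt (fun t : ℝ => x + t • h) h t := by
      simpa using ((hasDerivAt_id t).smul_const h).const_add x
    exact ((hu.differentiable one_ne_zero _).hasFDerivAt).comp_hasDerivAt t h1
  have hftc := intervalIntegral.integral_eq_sub_of_hasDerivAt (a := 0) (b := 1)
    (fun t _ => hd t) ((hc.clm_apply continuous_const).intervalIntegrable _ _)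
  simp only [one_smul, zero_smul, add_zero] at hftc
  rw [← hftc, intervalIntegral.integral_of_le zero_le_one]
  calc ‖∫ t in Set.Ioc (0 : ℝ) 1, fderiv ℝ u (x + t • h) h‖ₑ ^ 2
      ≤ (∫⁻ t in Set.Ioc (0 : ℝ) 1, ‖h‖ₑ * ‖fderiv ℝ u (x + t • h)‖ₑ) ^ 2 := by
        gcongr
        refine (enorm_integral_le_lintegral_enorm _).trans (lintegral_mono fun t => ?_)
        rw [mul_comm]
        exact ContinuousLinearMap.le_opENorm _ _
    _ ≤ ∫⁻ t in Set.Ioc (0 : ℝ) 1, (‖h‖ₑ * ‖fderiv ℝ u (x + t • h)‖ₑ) ^ 2 :=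
by
        refine (sq_lintegral_le_mul_lintegral_sq _
          (hc.enorm.measurable.const_mul _).aemeasurable).trans_eq ?_
        simp
    _ = _ := by
        simp_rw [mul_pow]
        rw [lintegral_const_mul _ (hc.enorm.measurable.pow_const 2)]

/-- A two-point form of the Poincaré inequality on a convex set. -/
theorem lintegral_lintegral_enorm_sub_sq_le {F : Type*} [NormedAddCommGroup F] [NormedSpace ℝ F]
    [CompleteSpace F] {u : E3 → F} (hu : ContDiff ℝ 1 u) {q : Set E3} (hq : Convex ℝ q)
    (hqm : MeasurableSet q) {s : ℝ} (hs : 0 ≤ s) (hqs : ∀ x ∈ q, ∀ y ∈ q, ‖x - y‖ ≤ s) :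
    ∫⁻ x in q, ∫⁻ y in q, ‖u x - u y‖ₑ ^ 2 ≤
      ENNReal.ofReal (8 * s ^ 5) * ∫⁻ x in q, ‖fderiv ℝ u x‖ₑ ^ 2 := by
  have hcf : Continuous (fderiv ℝ u) := hu.continuous_fderiv one_ne_zero
  set D : E3 → ℝ≥0∞ := q.indicator fun x => ‖fderiv ℝ u x‖ₑ ^ 2 with hD
  have hDm : Measurable D := (hcf.enorm.measurable.pow_const 2).indicator hqm
  have key : ∀ x h : E3, q.indicator 1 x * q.indicator 1 (x + h) * ‖u x - u (x + h)‖ₑ ^ 2 ≤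
      (closedBall (0 : E3) s).indicator (fun _ => ENNReal.ofReal (s ^ 2)) h *
        ∫⁻ t in Set.Ioc (0 : ℝ) 1, D (x + t • h) := by
    intro x h
    by_cases hx : x ∈ q
    swap
    · simp [hx]
    by_cases hxh : x + h ∈ q
    swap
    · simp [hxh]
    have hhs : ‖h‖ ≤ s := by simpa using hqs _ hxh _ hx
    have hmem : h ∈ closedBall (0 : E3) s := by simpa using hhs
    simp only [hx, hxh, hmem, Set.indicator_of_mem, Pi.one_apply, one_mul]
    rw [enorm_sub_rev]
    refine (enorm_sub_sq_le_lintegral_fderiv hu x h).trans ?_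
    gcongr ?_ * ?_
    · rw [ENNReal.ofReal_pow hs, ← ofReal_norm]
      gcongr
    · apply setLIntegral_mono' measurableSet_Ioc
      intro t ht
      have : x + t • h ∈ q := by
        have := hq hx hxh (a := 1 - t) (b := t) (by linarith [ht.2]) ht.1.le (by ring)
        convert this using 1
        module
      simp [hD, this]
  have hucm : Continuous fun p : E3 × E3 => ‖u p.1 - u p.2‖ₑ ^ 2 := by
    have := hu.continuous
    fun_prop
  calc ∫⁻ x in q, ∫⁻ y in q, ‖u x - u y‖ₑ ^ 2
      = ∫⁻ x, ∫⁻ y, q.indicator 1 x * q.indicator 1 y * ‖u x - u y‖ₑ ^ 2 := by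
        rw [← lintegral_indicator hqm]
        congr 1 with x
        by_cases hx : x ∈ q
        · simp only [hx, Set.indicator_of_mem, Pi.one_apply, one_mul]
          rw [← lintegral_indicator hqm]
          congr 1 with y
          by_cases hy : y ∈ q <;> simp [hy]
        · simp [hx]
    _ = ∫⁻ x, ∫⁻ h, q.indicator 1 x * q.indicator 1 (x + h) * ‖u x - u (x + h)‖ₑ ^ 2 := by
        congr 1 with x
        exact (lintegral_add_left_eq_self
          (fun y => q.indicator 1 x * q.indicator 1 y * ‖u x - u y‖ₑ ^ 2) x).symm
    _ ≤ ∫⁻ x, ∫⁻ h, (closedBall (0 : E3) s).indicator (fun _ => ENNReal.ofReal (s ^ 2)) h *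
        ∫⁻ t in Set.Ioc (0 : ℝ) 1, D (x + t • h) :=
        lintegral_mono fun x => lintegral_mono fun h => key x h
    _ = ∫⁻ h, (closedBall (0 : E3) s).indicator (fun _ => ENNReal.ofReal (s ^ 2)) h *
        ∫⁻ x, ∫⁻ t in Set.Ioc (0 : ℝ) 1, D (x + t • h) := by
        have hm1 : Measurable fun z : (E3 × E3) × ℝ => D (z.1.1 + z.2 • z.1.2) :=
          hDm.comp (by fun_prop)
        have hm2 := hm1.lintegral_prod_right' (ν := volume.restrict (Set.Ioc (0 : ℝ) 1))
        have hmI : Measurable ((closedBall (0 : E3) s).indicator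
            (fun _ => ENNReal.ofReal (s ^ 2))) := measurable_const.indicator measurableSet_closedBall
        rw [lintegral_lintegral_swap]
        · congr 1 with h
          rw [lintegral_const_mul]
          exact hm2.comp (measurable_id.prodMk measurable_const)
        · exact ((hmI.comp measurable_snd).mul hm2).aemeasurable
    _ = ∫⁻ h, (closedBall (0 : E3) s).indicator (fun _ => ENNReal.ofReal (s ^ 2)) h *
        ∫⁻ x, D x := by
        congr 1 with h
        congr 1
        rw [lintegral_lintegral_swap]
        · simp_rw [lintegral_add_right_eq_self]
          simp
        · exact (hDm.comp (by fun_prop)).aemeasurable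
    _ = _ := by
        rw [lintegral_mul_const _ (measurable_const.indicator measurableSet_closedBall),
          lintegral_indicator measurableSet_closedBall, setLIntegral_const,
          Real.volume_pi_closedBall _ hs, hD, lintegral_indicator hqm,
          ← ENNReal.ofReal_mul (by positivity)]
        congr 2
        simp
        ring

/-- Poincaré inequality with the mean value controlled separately. -/
theorem lintegral_sq_le_mean_add_poincare {u : E3 → ℂ} (hu : ContDiff ℝ 1 u) {q : Set E3}
    (hq : Convex ℝ q) (hqm : MeasurableSet q) {s : ℝ} (hs : 0 < s)
    (hqs : ∀ x ∈ q, ∀ y ∈ q, ‖x - y‖ ≤ s) (hvol : volume q = ENNReal.ofReal (s ^ 3))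
    (hui : IntegrableOn u q) :
    ∫⁻ x in q, ‖u x‖ₑ ^ 2 ≤ ENNReal.ofReal (2 / s ^ 3) * ‖∫ x in q, u x‖ₑ ^ 2 +
      ENNReal.ofReal (16 * s ^ 2) * ∫⁻ x in q, ‖fderiv ℝ u x‖ₑ ^ 2 := by
  have hfin : volume q ≠ ⊤ := by rw [hvol]; exact ENNReal.ofReal_ne_top
  have hs3 : 0 < s ^ 3 := by positivity
  have hpt : ∀ x, ENNReal.ofReal (s ^ 3) ^ 2 * ‖u x‖ₑ ^ 2 ≤
      2 * ‖∫ y in q, u y‖ₑ ^ 2 + 2 * ENNReal.ofReal (s ^ 3) * ∫⁻ y in q, ‖u x - u y‖ₑ ^ 2 := by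
    intro x
    have hconst : IntegrableOn (fun _ : E3 => u x) q := integrableOn_const hfin
    have h1 : (s ^ 3 : ℝ) • u x = (∫ y in q, u y) + ∫ y in q, (u x - u y) := by
      rw [integral_sub hconst hui, setIntegral_const, Measure.real, hvol,
        ENNReal.toReal_ofReal hs3.le]
      ring
    have h2 : ENNReal.ofReal (s ^ 3) * ‖u x‖ₑ ≤
        ‖∫ y in q, u y‖ₑ + ∫⁻ y in q, ‖u x - u y‖ₑ := by
      have h3 : ‖(s ^ 3 : ℝ) • u x‖ₑ = ENNReal.ofReal (s ^ 3) * ‖u x‖ₑ := by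
        rw [enorm_smul, Real.enorm_of_nonneg hs3.le]
      rw [← h3, h1]
      exact (enorm_add_le _ _).trans (add_le_add le_rfl (enorm_integral_le_lintegral_enorm _))
    have hmeas : Measurable fun y => ‖u x - u y‖ₑ := by
      have := hu.continuous
      exact (by fun_prop : Continuous fun y => ‖u x - u y‖ₑ).measurable
    have h4 := sq_lintegral_le_mul_lintegral_sq (volume.restrict q) hmeas.aemeasurable
    rw [Measure.restrict_apply_univ, hvol] at h4
    calc _ = (ENNReal.ofReal (s ^ 3) * ‖u x‖ₑ) ^ 2 := by rw [mul_pow]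
      _ ≤ (‖∫ y in q, u y‖ₑ + ∫⁻ y in q, ‖u x - u y‖ₑ) ^ 2 := by gcongr
      _ ≤ 2 * ‖∫ y in q, u y‖ₑ ^ 2 + 2 * (∫⁻ y in q, ‖u x - u y‖ₑ) ^ 2 := 
        ENNReal.add_sq_le_two_mul _ _
      _ ≤ _ := by rw [mul_assoc]; gcongr
  have hcont := hu.continuous
  have hinteg := setLIntegral_mono' (μ := volume) hqm (fun x _ => hpt x)
  have hm1 : Measurable fun x => ‖u x‖ₑ ^ 2 := hcont.enorm.measurable.pow_const 2
  have hm2 : Measurable fun x => ∫⁻ y in q, ‖u x - u y‖ₑ ^ 2 :=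
    Measurable.lintegral_prod_right' (f := fun p : E3 × E3 => ‖u p.1 - u p.2‖ₑ ^ 2)
      (by fun_prop)
  rw [lintegral_const_mul _ hm1, lintegral_add_left measurable_const, setLIntegral_const,
    lintegral_const_mul _ hm2, hvol] at hinteg
  have hP := lintegral_lintegral_enorm_sub_sq_le hu hq hqm hs.le hqs
  have hinv : ENNReal.ofReal ((s ^ 3)⁻¹ ^ 2) * ENNReal.ofReal (s ^ 3) ^ 2 = 1 := by
    rw [← ENNReal.ofReal_pow hs3.le, ← ENNReal.ofReal_mul (by positivity)]
    rw [← ENNReal.ofReal_one]; congr 1; field_simp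
  calc ∫⁻ x in q, ‖u x‖ₑ ^ 2
      = ENNReal.ofReal ((s ^ 3)⁻¹ ^ 2) * (ENNReal.ofReal (s ^ 3) ^ 2 *
          ∫⁻ x in q, ‖u x‖ₑ ^ 2) := by rw [← mul_assoc, hinv, one_mul]
    _ ≤ ENNReal.ofReal ((s ^ 3)⁻¹ ^ 2) * (2 * ‖∫ y in q, u y‖ₑ ^ 2 * ENNReal.ofReal (s ^ 3) +
          2 * ENNReal.ofReal (s ^ 3) *
            (ENNReal.ofReal (8 * s ^ 5) * ∫⁻ x in q, ‖fderiv ℝ u x‖ₑ ^ 2)) := by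
        gcongr
        exact hinteg.trans (by gcongr)
    _ = (ENNReal.ofReal ((s ^ 3)⁻¹ ^ 2) * ENNReal.ofReal 2 * ENNReal.ofReal (s ^ 3)) *
          ‖∫ y in q, u y‖ₑ ^ 2 + (ENNReal.ofReal ((s ^ 3)⁻¹ ^ 2) * ENNReal.ofReal 2 *
          ENNReal.ofReal (s ^ 3) * ENNReal.ofReal (8 * s ^ 5)) *
            ∫⁻ x in q, ‖fderiv ℝ u x‖ₑ ^ 2 := by
        rw [ENNReal.ofReal_ofNat]; ring
    _ = _ := by
        simp only [← ENNReal.ofReal_mul (show (0:ℝ) ≤ (s ^ 3)⁻¹ ^ 2 by positivity),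
          ← ENNReal.ofReal_mul (show (0:ℝ) ≤ (s ^ 3)⁻¹ ^ 2 * 2 by positivity),
          ← ENNReal.ofReal_mul (show (0:ℝ) ≤ (s ^ 3)⁻¹ ^ 2 * 2 * s ^ 3 by positivity)]
        congr 3 <;> field_simp
        ring

/-- Poincaré inequality around a suitable value of the function. -/
theorem exists_lintegral_enorm_sub_sq_le {F : Type*} [NormedAddCommGroup F] [NormedSpace ℝ F]
    [CompleteSpace F] {u : E3 → F} (hu : ContDiff ℝ 1 u) {q : Set E3}
    (hq : Convex ℝ q) (hqm : MeasurableSet q) {s : ℝ} (hs : 0 < s)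
    (hqs : ∀ x ∈ q, ∀ y ∈ q, ‖x - y‖ ≤ s) (hvol : volume q = ENNReal.ofReal (s ^ 3)) :
    ∃ y, ∫⁻ x in q, ‖u x - u y‖ₑ ^ 2 ≤
      ENNReal.ofReal (8 * s ^ 2) * ∫⁻ x in q, ‖fderiv ℝ u x‖ₑ ^ 2 := by
  have hfin : volume q ≠ ⊤ := by rw [hvol]; exact ENNReal.ofReal_ne_top
  have hs3 : 0 < s ^ 3 := by positivity
  have hne : volume q ≠ 0 := by rw [hvol]; simpa using hs3
  have hcont := hu.continuous
  have hc2 : Continuous fun p : E3 × E3 => ‖u p.2 - u p.1‖ₑ ^ 2 := by fun_prop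
  have hm : Measurable fun x => ∫⁻ y in q, ‖u y - u x‖ₑ ^ 2 :=
    Measurable.lintegral_prod_right' (f := fun p : E3 × E3 => ‖u p.2 - u p.1‖ₑ ^ 2)
      hc2.measurable
  have h5 : ∫⁻ x in q, ∫⁻ y in q, ‖u y - u x‖ₑ ^ 2 =
      ∫⁻ x in q, ∫⁻ y in q, ‖u x - u y‖ₑ ^ 2 := by
    simp_rw [enorm_sub_rev]
  obtain ⟨y, -, hy⟩ := exists_le_setLAverage (s := q) (μ := volume) hne hfin
    (f := fun x => ∫⁻ y in q, ‖u y - u x‖ₑ ^ 2) hm.aemeasurable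
  refine ⟨y, hy.trans ?_⟩
  have hP := lintegral_lintegral_enorm_sub_sq_le hu hq hqm hs.le hqs
  rw [setLAverage_eq, h5, hvol]
  refine ENNReal.div_le_of_le_mul (hP.trans (le_of_eq ?_))
  rw [mul_right_comm, ← ENNReal.ofReal_mul (by positivity)]
  congr 2
  ring

theorem HasCompactSupport.fderiv_apply_const {E F : Type*} [NormedAddCommGroup E]
    [NormedSpace ℝ E] [NormedAddCommGroup F] [NormedSpace ℝ F] {f : E → F}
    (hf : HasCompactSupport f) (a : E) : HasCompactSupport fun x => fderiv ℝ f x a :=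
  (hf.fderiv ℝ).comp_left (g := fun L : E →L[ℝ] F => L a) (by simp)

theorem integral_fderiv_mul_fderiv_eq {f w : E3 → ℂ} (hf : ContDiff ℝ 2 f)
    (hw : ContDiff ℝ 2 w) (hfc : HasCompactSupport f) (a b : E3) :
    ∫ x, fderiv ℝ f x a * fderiv ℝ w x b = -∫ x, f x * fderiv ℝ (fderiv ℝ w) x a b := by
  have hw' : ContDiff ℝ 1 (fderiv ℝ w) := hw.fderiv_right (by norm_num)
  have hf' : Continuous (fderiv ℝ f) := hf.continuous_fderiv (by norm_num)
  have hw'' : Continuous (fderiv ℝ (fderiv ℝ w)) := hw'.continuous_fderiv (by norm_num)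
  have hfd := hf.continuous
  have hwd := hw'.continuous
  have hd : ∀ x, fderiv ℝ (fun x => fderiv ℝ w x b) x a = fderiv ℝ (fderiv ℝ w) x a b := by
    intro x
    rw [fderiv_clm_apply (hw'.differentiable (by norm_num) x) (by fun_prop)]
    simp
  have h := integral_mul_fderiv_eq_neg_fderiv_mul_of_integrable (μ := (volume : Measure E3))
    (f := f) (g := fun x => fderiv ℝ w x b) (v := a)
    (Continuous.integrable_of_hasCompactSupport (by fun_prop)
      ((hfc.fderiv_apply_const a).mul_right))
    (Continuous.integrable_of_hasCompactSupport (by simp_rw [hd]; fun_prop) hfc.mul_right)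
    (Continuous.integrable_of_hasCompactSupport (by fun_prop) hfc.mul_right)
    (fun x _ => hf.differentiable (by norm_num) x)
    (fun x _ => (hw'.clm_apply contDiff_const).differentiable (by norm_num) x)
  simp_rw [hd] at h
  rw [h, neg_neg]

theorem integral_fderiv_mul_fderiv_comm {f w : E3 → ℂ} (hf : ContDiff ℝ 2 f)
    (hw : ContDiff ℝ 2 w) (hfc : HasCompactSupport f) (a b : E3) :
    ∫ x, fderiv ℝ f x a * fderiv ℝ w x b = ∫ x, fderiv ℝ f x b * fderiv ℝ w x a := by
  rw [integral_fderiv_mul_fderiv_eq hf hw hfc, integral_fderiv_mul_fderiv_eq hf hw hfc]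
  congr 2 with x
  rw [(hw.contDiffAt (x := x)).isSymmSndFDerivAt (by simp) a b]

/-- The antisymmetrized product of two partial derivatives, a total derivative. -/
def derivBracket (f g : E3 → ℂ) (j k : Fin 3) (x : E3) : ℂ :=
  fderiv ℝ f x (Pi.single j 1) * starRingEnd ℂ (fderiv ℝ g x (Pi.single k 1)) -
    fderiv ℝ f x (Pi.single k 1) * starRingEnd ℂ (fderiv ℝ g x (Pi.single j 1))

theorem fderiv_star_comp {g : E3 → ℂ} (hg : Differentiable ℝ g) (x v : E3) :
    fderiv ℝ (fun y => starRingEnd ℂ (g y)) x v = starRingEnd ℂ (fderiv ℝ g x v) := by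
  have h := (Complex.conjCLE.toContinuousLinearMap.hasFDerivAt.comp x (hg x).hasFDerivAt).fderiv
  have h2 : (fun y => starRingEnd ℂ (g y)) = (Complex.conjCLE.toContinuousLinearMap ∘ g) := by
    ext; simp
  rw [h2, h]
  simp

theorem derivBracket_integrable_and_integral {f g : E3 → ℂ} (hf : ContDiff ℝ 2 f)
    (hg : ContDiff ℝ 2 g) (hfc : HasCompactSupport f) (j k : Fin 3) :
    Integrable (derivBracket f g j k) ∧ ∫ x, derivBracket f g j k x = 0 := by
  have hf' : Continuous (fderiv ℝ f) := hf.continuous_fderiv (by norm_num)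
  have hg' : Continuous (fderiv ℝ g) := hg.continuous_fderiv (by norm_num)
  have hi : ∀ a b : E3, Integrable fun x =>
      fderiv ℝ f x a * starRingEnd ℂ (fderiv ℝ g x b) := fun a b =>
    Continuous.integrable_of_hasCompactSupport
      ((hf'.clm_apply continuous_const).mul
        (Complex.continuous_conj.comp (hg'.clm_apply continuous_const)))
      (hfc.fderiv_apply_const a).mul_right
  refine ⟨(hi _ _).sub (hi _ _), ?_⟩
  unfold derivBracket
  rw [integral_sub (hi _ _) (hi _ _), sub_eq_zero]
  have hw : ContDiff ℝ 2 fun y => starRingEnd ℂ (g y) :=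
    Complex.conjCLE.contDiff.comp hg
  have := integral_fderiv_mul_fderiv_comm hf hw hfc (Pi.single j 1) (Pi.single k 1)
  simpa only [fderiv_star_comp (hg.differentiable (by norm_num))] using this

theorem lintegral_fderiv_le_dirac {h : Fin 2 → E3 → ℂ} (hh : ∀ t, ContDiff ℝ 2 (h t))
    (hc : ∀ t, HasCompactSupport (h t)) :
    ∫⁻ x, ∑ t, ‖fderiv ℝ (h t) x‖ₑ ^ 2 ≤
      3 * ∫⁻ x, ∑ s, ‖∑ k, ∑ t, pauli k s t * fderiv ℝ (h t) x (Pi.single k 1)‖ₑ ^ 2 := by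
  have hh' : ∀ t, Continuous (fderiv ℝ (h t)) := fun t => (hh t).continuous_fderiv (by norm_num)
  have key : ∀ x, ∑ s, ‖∑ k, ∑ t, pauli k s t * fderiv ℝ (h t) x (Pi.single k 1)‖ ^ 2 =
      ∑ t, ∑ k, ‖fderiv ℝ (h t) x (Pi.single k 1)‖ ^ 2 +
      (Complex.I * derivBracket (h 1) (h 1) 0 1 x - Complex.I * derivBracket (h 0) (h 0) 0 1 x +
        2 * derivBracket (h 1) (h 0) 0 2 x - 2 * Complex.I * derivBracket (h 1) (h 0) 1 2 x).re := by
    intro x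
    simp only [Fin.sum_univ_three, Fin.sum_univ_two, pauli, derivBracket, ← Complex.normSq_eq_norm_sq,
      Complex.normSq_apply]
    simp
    ring
  set B : E3 → ℂ := fun x =>
    Complex.I * derivBracket (h 1) (h 1) 0 1 x - Complex.I * derivBracket (h 0) (h 0) 0 1 x +
        2 * derivBracket (h 1) (h 0) 0 2 x - 2 * Complex.I * derivBracket (h 1) (h 0) 1 2 x with hB
  have b1 := derivBracket_integrable_and_integral (hh 1) (hh 1) (hc 1) 0 1
  have b2 := derivBracket_integrable_and_integral (hh 0) (hh 0) (hc 0) 0 1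
  have b3 := derivBracket_integrable_and_integral (hh 1) (hh 0) (hc 1) 0 2
  have b4 := derivBracket_integrable_and_integral (hh 1) (hh 0) (hc 1) 1 2
  have c1 := b1.1.const_mul Complex.I
  have c2 := b2.1.const_mul Complex.I
  have c3 := b3.1.const_mul 2
  have c4 := b4.1.const_mul (2 * Complex.I)
  have hBi : Integrable B := ((c1.sub c2).add c3).sub c4
  have hB0 : ∫ x, B x = 0 := by
    have e1 := integral_sub ((c1.sub c2).add c3) c4
    have e2 := integral_add (c1.sub c2) c3
    have e3 := integral_sub c1 c2
    simp only [Pi.add_apply, Pi.sub_apply] at e1 e2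
    rw [hB, e1, e2, e3]
    simp only [integral_const_mul, b1.2, b2.2, b3.2, b4.2]
    simp
  have hreal : ∫ x, (B x).re = 0 := by
    have := integral_re hBi
    simp only [RCLike.re_to_complex] at this
    rw [this, hB0]; rfl
  set S : E3 → ℝ := fun x => ∑ t, ∑ k, ‖fderiv ℝ (h t) x (Pi.single k 1)‖ ^ 2 with hS
  have hSi : Integrable S := by
    refine integrable_finsetSum _ fun t _ => integrable_finsetSum _ fun k _ => ?_
    refine Continuous.integrable_of_hasCompactSupport
      (((hh' t).clm_apply continuous_const).norm.pow 2) ?_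
    exact ((hc t).fderiv_apply_const (Pi.single k 1)).comp_left (g := fun z : ℂ => ‖z‖ ^ 2) (by simp)
  have hPi : ∫ x, ∑ s, ‖∑ k, ∑ t, pauli k s t * fderiv ℝ (h t) x (Pi.single k 1)‖ ^ 2 =
      ∫ x, S x := by
    simp_rw [key]
    have := integral_add hSi hBi.re
    simp only [RCLike.re_to_complex] at this
    rw [hreal, add_zero] at this
    exact this
  have hPint : Integrable fun x =>
      ∑ s, ‖∑ k, ∑ t, pauli k s t * fderiv ℝ (h t) x (Pi.single k 1)‖ ^ 2 := by
    simp_rw [key]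
    exact hSi.add hBi.re
  have hpt : ∀ x, ∑ t, ‖fderiv ℝ (h t) x‖ₑ ^ 2 ≤ 3 * ENNReal.ofReal (S x) := by
    intro x
    have e : ∀ t, ‖fderiv ℝ (h t) x‖ ^ 2 ≤ 3 * ∑ k, ‖fderiv ℝ (h t) x (Pi.single k 1)‖ ^ 2 := by
      intro t
      have : ‖fderiv ℝ (h t) x‖ ≤ ∑ k, ‖fderiv ℝ (h t) x (Pi.single k 1)‖ := by
        refine ContinuousLinearMap.opNorm_le_bound _ (by positivity) fun v => ?_
        conv_lhs => rw [← Finset.univ_sum_single v, map_sum]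
        rw [Finset.sum_mul]
        refine (norm_sum_le _ _).trans (Finset.sum_le_sum fun k _ => ?_)
        have : (Pi.single k (v k) : E3) = v k • Pi.single k 1 := by
          rw [← Pi.single_smul]; simp
        rw [this, map_smul, norm_smul, mul_comm]
        gcongr
        exact norm_le_pi_norm v k
      calc _ ≤ (∑ k, ‖fderiv ℝ (h t) x (Pi.single k 1)‖) ^ 2 := by gcongr
        _ ≤ _ := by
          have := sq_sum_le_card_mul_sum_sq (s := Finset.univ)
            (f := fun k => ‖fderiv ℝ (h t) x (Pi.single k 1)‖)
          simpa using this
    have : ∑ t, ‖fderiv ℝ (h t) x‖ ^ 2 ≤ 3 * S x := by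
      rw [hS, Finset.mul_sum]; exact Finset.sum_le_sum fun t _ => e t
    rw [show (3 : ℝ≥0∞) = ENNReal.ofReal 3 by simp, ← ENNReal.ofReal_mul (by norm_num)]
    refine le_trans (le_of_eq ?_) (ENNReal.ofReal_le_ofReal this)
    rw [ENNReal.ofReal_sum_of_nonneg fun _ _ => by positivity]
    simp only [ENNReal.ofReal_pow (norm_nonneg _), ofReal_norm]
  have hS0 : ∀ x, 0 ≤ S x := fun x => by positivity
  calc _ ≤ ∫⁻ x, 3 * ENNReal.ofReal (S x) := lintegral_mono hpt
    _ = 3 * ENNReal.ofReal (∫ x, S x) := by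
        rw [lintegral_const_mul' _ _ (by simp), ofReal_integral_eq_lintegral_ofReal hSi
          (Filter.Eventually.of_forall hS0)]
    _ = _ := by
        rw [← hPi, ofReal_integral_eq_lintegral_ofReal hPint
          (Filter.Eventually.of_forall fun x => by positivity)]
        congr 2 with x
        rw [ENNReal.ofReal_sum_of_nonneg fun _ _ => by positivity]
        simp only [ENNReal.ofReal_pow (norm_nonneg _), ofReal_norm]

theorem exists_cutoff : ∃ C : ℝ, 0 < C ∧ ∀ (y : E3) (l : ℝ), 0 < l → ∃ χ : E3 → ℝ,
    ContDiff ℝ (⊤ : ℕ∞) χ ∧ (∀ x, 0 ≤ χ x) ∧ (∀ x, χ x ≤ 1) ∧ (∀ x ∈ ball y l, χ x = 1) ∧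
    (∀ x ∉ ball y (2 * l), χ x = 0) ∧ (∀ x, ‖fderiv ℝ χ x‖ ≤ C / l) ∧
    (∀ x ∉ ball y (2 * l), fderiv ℝ χ x = 0) ∧ HasCompactSupport χ := by
  let f : ContDiffBump (0 : E3) := ⟨1, 2, one_pos, one_lt_two⟩
  have hfd : Continuous (fderiv ℝ f) := (f.contDiff (n := 1)).continuous_fderiv one_ne_zero
  obtain ⟨C, hC⟩ := hfd.bounded_above_of_compact_support (f.hasCompactSupport.fderiv ℝ)
  refine ⟨max C 1, lt_max_of_lt_right one_pos, fun y l hl => ?_⟩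
  set L : E3 → E3 := fun x => l⁻¹ • (x - y) with hL
  have hLd : ContDiff ℝ (⊤ : ℕ∞) L := by fun_prop
  have hχ : ContDiff ℝ (⊤ : ℕ∞) (fun x => f (L x)) := f.contDiff.comp hLd
  have hLn : ∀ x, ‖L x‖ = dist x y / l := fun x => by
    simp [hL, norm_smul, abs_of_pos hl, dist_eq_norm, div_eq_inv_mul]
  have h0 : ∀ x, 0 ≤ f (L x) := fun x => f.nonneg
  have hz : ∀ x ∉ ball y (2 * l), f (L x) = 0 := fun x hx => by
    apply f.zero_of_le_dist
    rw [dist_zero_right, hLn]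
    show 2 ≤ _
    rw [le_div_iff₀ hl]; simpa using hx
  refine ⟨fun x => f (L x), hχ, h0, fun x => f.le_one, fun x hx => ?_, hz, fun x => ?_,
    fun x hx => ?_, ?_⟩
  · apply f.one_of_mem_closedBall
    rw [mem_closedBall, dist_zero_right, hLn]
    show _ ≤ 1
    rw [div_le_one hl]
    exact (mem_ball.1 hx).le
  · have hd : HasFDerivAt L (l⁻¹ • ContinuousLinearMap.id ℝ E3) x :=
      ((hasFDerivAt_id x).sub_const y).const_smul l⁻¹
    have h1 : HasFDerivAt f (fderiv ℝ f (L x)) (L x) :=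
      ((f.contDiff (n := 1)).differentiable one_ne_zero _).hasFDerivAt
    rw [show (fun x => f (L x)) = f ∘ L from rfl, (h1.comp x hd).fderiv,
      ContinuousLinearMap.comp_smul, ContinuousLinearMap.comp_id, norm_smul, Real.norm_eq_abs,
      abs_of_pos (inv_pos.2 hl), div_eq_inv_mul]
    gcongr
    exact (hC _).trans (le_max_left _ _)
  · refine IsLocalMin.fderiv_eq_zero (Filter.Eventually.of_forall fun z => ?_)
    simpa only [hz x hx] using h0 z
  · refine HasCompactSupport.intro (isCompact_closedBall y (2 * l)) fun x hx => hz x fun h => ?_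
    exact hx (ball_subset_closedBall h)

theorem norm_fderiv_sq_le_gradSq (A : E3 → E3) (x : E3) :
    ‖fderiv ℝ A x‖ ^ 2 ≤ 3 * gradSq A x := by
  have h : ‖fderiv ℝ A x‖ ≤ ∑ k, ‖fderiv ℝ A x (Pi.single k 1)‖ := by
    refine ContinuousLinearMap.opNorm_le_bound _ (by positivity) fun v => ?_
    conv_lhs => rw [← Finset.univ_sum_single v, map_sum]
    rw [Finset.sum_mul]
    refine (norm_sum_le _ _).trans (Finset.sum_le_sum fun k _ => ?_)
    have : (Pi.single k (v k) : E3) = v k • Pi.single k 1 := by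
      rw [← Pi.single_smul]; simp
    rw [this, map_smul, norm_smul, mul_comm]
    gcongr
    exact norm_le_pi_norm v k
  have h2 : ∀ k, ‖fderiv ℝ A x (Pi.single k 1)‖ ^ 2 ≤ ∑ j, (pdVec A k j x) ^ 2 := fun k => by
    obtain ⟨j, hj⟩ : ∃ j, ‖fderiv ℝ A x (Pi.single k 1)‖ = ‖fderiv ℝ A x (Pi.single k 1) j‖ := by
      obtain ⟨j, -, hj⟩ := Finset.exists_mem_eq_sup' (Finset.univ_nonempty (α := Fin 3))
        (fun j => ‖fderiv ℝ A x (Pi.single k 1) j‖₊)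
      refine ⟨j, ?_⟩
      rw [Pi.norm_def, ← Finset.sup'_eq_sup Finset.univ_nonempty, hj]; rfl
    rw [hj, Real.norm_eq_abs, sq_abs]
    exact Finset.single_le_sum (f := fun j => (pdVec A k j x) ^ 2) (fun _ _ => sq_nonneg _)
      (Finset.mem_univ j)
  calc _ ≤ (∑ k, ‖fderiv ℝ A x (Pi.single k 1)‖) ^ 2 := by gcongr
    _ ≤ 3 * ∑ k, ‖fderiv ℝ A x (Pi.single k 1)‖ ^ 2 := by
      have := sq_sum_le_card_mul_sum_sq (s := Finset.univ)
        (f := fun k => ‖fderiv ℝ A x (Pi.single k 1)‖)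
      simpa using this
    _ ≤ _ := by
      unfold gradSq
      gcongr with k
      exact h2 k

theorem volume_ball_E3 (y : E3) {r : ℝ} (hr : 0 < r) :
    volume (ball y r) = ENNReal.ofReal ((2 * r) ^ 3) := by
  rw [Real.volume_pi_ball _ hr]; simp

/-- Scale-invariant local control of a vector field by its gradient. -/
theorem exists_eLpNorm_three_sub_le : ∃ C : ℝ, 0 < C ∧ ∀ A : E3 → E3, ContDiff ℝ (⊤ : ℕ∞) A →
    ∀ (y : E3) (l : ℝ), 0 < l → ∃ a : E3,
      eLpNorm (fun x => A x - a) 3 (volume.restrict (ball y (2 * l))) ^ 2 ≤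
        ENNReal.ofReal (C * l) * ∫⁻ x in ball y (4 * l), ENNReal.ofReal (gradSq A x) := by
  obtain ⟨Cx, hCx, hcut⟩ := exists_cutoff
  obtain ⟨Cs, hCs⟩ := eLpNorm_six_le_fderiv E3
  refine ⟨4 * (Cs ^ 2 + 1) * (6 + 6 * (Cx / 2) ^ 2 * 512), by positivity, fun A hA y l hl => ?_⟩
  have hA1 : ContDiff ℝ 1 A := hA.of_le (by exact_mod_cast le_top)
  obtain ⟨y0, hy0⟩ := exists_lintegral_enorm_sub_sq_le hA1
    (convex_ball y (4 * l)) measurableSet_ball (s := 8 * l) (by positivity)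
    (fun x hx z hz => by
      rw [mem_ball, dist_eq_norm] at hx hz
      calc ‖x - z‖ = ‖(x - y) - (z - y)‖ := by congr 1; abel
        _ ≤ ‖x - y‖ + ‖z - y‖ := norm_sub_le _ _
        _ ≤ _ := by linarith)
    (by rw [volume_ball_E3 _ (by positivity)]; ring_nf)
  set a := A y0
  refine ⟨a, ?_⟩
  obtain ⟨ξ, hξ, hξ0, hξ1, hξb, hξz, hξd, hξdz, hξc⟩ := hcut y (2 * l) (by positivity)
  rw [show 2 * (2 * l) = 4 * l by ring] at hξz hξdz
  set G := ∫⁻ x in ball y (4 * l), ENNReal.ofReal (gradSq A x) with hG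
  set v : E3 → E3 := fun x => ξ x • (A x - a) with hv
  have hξ1' : ContDiff ℝ 1 ξ := hξ.of_le (by exact_mod_cast le_top)
  have hv1 : ContDiff ℝ 1 v := hξ1'.smul (hA1.sub contDiff_const)
  have hvc : HasCompactSupport v := hξc.smul_right
  have hvd : ∀ x, fderiv ℝ v x = ξ x • fderiv ℝ A x + (fderiv ℝ ξ x).smulRight (A x - a) := by
    intro x
    have := ((hξ1'.differentiable one_ne_zero x).hasFDerivAt.smul
      (((hA1.differentiable one_ne_zero x).hasFDerivAt).sub_const a)).fderiv
    exact this
  have hvn : ∀ x, ‖fderiv ℝ v x‖ₑ ^ 2 ≤ (ball y (4 * l)).indicator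
      (fun x => ENNReal.ofReal (6 * gradSq A x) +
        ENNReal.ofReal (2 * (Cx / (2 * l)) ^ 2) * ‖A x - a‖ₑ ^ 2) x := by
    intro x
    by_cases hx : x ∈ ball y (4 * l)
    · rw [Set.indicator_of_mem hx]
      have : ‖fderiv ℝ v x‖ ≤ ‖fderiv ℝ A x‖ + Cx / (2 * l) * ‖A x - a‖ := by
        rw [hvd]
        refine (norm_add_le _ _).trans ?_
        rw [norm_smul, ContinuousLinearMap.norm_smulRight_apply]
        gcongr
        · rw [Real.norm_eq_abs, abs_of_nonneg (hξ0 x)]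
          exact mul_le_of_le_one_left (norm_nonneg _) (hξ1 x)
        · exact hξd x
      have h2 : ‖fderiv ℝ v x‖ ^ 2 ≤ 6 * gradSq A x + 2 * (Cx / (2 * l)) ^ 2 * ‖A x - a‖ ^ 2 := by
        have h3 := norm_fderiv_sq_le_gradSq A x
        calc _ ≤ (‖fderiv ℝ A x‖ + Cx / (2 * l) * ‖A x - a‖) ^ 2 := by gcongr
          _ ≤ 2 * ‖fderiv ℝ A x‖ ^ 2 + 2 * (Cx / (2 * l) * ‖A x - a‖) ^ 2 := by
            nlinarith [sq_nonneg (‖fderiv ℝ A x‖ - Cx / (2 * l) * ‖A x - a‖)]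
          _ ≤ _ := by rw [mul_pow]; nlinarith
      have hg : 0 ≤ gradSq A x := by unfold gradSq; positivity
      rw [← ofReal_norm, ← ofReal_norm (A x - a), ← ENNReal.ofReal_pow (norm_nonneg _),
        ← ENNReal.ofReal_pow (norm_nonneg _), ← ENNReal.ofReal_mul (by positivity),
        ← ENNReal.ofReal_add (by positivity) (by positivity)]
      exact ENNReal.ofReal_le_ofReal h2
    · have h0 : fderiv ℝ v x = 0 := by
        rw [hvd, hξz x hx, hξdz x hx]
        ext
        simp
      have hn : ‖fderiv ℝ v x‖ = 0 := by rw [h0, norm_zero]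
      rw [Set.indicator_of_notMem hx, ← ofReal_norm, hn]
      simp
  have hgm : Measurable fun x => ENNReal.ofReal (6 * gradSq A x) := by
    have : Continuous (fderiv ℝ A) := hA1.continuous_fderiv one_ne_zero
    have : Continuous fun x => gradSq A x := by
      unfold gradSq pdVec; fun_prop
    fun_prop
  have hv2 : eLpNorm (fderiv ℝ v) 2 volume ^ 2 ≤
      ENNReal.ofReal (6 + 6 * (Cx / 2) ^ 2 * 512) * G := by
    rw [eLpNorm_two_sq]
    have hfd : ∫⁻ x in ball y (4 * l), ‖fderiv ℝ A x‖ₑ ^ 2 ≤ ENNReal.ofReal 3 * G := by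
      rw [hG, ← lintegral_const_mul' _ _ ENNReal.ofReal_ne_top]
      refine lintegral_mono fun x => ?_
      dsimp only
      rw [← ENNReal.ofReal_mul (by norm_num), ← ofReal_norm, ← ENNReal.ofReal_pow (norm_nonneg _)]
      exact ENNReal.ofReal_le_ofReal (norm_fderiv_sq_le_gradSq A x)
    have h6 : ∫⁻ x in ball y (4 * l), ENNReal.ofReal (6 * gradSq A x) = ENNReal.ofReal 6 * G := by
      rw [hG, ← lintegral_const_mul' _ _ ENNReal.ofReal_ne_top]
      simp_rw [ENNReal.ofReal_mul (show (0:ℝ) ≤ 6 by norm_num)]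
    calc _ ≤ _ := lintegral_mono hvn
      _ = ENNReal.ofReal 6 * G + ENNReal.ofReal (2 * (Cx / (2 * l)) ^ 2) *
          ∫⁻ x in ball y (4 * l), ‖A x - a‖ₑ ^ 2 := by
        rw [lintegral_indicator measurableSet_ball, lintegral_add_left hgm, h6,
          lintegral_const_mul' _ _ ENNReal.ofReal_ne_top]
      _ ≤ ENNReal.ofReal 6 * G + ENNReal.ofReal (2 * (Cx / (2 * l)) ^ 2) *
          (ENNReal.ofReal (8 * (8 * l) ^ 2) * (ENNReal.ofReal 3 * G)) := by
        gcongr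
        exact hy0.trans (by gcongr)
      _ = _ := by
        rw [← mul_assoc, ← mul_assoc, ← add_mul, ← ENNReal.ofReal_mul (by positivity),
          ← ENNReal.ofReal_mul (by positivity), ← ENNReal.ofReal_add (by norm_num) (by positivity)]
        congr 2
        field_simp
        ring
  have h36 : eLpNorm (fun x => A x - a) 3 (volume.restrict (ball y (2 * l))) ≤
      eLpNorm v 6 volume * volume (ball y (2 * l)) ^ (1 / 6 : ℝ) := by
    have h1 : eLpNorm (fun x => A x - a) 3 (volume.restrict (ball y (2 * l))) =
        eLpNorm v 3 (volume.restrict (ball y (2 * l))) := by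
      refine eLpNorm_congr_ae ?_
      filter_upwards [ae_restrict_mem measurableSet_ball] with x hx
      simp [hv, hξb x hx]
    rw [h1]
    have := eLpNorm_le_eLpNorm_mul_rpow_measure_univ (p := 3) (q := 6)
      (μ := volume.restrict (ball y (2 * l))) (f := v) (by norm_num)
      hv1.continuous.aestronglyMeasurable
    refine this.trans ?_
    rw [Measure.restrict_apply_univ]
    norm_num
    gcongr
    exact Measure.restrict_le_self
  have hvol : (volume (ball y (2 * l)) ^ (1 / 6 : ℝ)) ^ 2 = ENNReal.ofReal (4 * l) := by
    rw [volume_ball_E3 _ (by positivity), ← ENNReal.rpow_natCast, ← ENNReal.rpow_mul,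
      ENNReal.ofReal_rpow_of_nonneg (by positivity) (by positivity)]
    congr 1
    rw [← Real.rpow_natCast, ← Real.rpow_mul (by positivity)]
    norm_num
    ring
  calc _ ≤ (eLpNorm v 6 volume * volume (ball y (2 * l)) ^ (1 / 6 : ℝ)) ^ 2 := by gcongr
    _ ≤ (Cs * eLpNorm (fderiv ℝ v) 2 volume) ^ 2 * ENNReal.ofReal (4 * l) := by
      rw [mul_pow, hvol]
      gcongr
      exact hCs v hv1 hvc
    _ ≤ Cs ^ 2 * (ENNReal.ofReal (6 + 6 * (Cx / 2) ^ 2 * 512) * G) * ENNReal.ofReal (4 * l) := by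
      rw [mul_pow]
      gcongr
    _ = (Cs ^ 2 * ENNReal.ofReal (6 + 6 * (Cx / 2) ^ 2 * 512) * ENNReal.ofReal (4 * l)) * G := by
      ring
    _ ≤ _ := by
      gcongr
      rw [show (Cs : ℝ≥0∞) ^ 2 = ENNReal.ofReal ((Cs : ℝ) ^ 2) by
        rw [ENNReal.ofReal_pow (by positivity), ENNReal.ofReal_coe_nnreal],
        ← ENNReal.ofReal_mul (by positivity), ← ENNReal.ofReal_mul (by positivity)]
      apply ENNReal.ofReal_le_ofReal
      have : (0:ℝ) ≤ (6 + 6 * (Cx / 2) ^ 2 * 512) * l := by positivity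
      nlinarith

/-- The Pauli operator `σ·(-i∇ + A)` acting on a spinor field. -/
def pauliField (A : E3 → E3) (g : Fin 2 → E3 → ℂ) (s : Fin 2) (x : E3) : ℂ :=
  ∑ k, ∑ t, pauli k s t *
    (-Complex.I * fderiv ℝ (g t) x (Pi.single k 1) + (A x k : ℂ) * g t x)

theorem norm_pauli_le (k : Fin 3) (s t : Fin 2) : ‖pauli k s t‖ ≤ 1 := by
  fin_cases k <;> fin_cases s <;> fin_cases t <;> simp [pauli]

/-- The plane wave with wave vector `a`. -/
def planeWave (a x : E3) : ℂ := Complex.exp (Complex.I * ((∑ k, a k * x k : ℝ) : ℂ))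

theorem norm_planeWave (a x : E3) : ‖planeWave a x‖ = 1 := by
  unfold planeWave
  rw [mul_comm, Complex.norm_exp_ofReal_mul_I]

theorem contDiff_planeWave (a : E3) : ContDiff ℝ (⊤ : ℕ∞) (planeWave a) := by
  unfold planeWave
  have h : ContDiff ℝ (⊤ : ℕ∞) fun x : E3 => ∑ k, a k * x k :=
    ContDiff.sum fun k _ => contDiff_const.mul (contDiff_apply ℝ ℝ k)
  exact (contDiff_const.mul (Complex.ofRealCLM.contDiff.comp h)).cexp

theorem fderiv_planeWave (a x : E3) (k : Fin 3) :
    fderiv ℝ (planeWave a) x (Pi.single k 1) = Complex.I * a k * planeWave a x := by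
  let L : E3 →L[ℝ] ℝ := ∑ k, a k • ContinuousLinearMap.proj k
  have hL : ∀ x, L x = ∑ k, a k * x k := fun x => by simp [L]
  have h1 : HasFDerivAt (fun x => Complex.I * (L x : ℂ))
      (Complex.I • Complex.ofRealCLM.comp L) x :=
    ((Complex.ofRealCLM.hasFDerivAt).comp x L.hasFDerivAt).const_mul Complex.I
  have h2 := h1.cexp.fderiv
  have h3 : planeWave a = fun x => Complex.exp (Complex.I * (L x : ℂ)) := by
    ext x; rw [hL]; rfl
  rw [h3, h2]
  have h4 : L (Pi.single k 1) = a k := by rw [hL]; simp [Pi.single_apply]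
  simp [h4]
  ring

theorem sum_pauli_fderiv_gauge (A : E3 → E3) (a : E3) {χ : E3 → ℝ} {g : Fin 2 → E3 → ℂ}
    (hχ : Differentiable ℝ χ) (hg : ∀ t, Differentiable ℝ (g t)) (s : Fin 2) (x : E3) :
    ∑ k, ∑ t, pauli k s t *
        fderiv ℝ (fun x => planeWave a x * χ x * g t x) x (Pi.single k 1) =
      Complex.I * (planeWave a x * χ x * pauliField A g s x) +
      ∑ k, ∑ t, pauli k s t * (Complex.I * ((a k - A x k : ℝ) : ℂ) *
        (planeWave a x * χ x * g t x) +
        planeWave a x * (fderiv ℝ χ x (Pi.single k 1) : ℂ) * g t x) := by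
  have hd : ∀ t k, fderiv ℝ (fun x => planeWave a x * χ x * g t x) x (Pi.single k 1) =
      planeWave a x * χ x * fderiv ℝ (g t) x (Pi.single k 1) +
      (Complex.I * a k * planeWave a x * χ x +
        planeWave a x * (fderiv ℝ χ x (Pi.single k 1) : ℂ)) * g t x := by
    intro t k
    have h1 : HasFDerivAt (planeWave a) _ x :=
      ((contDiff_planeWave a).differentiable (by simp) x).hasFDerivAt
    have h2 : HasFDerivAt (fun x => (χ x : ℂ)) (Complex.ofRealCLM.comp (fderiv ℝ χ x)) x :=
      Complex.ofRealCLM.hasFDerivAt.comp x (hχ x).hasFDerivAt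
    have h3 := ((h1.mul h2).mul (hg t x).hasFDerivAt).fderiv
    have h4 : (fun x => planeWave a x * χ x * g t x) =
      (planeWave a * fun x => (χ x : ℂ)) * g t := rfl
    rw [h4, h3]
    simp [fderiv_planeWave]
    ring
  simp_rw [hd]
  unfold pauliField
  rw [Finset.mul_sum, Finset.mul_sum, ← Finset.sum_add_distrib]
  refine Finset.sum_congr rfl fun k _ => ?_
  rw [Finset.mul_sum, Finset.mul_sum, ← Finset.sum_add_distrib]
  refine Finset.sum_congr rfl fun t _ => ?_
  push_cast
  ring_nf
  simp only [Complex.I_sq]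
  ring

theorem norm_sum_pauli_le {f : Fin 3 → Fin 2 → ℂ} {m : Fin 2 → ℝ} (hf : ∀ k t, ‖f k t‖ ≤ m t)
    (s : Fin 2) : ‖∑ k, ∑ t, pauli k s t * f k t‖ ≤ 3 * ∑ t, m t := by
  calc _ ≤ ∑ k : Fin 3, ∑ t, m t := by
        refine (norm_sum_le _ _).trans (Finset.sum_le_sum fun k _ => ?_)
        refine (norm_sum_le _ _).trans (Finset.sum_le_sum fun t _ => ?_)
        rw [norm_mul]
        exact (mul_le_of_le_one_left (norm_nonneg _) (norm_pauli_le k s t)).trans (hf k t)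
    _ = _ := by simp [mul_add]

theorem sum_norm_pauli_gauge_sq_le (A : E3 → E3) (a : E3) {χ : E3 → ℝ} {g : Fin 2 → E3 → ℂ}
    (hχ : Differentiable ℝ χ) (hg : ∀ t, Differentiable ℝ (g t)) {c : ℝ} (x : E3)
    (hχ0 : 0 ≤ χ x) (hχ1 : χ x ≤ 1) (hc : ‖fderiv ℝ χ x‖ ≤ c) :
    ∑ s, ‖∑ k, ∑ t, pauli k s t *
        fderiv ℝ (fun x => planeWave a x * χ x * g t x) x (Pi.single k 1)‖ ^ 2 ≤
      3 * ∑ s, ‖pauliField A g s x‖ ^ 2 +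
      108 * (‖A x - a‖ ^ 2 * ∑ t, ‖planeWave a x * χ x * g t x‖ ^ 2) +
      108 * c ^ 2 * ∑ t, ‖g t x‖ ^ 2 := by
  have hc0 : 0 ≤ c := (norm_nonneg _).trans hc
  have hs : ∀ s, ‖∑ k, ∑ t, pauli k s t *
        fderiv ℝ (fun x => planeWave a x * χ x * g t x) x (Pi.single k 1)‖ ≤
      ‖pauliField A g s x‖ +
      3 * ∑ t, (‖A x - a‖ * ‖planeWave a x * χ x * g t x‖ + c * ‖g t x‖) := by
    intro s
    rw [sum_pauli_fderiv_gauge A a hχ hg]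
    refine (norm_add_le _ _).trans (add_le_add ?_ ?_)
    · rw [norm_mul, norm_mul, norm_mul, norm_planeWave, Complex.norm_I, one_mul, one_mul,
        Complex.norm_real, Real.norm_eq_abs, abs_of_nonneg hχ0]
      exact mul_le_of_le_one_left (norm_nonneg _) hχ1
    · refine norm_sum_pauli_le (fun k t => ?_) s
      refine (norm_add_le _ _).trans (add_le_add ?_ ?_)
      · rw [norm_mul, norm_mul, Complex.norm_I, one_mul]
        gcongr
        rw [Complex.norm_real, norm_sub_rev]
        exact norm_le_pi_norm (A x - a) k
      · rw [norm_mul, norm_mul, norm_planeWave, one_mul]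
        gcongr
        rw [Complex.norm_real]
        refine ((fderiv ℝ χ x).le_opNorm _).trans ?_
        rw [Pi.norm_single, norm_one, mul_one]
        exact hc
  have hsq : ∀ s, ‖∑ k, ∑ t, pauli k s t *
        fderiv ℝ (fun x => planeWave a x * χ x * g t x) x (Pi.single k 1)‖ ^ 2 ≤
      3 * ‖pauliField A g s x‖ ^ 2 +
      54 * (‖A x - a‖ ^ 2 * ∑ t, ‖planeWave a x * χ x * g t x‖ ^ 2) +
      54 * c ^ 2 * ∑ t, ‖g t x‖ ^ 2 := by
    intro s
    refine (pow_le_pow_left₀ (norm_nonneg _) (hs s) 2).trans ?_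
    simp only [Fin.sum_univ_two]
    set p := ‖pauliField A g s x‖
    set b := ‖A x - a‖
    set u0 := ‖planeWave a x * χ x * g 0 x‖
    set u1 := ‖planeWave a x * χ x * g 1 x‖
    set g0 := ‖g 0 x‖
    set g1 := ‖g 1 x‖
    have e1 : ∀ P X Y : ℝ, (P + X + Y) ^ 2 ≤ 3 * P ^ 2 + 3 * X ^ 2 + 3 * Y ^ 2 := fun P X Y => by
      nlinarith [sq_nonneg (P - X), sq_nonneg (P - Y), sq_nonneg (X - Y)]
    have e2 : ∀ X Y : ℝ, (X + Y) ^ 2 ≤ 2 * X ^ 2 + 2 * Y ^ 2 := fun X Y => by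
      nlinarith [sq_nonneg (X - Y)]
    have e3 := e1 p (3 * (b * (u0 + u1))) (3 * (c * (g0 + g1)))
    have e4 := mul_le_mul_of_nonneg_left (e2 u0 u1) (sq_nonneg b)
    have e5 := mul_le_mul_of_nonneg_left (e2 g0 g1) (sq_nonneg c)
    nlinarith
  refine (Finset.sum_le_sum fun s _ => hsq s).trans (le_of_eq ?_)
  rw [Finset.sum_add_distrib, Finset.sum_add_distrib, ← Finset.mul_sum]
  simp
  ring

theorem ofReal_sum_norm_sq {ι F : Type*} [SeminormedAddCommGroup F] (s : Finset ι) (f : ι → F) :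
    ENNReal.ofReal (∑ i ∈ s, ‖f i‖ ^ 2) = ∑ i ∈ s, ‖f i‖ₑ ^ 2 := by
  rw [ENNReal.ofReal_sum_of_nonneg fun _ _ => by positivity]
  simp only [ENNReal.ofReal_pow (norm_nonneg _), ofReal_norm]

/-- Local gauge: in a ball where the magnetic field energy is small on the natural scale, a
multiplication operator of modulus one turns the Pauli energy into a bound on the gradient. -/
theorem exists_local_gauge : ∃ C ε : ℝ, 0 < C ∧ 0 < ε ∧ ∀ A : E3 → E3,
    ContDiff ℝ (⊤ : ℕ∞) A → ∀ (y : E3) (l : ℝ), 0 < l →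
    ∫⁻ x in ball y (4 * l), ENNReal.ofReal (gradSq A x) ≤ ENNReal.ofReal (ε / l) →
    ∃ u : E3 → ℂ, ContDiff ℝ (⊤ : ℕ∞) u ∧ (∀ x, ‖u x‖ ≤ 1) ∧ (∀ x ∈ ball y l, ‖u x‖ = 1) ∧
      (∀ x ∉ ball y (2 * l), u x = 0) ∧
      ∀ g : Fin 2 → E3 → ℂ, (∀ t, ContDiff ℝ 2 (g t)) → (∀ t, HasCompactSupport (g t)) →
        ∫⁻ x, ∑ t, ‖fderiv ℝ (fun x => u x * g t x) x‖ₑ ^ 2 ≤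
          ENNReal.ofReal C * ((∫⁻ x in ball y (2 * l), ∑ s, ‖pauliField A g s x‖ₑ ^ 2) +
            ENNReal.ofReal (l⁻¹ ^ 2) * ∫⁻ x in ball y (2 * l), ∑ t, ‖g t x‖ₑ ^ 2) := by
  obtain ⟨Cx, hCx, hcut⟩ := exists_cutoff
  obtain ⟨Cs, hCs⟩ := lintegral_mul_sq_le_sobolev
  obtain ⟨Ca, hCa, hA3⟩ := exists_eLpNorm_three_sub_le
  refine ⟨18 + 648 * Cx ^ 2, (648 * (Cs + 1) * Ca)⁻¹, by positivity, by positivity,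
    fun A hA y l hl hsmall => ?_⟩
  obtain ⟨a, ha⟩ := hA3 A hA y l hl
  obtain ⟨χ, hχ, hχ0, hχ1, hχb, hχz, hχd, hχdz, hχc⟩ := hcut y l hl
  have hχ' : ContDiff ℝ (⊤ : ℕ∞) fun x => (χ x : ℂ) := Complex.ofRealCLM.contDiff.comp hχ
  have hu : ContDiff ℝ (⊤ : ℕ∞) fun x => planeWave a x * χ x := (contDiff_planeWave a).mul hχ'
  refine ⟨fun x => planeWave a x * χ x, hu, fun x => ?_, fun x hx => ?_, fun x hx => ?_,
    fun g hg hgc => ?_⟩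
  · rw [norm_mul, norm_planeWave, one_mul, Complex.norm_real, Real.norm_eq_abs,
      abs_of_nonneg (hχ0 x)]
    exact hχ1 x
  · rw [norm_mul, norm_planeWave, hχb x hx]; simp
  · simp [hχz x hx]
  set h : Fin 2 → E3 → ℂ := fun t x => planeWave a x * χ x * g t x with hh
  have hu2 : ContDiff ℝ 2 fun x => planeWave a x * χ x := contDiff_infty.1 hu 2
  have hh2 : ∀ t, ContDiff ℝ 2 (h t) := fun t => hu2.mul (hg t)
  have hhc : ∀ t, HasCompactSupport (h t) := fun t => (hgc t).mul_left
  set X := ∫⁻ x, ∑ t, ‖fderiv ℝ (h t) x‖ₑ ^ 2 with hX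
  set T := ∫⁻ x in ball y (2 * l), ∑ s, ‖pauliField A g s x‖ₑ ^ 2 with hT
  set R := ∫⁻ x in ball y (2 * l), ∑ t, ‖g t x‖ₑ ^ 2 with hR
  set w : E3 → ℝ≥0∞ := (ball y (2 * l)).indicator fun x => ‖A x - a‖ₑ ^ 2 with hw
  have hAc := hA.continuous
  have hwm : Measurable w :=
    (((hAc.sub continuous_const).enorm.measurable).pow_const 2).indicator measurableSet_ball
  have hfc : ∀ t, Continuous (fderiv ℝ (h t)) := fun t => (hh2 t).continuous_fderiv (by norm_num)
  have hgd : ∀ t, Continuous (fderiv ℝ (g t)) := fun t => (hg t).continuous_fderiv (by norm_num)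
  have hgc' : ∀ t, Continuous (g t) := fun t => (hg t).continuous
  have hXfin : X ≠ ⊤ := by
    have hi : Integrable fun x => ∑ t, ‖fderiv ℝ (h t) x‖ ^ 2 := by
      refine integrable_finsetSum _ fun t _ => Continuous.integrable_of_hasCompactSupport
        ((hfc t).norm.pow 2) ?_
      exact ((hhc t).fderiv ℝ).comp_left (g := fun L : E3 →L[ℝ] ℂ => ‖L‖ ^ 2) (by simp)
    have := hi.lintegral_lt_top
    simp_rw [ofReal_sum_norm_sq] at this
    exact this.ne
  have hwX : ∫⁻ x, ∑ t, w x * ‖h t x‖ₑ ^ 2 ≤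
      Cs * (∫⁻ x, w x ^ (3 / 2 : ℝ)) ^ (2 / 3 : ℝ) * X := by
    rw [hX, lintegral_finsetSum' _ fun t _ => by
      exact (hwm.mul ((hh2 t).continuous.enorm.measurable.pow_const 2)).aemeasurable,
      lintegral_finsetSum' _ fun t _ => by
      exact ((hfc t).enorm.measurable.pow_const 2).aemeasurable, Finset.mul_sum]
    exact Finset.sum_le_sum fun t _ => hCs w (h t) hwm.aemeasurable
      ((hh2 t).of_le (by norm_num)) (hhc t)
  have hw3 : (∫⁻ x, w x ^ (3 / 2 : ℝ)) ^ (2 / 3 : ℝ) =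
      eLpNorm (fun x => A x - a) 3 (volume.restrict (ball y (2 * l))) ^ 2 := by
    have e : ∀ x, w x ^ (3 / 2 : ℝ) =
        (ball y (2 * l)).indicator (fun x => ‖A x - a‖ₑ ^ (3 : ℝ)) x := by
      intro x
      by_cases hx : x ∈ ball y (2 * l)
      · rw [hw, Set.indicator_of_mem hx, Set.indicator_of_mem hx, ← ENNReal.rpow_natCast,
          ← ENNReal.rpow_mul]
        norm_num
      · rw [hw, Set.indicator_of_notMem hx, Set.indicator_of_notMem hx]
        norm_num
    simp_rw [e]
    rw [lintegral_indicator measurableSet_ball,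
      eLpNorm_eq_lintegral_rpow_enorm_toReal (by norm_num) (by norm_num), ← ENNReal.rpow_natCast,
      ← ENNReal.rpow_mul]
    norm_num
  have hhalf : Cs * (∫⁻ x, w x ^ (3 / 2 : ℝ)) ^ (2 / 3 : ℝ) ≤ ENNReal.ofReal (1 / 648) := by
    rw [hw3]
    calc _ ≤ ENNReal.ofReal (Cs + 1) * (ENNReal.ofReal (Ca * l) *
          ENNReal.ofReal ((648 * (Cs + 1) * Ca)⁻¹ / l)) := by
          gcongr
          · rw [← ENNReal.ofReal_coe_nnreal]
            exact ENNReal.ofReal_le_ofReal (by linarith)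
          · exact ha.trans (by gcongr)
      _ = _ := by
          rw [← ENNReal.ofReal_mul (by positivity), ← ENNReal.ofReal_mul (by positivity)]
          congr 1
          field_simp
  have hpt : ∀ x, ∑ s, ‖∑ k, ∑ t, pauli k s t * fderiv ℝ (h t) x (Pi.single k 1)‖ₑ ^ 2 ≤
      (ball y (2 * l)).indicator (fun x => 3 * ∑ s, ‖pauliField A g s x‖ₑ ^ 2) x +
      108 * ∑ t, w x * ‖h t x‖ₑ ^ 2 +
      (ball y (2 * l)).indicator
        (fun x => ENNReal.ofReal (108 * (Cx / l) ^ 2) * ∑ t, ‖g t x‖ₑ ^ 2) x := by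
    intro x
    by_cases hx : x ∈ ball y (2 * l)
    · have := sum_norm_pauli_gauge_sq_le A a (g := g) (hχ.differentiable (by simp))
        (fun t => (hg t).differentiable (by norm_num)) x (hχ0 x) (hχ1 x) (hχd x)
      have := ENNReal.ofReal_le_ofReal this
      rw [ENNReal.ofReal_add (by positivity) (by positivity),
        ENNReal.ofReal_add (by positivity) (by positivity),
        ENNReal.ofReal_mul (by positivity), ENNReal.ofReal_mul (by positivity),
        ENNReal.ofReal_mul (by positivity), ENNReal.ofReal_mul (p := 108 * (Cx / l) ^ 2)
        (by positivity), ofReal_sum_norm_sq, ofReal_sum_norm_sq, ofReal_sum_norm_sq,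
        ofReal_sum_norm_sq, ENNReal.ofReal_pow (norm_nonneg _), ofReal_norm] at this
      rw [Set.indicator_of_mem hx, Set.indicator_of_mem hx, hw, Set.indicator_of_mem hx,
        ← Finset.mul_sum]
      rw [ENNReal.ofReal_ofNat, ENNReal.ofReal_ofNat] at this
      exact this
    · have h0 : ∀ t, fderiv ℝ (h t) x = 0 := fun t => by
        have h1 : HasFDerivAt (planeWave a) _ x :=
          ((contDiff_planeWave a).differentiable (by simp) x).hasFDerivAt
        have h2 : HasFDerivAt (fun x => (χ x : ℂ)) (Complex.ofRealCLM.comp (fderiv ℝ χ x)) x :=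
          Complex.ofRealCLM.hasFDerivAt.comp x (hχ.differentiable (by simp) x).hasFDerivAt
        have h3 := ((h1.mul h2).mul
          ((hg t).differentiable (by norm_num) x).hasFDerivAt).fderiv
        have h4 : h t = (planeWave a * fun x => (χ x : ℂ)) * g t := rfl
        rw [h4, h3, hχdz x hx]
        ext v
        simp [hχz x hx]
      simp [h0]
  have hDm : Measurable fun x => 3 * ∑ s, ‖pauliField A g s x‖ₑ ^ 2 := by
    have : ∀ s, Continuous (pauliField A g s) := fun s => by
      unfold pauliField
      refine continuous_finsetSum _ fun k _ => continuous_finsetSum _ fun t _ => ?_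
      have h1 : Continuous fun x => fderiv ℝ (g t) x (Pi.single k 1) :=
        (hgd t).clm_apply continuous_const
      have h2 := hgc' t
      have h3 : Continuous fun x => (A x k : ℂ) :=
        Complex.continuous_ofReal.comp ((continuous_apply k).comp hAc)
      fun_prop
    exact (Finset.measurable_sum _ fun s _ => (this s).enorm.measurable.pow_const 2).const_mul 3
  have hwm2 : Measurable fun x => 108 * ∑ t, w x * ‖h t x‖ₑ ^ 2 :=
    (Finset.measurable_sum _ fun t _ =>
      hwm.mul ((hh2 t).continuous.enorm.measurable.pow_const 2)).const_mul _
  have hmain : X ≤ 3 * (3 * T + 108 * (ENNReal.ofReal (1 / 648) * X) +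
      ENNReal.ofReal (108 * (Cx / l) ^ 2) * R) := by
    refine (lintegral_fderiv_le_dirac hh2 hhc).trans ?_
    gcongr
    refine (lintegral_mono hpt).trans ?_
    have hsum : Measurable fun x => (ball y (2 * l)).indicator
        (fun x => 3 * ∑ s, ‖pauliField A g s x‖ₑ ^ 2) x + 108 * ∑ t, w x * ‖h t x‖ₑ ^ 2 :=
      (hDm.indicator measurableSet_ball).add hwm2
    rw [lintegral_add_left hsum,
      lintegral_add_left (hDm.indicator measurableSet_ball),
      lintegral_indicator measurableSet_ball, lintegral_indicator measurableSet_ball,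
      lintegral_const_mul' _ _ (by simp), lintegral_const_mul' _ _ (by simp),
      lintegral_const_mul' _ _ ENNReal.ofReal_ne_top]
    gcongr
    exact hwX.trans (by gcongr)
  have habs : 3 * (3 * T + 108 * (ENNReal.ofReal (1 / 648) * X) +
      ENNReal.ofReal (108 * (Cx / l) ^ 2) * R) =
      ENNReal.ofReal (1 / 2) * X + (9 * T + ENNReal.ofReal (324 * (Cx / l) ^ 2) * R) := by
    have e1 : (3 : ℝ≥0∞) * 108 * ENNReal.ofReal (1 / 648) = ENNReal.ofReal (1 / 2) := by
      rw [show (3 : ℝ≥0∞) * 108 = ENNReal.ofReal 324 by norm_num, ← ENNReal.ofReal_mul (by norm_num)]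
      norm_num
    have e2 : (3 : ℝ≥0∞) * ENNReal.ofReal (108 * (Cx / l) ^ 2) =
        ENNReal.ofReal (324 * (Cx / l) ^ 2) := by
      rw [show (3 : ℝ≥0∞) = ENNReal.ofReal 3 by norm_num, ← ENNReal.ofReal_mul (by norm_num)]
      ring_nf
    rw [← e1, ← e2]
    ring
  rw [habs] at hmain
  have hX2 : X ≤ 2 * (9 * T + ENNReal.ofReal (324 * (Cx / l) ^ 2) * R) := by
    have e : X = ENNReal.ofReal (1 / 2) * X + ENNReal.ofReal (1 / 2) * X := by
      rw [← add_mul, ← ENNReal.ofReal_add (by norm_num) (by norm_num)]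
      norm_num
    have hle : ENNReal.ofReal (1 / 2) * X ≤ 9 * T + ENNReal.ofReal (324 * (Cx / l) ^ 2) * R := by
      refine (ENNReal.add_le_add_iff_left (a := ENNReal.ofReal (1 / 2) * X)
        (ENNReal.mul_ne_top ENNReal.ofReal_ne_top hXfin)).1 ?_
      rw [← e]; exact hmain
    calc X = ENNReal.ofReal (1 / 2) * X + ENNReal.ofReal (1 / 2) * X := e
      _ ≤ _ := by rw [two_mul]; gcongr
  refine hX2.trans ?_
  have e3 : 2 * (9 * T + ENNReal.ofReal (324 * (Cx / l) ^ 2) * R) =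
      ENNReal.ofReal 18 * T + ENNReal.ofReal (648 * Cx ^ 2) * (ENNReal.ofReal (l⁻¹ ^ 2) * R) := by
    rw [← mul_assoc (ENNReal.ofReal _), ← ENNReal.ofReal_mul (by positivity), mul_add,
      ← mul_assoc, ← mul_assoc, show (2 : ℝ≥0∞) * 9 = ENNReal.ofReal 18 by norm_num,
      show (2 : ℝ≥0∞) = ENNReal.ofReal 2 by norm_num, ← ENNReal.ofReal_mul (by norm_num)]
    congr 3
    field_simp
    ring
  rw [e3, mul_add]
  gcongr
  · nlinarith [sq_nonneg Cx]
  · linarith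

/-- The half-open subcubes of side `l / K` of the ball of radius `l` about `y`. -/
def subcube (K : ℕ) (y : E3) (l : ℝ) (i : Fin 3 → Fin (2 * K)) : Set E3 :=
  Set.univ.pi fun k => Set.Ico (y k - l + (i k : ℕ) * (l / K)) (y k - l + ((i k : ℕ) + 1) * (l / K))

theorem measurableSet_subcube (K : ℕ) (y : E3) (l : ℝ) (i : Fin 3 → Fin (2 * K)) :
    MeasurableSet (subcube K y l i) :=
  MeasurableSet.univ_pi fun _ => measurableSet_Ico

theorem subcube_properties {K : ℕ} (hK : 0 < K) (y : E3) {l : ℝ} (hl : 0 < l)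
    (i : Fin 3 → Fin (2 * K)) :
    Convex ℝ (subcube K y l i) ∧
    (∀ x ∈ subcube K y l i, ∀ z ∈ subcube K y l i, ‖x - z‖ ≤ l / K) ∧
    volume (subcube K y l i) = ENNReal.ofReal ((l / K) ^ 3) := by
  have hs : 0 < l / K := by positivity
  refine ⟨convex_pi fun k _ => convex_Ico _ _, fun x hx z hz => ?_, ?_⟩
  · rw [pi_norm_le_iff_of_nonneg hs.le]
    intro k
    have h1 := hx k trivial
    have h2 := hz k trivial
    simp only [Set.mem_Ico] at h1 h2
    rw [Pi.sub_apply, Real.norm_eq_abs, abs_le]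
    constructor <;> nlinarith
  · rw [subcube, Real.volume_pi_Ico]
    have : ∀ k, y k - l + ((i k : ℕ) + 1) * (l / K) - (y k - l + (i k : ℕ) * (l / K)) = l / K :=
      fun k => by ring
    simp only [this]
    simp [ENNReal.ofReal_pow hs.le]

theorem pairwise_disjoint_subcube {K : ℕ} (hK : 0 < K) (y : E3) {l : ℝ} (hl : 0 < l) :
    Pairwise (Function.onFun Disjoint (subcube K y l)) := by
  have hs : 0 < l / K := by positivity
  intro i j hij
  rw [Function.onFun, Set.disjoint_left]
  intro x hxi hxj
  apply hij
  ext k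
  have h1 := hxi k trivial
  have h2 := hxj k trivial
  simp only [Set.mem_Ico] at h1 h2
  have a1 : (i k : ℝ) * (l / K) < ((j k : ℕ) + 1) * (l / K) := by linarith
  have a2 : (j k : ℝ) * (l / K) < ((i k : ℕ) + 1) * (l / K) := by linarith
  have b1 : ((i k : ℕ) : ℝ) < ((j k : ℕ) + 1 : ℕ) := by
    push_cast; exact lt_of_mul_lt_mul_right a1 hs.le
  have b2 : ((j k : ℕ) : ℝ) < ((i k : ℕ) + 1 : ℕ) := by
    push_cast; exact lt_of_mul_lt_mul_right a2 hs.le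
  have := Nat.cast_lt.1 b1
  have := Nat.cast_lt.1 b2
  omega

theorem ball_subset_iUnion_subcube {K : ℕ} (hK : 0 < K) (y : E3) {l : ℝ} (hl : 0 < l) :
    ball y l ⊆ ⋃ i, subcube K y l i := by
  have hs : 0 < l / K := by positivity
  intro x hx
  have hx' : ∀ k, |x k - y k| < l := fun k => by
    have := (dist_pi_lt_iff hl).1 (mem_ball.1 hx) k
    rwa [Real.dist_eq] at this
  have h0 : ∀ k, 0 ≤ (x k - y k + l) / (l / K) := fun k => by
    have := abs_lt.1 (hx' k)
    exact div_nonneg (by linarith) hs.le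
  have h1 : ∀ k, ⌊(x k - y k + l) / (l / K)⌋₊ < 2 * K := fun k => by
    rw [Nat.floor_lt (h0 k), div_lt_iff₀ hs]
    push_cast
    have e : 2 * (K : ℝ) * (l / K) = 2 * l := by field_simp
    rw [e]
    have := abs_lt.1 (hx' k)
    linarith
  refine Set.mem_iUnion.2 ⟨fun k => ⟨_, h1 k⟩, fun k _ => ?_⟩
  have a1 := Nat.floor_le (h0 k)
  have a2 := Nat.lt_floor_add_one ((x k - y k + l) / (l / K))
  rw [le_div_iff₀ hs] at a1
  rw [div_lt_iff₀ hs] at a2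
  simp only [Set.mem_Ico]
  constructor <;> linarith

/-- Local one-body estimates in balls of small magnetic field energy: the mass of a spinor is
controlled by finitely many linear functionals up to a small multiple of its energy, and the
Coulomb energy is controlled by the energy. -/
theorem exists_one_body_estimate : ∃ C ε : ℝ, 0 < C ∧ 0 < ε ∧ ∀ A : E3 → E3,
    ContDiff ℝ (⊤ : ℕ∞) A → ∀ (y : E3) (l : ℝ), 0 < l →
    ∫⁻ x in ball y (4 * l), ENNReal.ofReal (gradSq A x) ≤ ENNReal.ofReal (ε / l) →
    (∀ K : ℕ, 0 < K → ∃ φ : (Fin 3 → Fin (2 * K)) → E3 → ℂ,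
      (∀ i, Measurable (φ i)) ∧ (∀ i, ∃ b, ∀ x, ‖φ i x‖ ≤ b) ∧
      (∀ i, ∀ x ∉ ball y (2 * l), φ i x = 0) ∧ (∀ i, ∫⁻ x, ‖φ i x‖ₑ ^ 2 ≤ 1) ∧
      ∀ g : Fin 2 → E3 → ℂ, (∀ t, ContDiff ℝ 2 (g t)) → (∀ t, HasCompactSupport (g t)) →
        ∫⁻ x in ball y l, ∑ t, ‖g t x‖ₑ ^ 2 ≤
          2 * (∑ i, ∑ t, ‖∫ x, φ i x * g t x‖ₑ ^ 2) + ENNReal.ofReal (C / K ^ 2) *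
            (ENNReal.ofReal (l ^ 2) * (∫⁻ x in ball y (2 * l), ∑ s, ‖pauliField A g s x‖ₑ ^ 2) +
              ∫⁻ x in ball y (2 * l), ∑ t, ‖g t x‖ₑ ^ 2)) ∧
    (y = 0 → ∀ g : Fin 2 → E3 → ℂ, (∀ t, ContDiff ℝ 2 (g t)) → (∀ t, HasCompactSupport (g t)) →
      ∫⁻ x in ball y l, ENNReal.ofReal ‖x‖⁻¹ * ∑ t, ‖g t x‖ₑ ^ 2 ≤
        ENNReal.ofReal (C * l) *
          ((∫⁻ x in ball y (2 * l), ∑ s, ‖pauliField A g s x‖ₑ ^ 2) +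
            ENNReal.ofReal (l⁻¹ ^ 2) * ∫⁻ x in ball y (2 * l), ∑ t, ‖g t x‖ₑ ^ 2)) := by
  obtain ⟨C, ε, hC, hε, hgauge⟩ := exists_local_gauge
  obtain ⟨Cs, hCs⟩ := lintegral_mul_sq_le_sobolev
  obtain ⟨Cr, hCr, hrad⟩ := lintegral_norm_rpow_neg_ball_le (p := 3 / 2) (by norm_num)
  refine ⟨16 * C + (Cs + 1) * Cr ^ (2 / 3 : ℝ) * C, ε, by positivity, hε,
    fun A hA y l hl hsmall => ?_⟩
  obtain ⟨u, hu, hu1, hub, huz, hug⟩ := hgauge A hA y l hl hsmall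
  have hu2 : ContDiff ℝ 2 u := contDiff_infty.1 hu 2
  constructor
  · intro K hK
    set s := l / K with hs
    have hs0 : 0 < s := by positivity
    set c : ℝ := Real.sqrt ((s ^ 3)⁻¹) with hc
    have hc2 : c ^ 2 = (s ^ 3)⁻¹ := Real.sq_sqrt (by positivity)
    have hc0 : 0 ≤ c := Real.sqrt_nonneg _
    set φ : (Fin 3 → Fin (2 * K)) → E3 → ℂ := fun i =>
      (subcube K y l i).indicator fun x => (c : ℂ) * u x with hφ
    have hφn : ∀ i x, ‖φ i x‖ ≤ c := fun i x => by
      by_cases hx : x ∈ subcube K y l i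
      · rw [hφ]
        simp only [Set.indicator_of_mem hx, norm_mul, Complex.norm_real, Real.norm_eq_abs,
          abs_of_nonneg hc0]
        exact mul_le_of_le_one_right hc0 (hu1 x)
      · rw [hφ]
        simp only [Set.indicator_of_notMem hx, norm_zero]
        exact hc0
    refine ⟨φ, fun i => ?_, fun i => ⟨c, hφn i⟩, fun i x hx => ?_, fun i => ?_,
      fun g hg hgc => ?_⟩
    · exact (continuous_const.mul hu.continuous).measurable.indicator (measurableSet_subcube K y l i)
    · simp [hφ, huz x hx]
    · calc ∫⁻ x, ‖φ i x‖ₑ ^ 2 ≤ ∫⁻ x, (subcube K y l i).indicator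
            (fun _ => ENNReal.ofReal (c ^ 2)) x := by
            refine lintegral_mono fun x => ?_
            by_cases hx : x ∈ subcube K y l i
            · rw [Set.indicator_of_mem hx, ← ofReal_norm, ← ENNReal.ofReal_pow (norm_nonneg _)]
              have := hφn i x
              gcongr
            · simp [hφ, Set.indicator_of_notMem hx]
        _ = 1 := by
            rw [lintegral_indicator (measurableSet_subcube K y l i), setLIntegral_const,
              (subcube_properties hK y hl i).2.2, ← ENNReal.ofReal_mul (by positivity), hc2,
              inv_mul_cancel₀ (by positivity), ENNReal.ofReal_one]
    · have hX := hug g hg hgc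
      set T := ∫⁻ x in ball y (2 * l), ∑ s, ‖pauliField A g s x‖ₑ ^ 2 with hT
      set R := ∫⁻ x in ball y (2 * l), ∑ t, ‖g t x‖ₑ ^ 2 with hR
      have hug2 : ∀ t, ContDiff ℝ 2 fun x => u x * g t x := fun t => hu2.mul (hg t)
      have hugc : ∀ t, HasCompactSupport fun x => u x * g t x := fun t => (hgc t).mul_left
      have hfc : ∀ t, Continuous (fderiv ℝ fun x => u x * g t x) :=
        fun t => (hug2 t).continuous_fderiv (by norm_num)
      have hφi : ∀ i t, ENNReal.ofReal (2 / s ^ 3) * ‖∫ x in subcube K y l i, u x * g t x‖ₑ ^ 2 =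
          2 * ‖∫ x, φ i x * g t x‖ₑ ^ 2 := by
        intro i t
        have e : ∫ x, φ i x * g t x = c * ∫ x in subcube K y l i, u x * g t x := by
          rw [← integral_indicator (measurableSet_subcube K y l i), ← integral_const_mul]
          congr 1 with x
          by_cases hx : x ∈ subcube K y l i
          · simp [hφ, Set.indicator_of_mem hx, mul_assoc]
          · simp [hφ, Set.indicator_of_notMem hx]
        rw [e, enorm_mul, mul_pow, ← ofReal_norm (c : ℂ), Complex.norm_real, Real.norm_eq_abs,
          abs_of_nonneg hc0,
          ← ENNReal.ofReal_pow hc0, hc2, ← mul_assoc, show (2 : ℝ≥0∞) = ENNReal.ofReal 2 by norm_num,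
          ← ENNReal.ofReal_mul (by norm_num), div_eq_mul_inv]
      have hcube : ∀ i t, ∫⁻ x in subcube K y l i, ‖u x * g t x‖ₑ ^ 2 ≤
          2 * ‖∫ x, φ i x * g t x‖ₑ ^ 2 + ENNReal.ofReal (16 * s ^ 2) *
            ∫⁻ x in subcube K y l i, ‖fderiv ℝ (fun x => u x * g t x) x‖ₑ ^ 2 := by
        intro i t
        rw [← hφi]
        obtain ⟨h1, h2, h3⟩ := subcube_properties hK y hl i
        exact lintegral_sq_le_mean_add_poincare ((hug2 t).of_le (by norm_num)) h1
          (measurableSet_subcube K y l i) hs0 h2 h3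
          (((hug2 t).continuous.integrable_of_hasCompactSupport (hugc t)).integrableOn)
      have hsum : ∀ f : E3 → ℝ≥0∞, ∑ i, ∫⁻ x in subcube K y l i, f x =
          ∫⁻ x in ⋃ i, subcube K y l i, f x := fun f => by
        rw [lintegral_iUnion (measurableSet_subcube K y l) (pairwise_disjoint_subcube hK y hl),
          tsum_fintype]
      have ht : ∀ t, ∫⁻ x in ball y l, ‖g t x‖ₑ ^ 2 ≤
          2 * (∑ i, ‖∫ x, φ i x * g t x‖ₑ ^ 2) + ENNReal.ofReal (16 * s ^ 2) *
            ∫⁻ x, ‖fderiv ℝ (fun x => u x * g t x) x‖ₑ ^ 2 := by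
        intro t
        calc ∫⁻ x in ball y l, ‖g t x‖ₑ ^ 2 = ∫⁻ x in ball y l, ‖u x * g t x‖ₑ ^ 2 := by
              refine setLIntegral_congr_fun measurableSet_ball fun x hx => ?_
              have : ‖u x‖ₑ = 1 := by rw [← ofReal_norm, hub x hx, ENNReal.ofReal_one]
              simp [this]
          _ ≤ ∫⁻ x in ⋃ i, subcube K y l i, ‖u x * g t x‖ₑ ^ 2 :=
              lintegral_mono_set (ball_subset_iUnion_subcube hK y hl)
          _ = ∑ i, ∫⁻ x in subcube K y l i, ‖u x * g t x‖ₑ ^ 2 := (hsum _).symm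
          _ ≤ ∑ i, (2 * ‖∫ x, φ i x * g t x‖ₑ ^ 2 + ENNReal.ofReal (16 * s ^ 2) *
            ∫⁻ x in subcube K y l i, ‖fderiv ℝ (fun x => u x * g t x) x‖ₑ ^ 2) :=
              Finset.sum_le_sum fun i _ => hcube i t
          _ ≤ _ := by
              rw [Finset.sum_add_distrib, ← Finset.mul_sum, ← Finset.mul_sum, hsum]
              gcongr
              exact Measure.restrict_le_self
      have hgm : ∀ t, Measurable fun x => ‖g t x‖ₑ ^ 2 := fun t =>
        (hg t).continuous.enorm.measurable.pow_const 2
      have hXs : ∫⁻ x, ∑ t, ‖fderiv ℝ (fun x => u x * g t x) x‖ₑ ^ 2 =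
          ∑ t, ∫⁻ x, ‖fderiv ℝ (fun x => u x * g t x) x‖ₑ ^ 2 :=
        lintegral_finsetSum _ fun t _ => (hfc t).enorm.measurable.pow_const 2
      rw [lintegral_finsetSum _ fun t _ => hgm t]
      calc _ ≤ ∑ t, (2 * (∑ i, ‖∫ x, φ i x * g t x‖ₑ ^ 2) + ENNReal.ofReal (16 * s ^ 2) *
            ∫⁻ x, ‖fderiv ℝ (fun x => u x * g t x) x‖ₑ ^ 2) := Finset.sum_le_sum fun t _ => ht t
        _ = 2 * (∑ i, ∑ t, ‖∫ x, φ i x * g t x‖ₑ ^ 2) + ENNReal.ofReal (16 * s ^ 2) *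
            ∫⁻ x, ∑ t, ‖fderiv ℝ (fun x => u x * g t x) x‖ₑ ^ 2 := by
            rw [Finset.sum_add_distrib, ← Finset.mul_sum, ← Finset.mul_sum, hXs,
              Finset.sum_comm]
        _ ≤ _ := by
            refine add_le_add le_rfl ((mul_le_mul' le_rfl hX).trans ?_)
            have e : ENNReal.ofReal (l ^ 2) * T + R = ENNReal.ofReal (l ^ 2) *
                (T + ENNReal.ofReal (l⁻¹ ^ 2) * R) := by
              rw [mul_add, ← mul_assoc, ← ENNReal.ofReal_mul (by positivity)]
              rw [show l ^ 2 * l⁻¹ ^ 2 = 1 by field_simp]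
              simp
            rw [e, ← mul_assoc, ← mul_assoc, ← ENNReal.ofReal_mul (by positivity),
              ← ENNReal.ofReal_mul (by positivity)]
            refine mul_le_mul' (ENNReal.ofReal_le_ofReal ?_) le_rfl
            rw [hs, div_pow]
            have : (0 : ℝ) ≤ (Cs + 1) * Cr ^ (2 / 3 : ℝ) * C := by positivity
            rw [show 16 * (l ^ 2 / (K : ℝ) ^ 2) * C = 16 * C / K ^ 2 * l ^ 2 by ring]
            gcongr
            linarith
  · rintro rfl g hg hgc
    have hX := hug g hg hgc
    set T := ∫⁻ x in ball (0 : E3) (2 * l), ∑ s, ‖pauliField A g s x‖ₑ ^ 2 with hT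
    set R := ∫⁻ x in ball (0 : E3) (2 * l), ∑ t, ‖g t x‖ₑ ^ 2 with hR
    have hug2 : ∀ t, ContDiff ℝ 2 fun x => u x * g t x := fun t => hu2.mul (hg t)
    have hugc : ∀ t, HasCompactSupport fun x => u x * g t x := fun t => (hgc t).mul_left
    have hfc : ∀ t, Continuous (fderiv ℝ fun x => u x * g t x) :=
      fun t => (hug2 t).continuous_fderiv (by norm_num)
    set w : E3 → ℝ≥0∞ := (ball 0 l).indicator fun x => ENNReal.ofReal ‖x‖⁻¹ with hw
    have hwm : Measurable w := by
      refine Measurable.indicator ?_ measurableSet_ball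
      fun_prop
    have hw3 : (∫⁻ x, w x ^ (3 / 2 : ℝ)) ^ (2 / 3 : ℝ) ≤
        ENNReal.ofReal (Cr ^ (2 / 3 : ℝ) * l) := by
      have e : ∀ x, w x ^ (3 / 2 : ℝ) =
          (ball 0 l).indicator (fun x => ENNReal.ofReal (‖x‖ ^ (-(3 / 2) : ℝ))) x := by
        intro x
        by_cases hx : x ∈ ball (0 : E3) l
        · rw [hw, Set.indicator_of_mem hx, Set.indicator_of_mem hx,
            ENNReal.ofReal_rpow_of_nonneg (by positivity) (by norm_num),
            Real.inv_rpow (norm_nonneg _), Real.rpow_neg (norm_nonneg _)]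
        · rw [hw, Set.indicator_of_notMem hx, Set.indicator_of_notMem hx]
          norm_num
      simp_rw [e]
      rw [lintegral_indicator measurableSet_ball]
      calc _ ≤ ENNReal.ofReal (Cr * l ^ (3 - 3 / 2 : ℝ)) ^ (2 / 3 : ℝ) := by
            gcongr
            exact hrad l hl
        _ = _ := by
            rw [ENNReal.ofReal_rpow_of_nonneg (by positivity) (by norm_num),
              Real.mul_rpow hCr.le (by positivity), ← Real.rpow_mul hl.le]
            norm_num
    have h1 : ∫⁻ x in ball (0 : E3) l, ENNReal.ofReal ‖x‖⁻¹ * ∑ t, ‖g t x‖ₑ ^ 2 ≤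
        ∑ t, ∫⁻ x, w x * ‖u x * g t x‖ₑ ^ 2 := by
      have hm : ∀ t, Measurable fun x => w x * ‖u x * g t x‖ₑ ^ 2 := fun t =>
        hwm.mul ((hug2 t).continuous.enorm.measurable.pow_const 2)
      rw [← lintegral_finsetSum _ fun t _ => hm t, ← lintegral_indicator measurableSet_ball]
      refine lintegral_mono fun x => ?_
      by_cases hx : x ∈ ball (0 : E3) l
      · have : ‖u x‖ₑ = 1 := by rw [← ofReal_norm, hub x hx, ENNReal.ofReal_one]
        rw [hw, Set.indicator_of_mem hx, Set.indicator_of_mem hx, ← Finset.mul_sum]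
        simp [this]
      · rw [Set.indicator_of_notMem hx]; exact zero_le
    have hXs : ∫⁻ x, ∑ t, ‖fderiv ℝ (fun x => u x * g t x) x‖ₑ ^ 2 =
        ∑ t, ∫⁻ x, ‖fderiv ℝ (fun x => u x * g t x) x‖ₑ ^ 2 :=
      lintegral_finsetSum _ fun t _ => (hfc t).enorm.measurable.pow_const 2
    calc _ ≤ _ := h1
      _ ≤ ∑ t, Cs * (∫⁻ x, w x ^ (3 / 2 : ℝ)) ^ (2 / 3 : ℝ) *
          ∫⁻ x, ‖fderiv ℝ (fun x => u x * g t x) x‖ₑ ^ 2 :=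
        Finset.sum_le_sum fun t _ => hCs w _ hwm.aemeasurable ((hug2 t).of_le (by norm_num)) (hugc t)
      _ = Cs * (∫⁻ x, w x ^ (3 / 2 : ℝ)) ^ (2 / 3 : ℝ) *
          ∫⁻ x, ∑ t, ‖fderiv ℝ (fun x => u x * g t x) x‖ₑ ^ 2 := by
        rw [hXs, Finset.mul_sum]
      _ ≤ Cs * ENNReal.ofReal (Cr ^ (2 / 3 : ℝ) * l) * (ENNReal.ofReal C *
          (T + ENNReal.ofReal (l⁻¹ ^ 2) * R)) := by gcongr
      _ ≤ _ := by
        rw [← mul_assoc, ← ENNReal.ofReal_coe_nnreal, ← ENNReal.ofReal_mul (by positivity),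
          ← ENNReal.ofReal_mul (by positivity)]
        refine mul_le_mul' (ENNReal.ofReal_le_ofReal ?_) le_rfl
        have h2 : (0 : ℝ) ≤ Cr ^ (2 / 3 : ℝ) * l * C := by positivity
        have h3 := mul_pos hC hl
        calc _ ≤ Cs * (Cr ^ (2 / 3 : ℝ) * l) * C + (16 * (C * l) + Cr ^ (2 / 3 : ℝ) * l * C) := by
              linarith
          _ = _ := by ring

set_option linter.unusedSectionVars false

section ManyBody

variable {ι : Type*} [Fintype ι] [DecidableEq ι]

theorem measurable_update_prod (j : ι) :
    Measurable fun p : (ι → E3) × E3 => Function.update p.1 j p.2 := by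
  refine measurable_pi_lambda _ fun i => ?_
  by_cases h : i = j
  · subst h
    simpa using measurable_snd
  · simp only [Function.update_of_ne h]
    fun_prop

/-- The configurations whose `j`-th particle lies in the unit cube. -/
def unitSlab (j : ι) : Set (ι → E3) := (fun x => x j) ⁻¹' ball (0 : E3) (1 / 2)

theorem measurableSet_unitSlab (j : ι) : MeasurableSet (unitSlab j) :=
  measurableSet_ball.preimage (measurable_pi_apply j)

theorem lintegral_eq_lintegral_update (j : ι) {F : (ι → E3) → ℝ≥0∞} (hF : Measurable F) :
    ∫⁻ x, F x = ∫⁻ x in unitSlab j, ∫⁻ z, F (Function.update x j z) := by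
  have hm : Measurable fun x : ι → E3 => ∫⁻ z, F (Function.update x j z) :=
    (hF.comp (measurable_update_prod j)).lintegral_prod_right'
  rw [← lintegral_indicator (measurableSet_unitSlab j)]
  refine lintegral_eq_of_lmarginal_eq {j} hF (hm.indicator (measurableSet_unitSlab j)) ?_
  ext x
  rw [lmarginal_singleton, lmarginal_singleton]
  have e : ∀ z' : E3, (unitSlab j).indicator (fun x => ∫⁻ z, F (Function.update x j z))
      (Function.update x j z') =
      (ball (0 : E3) (1 / 2)).indicator (fun _ => ∫⁻ z, F (Function.update x j z)) z' := by
    intro z'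
    by_cases hz : z' ∈ ball (0 : E3) (1 / 2)
    · rw [Set.indicator_of_mem hz, Set.indicator_of_mem (by simpa [unitSlab] using hz)]
      simp only [Function.update_idem]
    · rw [Set.indicator_of_notMem hz, Set.indicator_of_notMem (by simpa [unitSlab] using hz)]
  simp_rw [e]
  rw [lintegral_indicator measurableSet_ball, setLIntegral_const, volume_ball_E3 _ (by norm_num)]
  norm_num

theorem measurePreserving_update (j : ι) :
    MeasurePreserving (fun p : (ι → E3) × E3 => Function.update p.1 j p.2)
      ((volume.restrict (unitSlab j)).prod volume) volume := by
  refine ⟨measurable_update_prod j, ?_⟩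
  ext s hs
  rw [Measure.map_apply (measurable_update_prod j) hs,
    Measure.prod_apply (measurable_update_prod j hs), ← lintegral_indicator_one hs,
    lintegral_eq_lintegral_update j (measurable_one.indicator hs)]
  refine lintegral_congr fun x => ?_
  rw [← lintegral_indicator_one]
  · rfl
  · exact measurable_prodMk_left (measurable_update_prod j hs)

theorem integral_eq_integral_update (j : ι) {f : (ι → E3) → ℂ} (hf : Integrable f) :
    ∫ x, f x = ∫ x in unitSlab j, ∫ z, f (Function.update x j z) := by
  have hp := measurePreserving_update (ι := ι) j
  have h1 : ∫ x, f x = ∫ p, f (Function.update p.1 j p.2)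
      ∂((volume.restrict (unitSlab j)).prod volume) := by
    conv_lhs => rw [← hp.map_eq]
    exact integral_map hp.measurable.aemeasurable (by rw [hp.map_eq]; exact hf.1)
  rw [h1, integral_prod]
  exact hp.integrable_comp_of_integrable hf

/-- Bounded measurable functions vanishing outside a bounded set. -/
def BddMeas {V : Type*} [NormedAddCommGroup V] [MeasurableSpace V] (f : V → ℂ) : Prop :=
  Measurable f ∧ (∃ b, ∀ x, ‖f x‖ ≤ b) ∧ ∃ R, ∀ x, R < ‖x‖ → f x = 0

theorem BddMeas.mul {V : Type*} [NormedAddCommGroup V] [MeasurableSpace V] {f g : V → ℂ}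
    (hf : BddMeas f) (hg : Measurable g) (hb : ∃ b, ∀ x, ‖g x‖ ≤ b) :
    BddMeas fun x => f x * g x := by
  obtain ⟨h1, ⟨b, h2⟩, R, h3⟩ := hf
  obtain ⟨b', h4⟩ := hb
  refine ⟨h1.mul hg, ⟨b * b', fun x => ?_⟩, R, fun x hx => by simp only [h3 x hx, zero_mul]⟩
  rw [norm_mul]
  exact mul_le_mul (h2 x) (h4 x) (norm_nonneg _) ((norm_nonneg _).trans (h2 x))

theorem BddMeas.integrable {V : Type*} [NormedAddCommGroup V] [MeasurableSpace V] [ProperSpace V]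
    [BorelSpace V] {f : V → ℂ} (hf : BddMeas f) (μ : Measure V) [IsFiniteMeasureOnCompacts μ] :
    Integrable f μ := by
  obtain ⟨h1, ⟨b, h2⟩, R, h3⟩ := hf
  rw [← integrableOn_iff_integrable_of_support_subset (s := closedBall (0 : V) R)]
  · refine Integrable.mono' (integrableOn_const (C := b) ?_) h1.aestronglyMeasurable
      (Filter.Eventually.of_forall h2)
    exact (isCompact_closedBall (0 : V) R).measure_lt_top.ne
  · intro x hx
    by_contra h
    rw [mem_closedBall_zero_iff, not_le] at h
    exact hx (h3 x h)

theorem BddMeas.star {V : Type*} [NormedAddCommGroup V] [MeasurableSpace V] {f : V → ℂ}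
    (hf : BddMeas f) : BddMeas fun x => starRingEnd ℂ (f x) := by
  obtain ⟨h1, ⟨b, h2⟩, R, h3⟩ := hf
  refine ⟨Complex.continuous_conj.measurable.comp h1, ⟨b, fun x => ?_⟩, R, fun x hx => ?_⟩
  · rw [RCLike.norm_conj]; exact h2 x
  · simp only [h3 x hx, map_zero]

theorem Continuous.bddMeas {V : Type*} [NormedAddCommGroup V] [MeasurableSpace V] [BorelSpace V]
    [ProperSpace V] {f : V → ℂ} (hf : Continuous f) (hc : HasCompactSupport f) : BddMeas f := by
  obtain ⟨b, hb⟩ := hc.exists_bound_of_continuous hf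
  obtain ⟨R, hR⟩ := hc.isCompact.isBounded.subset_closedBall 0
  refine ⟨hf.measurable, ⟨b, hb⟩, R, fun x hx => ?_⟩
  by_contra h
  have := hR (subset_tsupport f h)
  rw [mem_closedBall_zero_iff] at this
  linarith

theorem update_comp_swap (x : ι → E3) {i j : ι} (hij : i ≠ j) (z w : E3) :
    (fun k => Function.update (Function.update x i z) j w (Equiv.swap i j k)) =
      Function.update (Function.update x i w) j z := by
  ext1 k
  by_cases hi : k = i
  · subst hi
    rw [Equiv.swap_apply_left]
    simp [Function.update_of_ne hij]
  · by_cases hj : k = j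
    · subst hj
      rw [Equiv.swap_apply_right]
      simp [Function.update_of_ne hij]
    · rw [Equiv.swap_apply_of_ne_of_ne hi hj]
      simp [Function.update_of_ne hi, Function.update_of_ne hj]

/-- The amplitude for removing the `j`-th particle in the state `star φ`. -/
def amp (φ : E3 → ℂ) (ψ : (ι → E3) → ℂ) (j : ι) (x : ι → E3) : ℂ :=
  ∫ z, φ z * ψ (Function.update x j z)

theorem measurable_amp {φ : E3 → ℂ} {ψ : (ι → E3) → ℂ} (hφ : Measurable φ) (hψ : Measurable ψ)
    (j : ι) : Measurable (amp φ ψ j) := by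
  have : Measurable fun p : (ι → E3) × E3 => φ p.2 * ψ (Function.update p.1 j p.2) :=
    (hφ.comp measurable_snd).mul (hψ.comp (measurable_update_prod j))
  exact this.stronglyMeasurable.integral_prod_right'.measurable

theorem amp_bound {φ : E3 → ℂ} {ψ : (ι → E3) → ℂ} (hφ : BddMeas φ) (hψ : BddMeas ψ)
    (j : ι) : ∃ b, ∀ x, ‖amp φ ψ j x‖ ≤ b := by
  obtain ⟨b, hb⟩ := hψ.2.1
  refine ⟨∫ z, ‖φ z‖ * b, fun x => ?_⟩
  refine norm_integral_le_of_norm_le ((hφ.integrable volume).norm.mul_const b)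
    (Filter.Eventually.of_forall fun z => ?_)
  rw [norm_mul]
  exact mul_le_mul_of_nonneg_left (hb _) (norm_nonneg _)

theorem amp_update (φ : E3 → ℂ) (ψ : (ι → E3) → ℂ) (j : ι) (x : ι → E3) (z : E3) :
    amp φ ψ j (Function.update x j z) = amp φ ψ j x := by
  simp only [amp, Function.update_idem]

theorem bddMeas_mul_amp {φ χ : E3 → ℂ} {ψ : (ι → E3) → ℂ} (hχ : BddMeas χ) (hφ : BddMeas φ)
    (hψ : BddMeas ψ) (j : ι) : BddMeas fun x : ι → E3 => χ (x j) * amp φ ψ j x := by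
  obtain ⟨h1, ⟨b1, h2⟩, R1, h3⟩ := hχ
  obtain ⟨b2, h4⟩ := amp_bound hφ hψ j
  obtain ⟨R2, h6⟩ := hψ.2.2
  refine ⟨(h1.comp (measurable_pi_apply j)).mul (measurable_amp hφ.1 hψ.1 j),
    ⟨b1 * b2, fun x => ?_⟩, max (max R1 R2) 0, fun x hx => ?_⟩
  · rw [norm_mul]
    exact mul_le_mul (h2 _) (h4 x) (norm_nonneg _) ((norm_nonneg _).trans (h2 0))
  · by_cases hj : R1 < ‖x j‖
    · simp only [h3 _ hj, zero_mul]
    · have : amp φ ψ j x = 0 := by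
        rw [amp, integral_eq_zero_of_ae]
        refine Filter.Eventually.of_forall fun z => ?_
        have : ψ (Function.update x j z) = 0 := by
          refine h6 _ ?_
          by_contra hc
          refine absurd hx (not_lt.2 ?_)
          refine (pi_norm_le_iff_of_nonneg (le_max_right _ _)).2 fun i => ?_
          by_cases hi : i = j
          · subst hi
            exact (not_lt.1 hj).trans ((le_max_left _ _).trans (le_max_left _ _))
          · have := norm_le_pi_norm (Function.update x j z) i
            rw [Function.update_of_ne hi] at this
            exact this.trans ((not_lt.1 hc).trans ((le_max_right _ _).trans (le_max_left _ _)))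
        simp [this]
      simp only [this, mul_zero]

theorem bddMeas_conj_mul_amp {φ : E3 → ℂ} {ψ : (ι → E3) → ℂ} (hφ : BddMeas φ) (hψ : BddMeas ψ)
    (j : ι) : BddMeas fun x : ι → E3 => starRingEnd ℂ (φ (x j)) * amp φ ψ j x :=
  bddMeas_mul_amp hφ.star hφ hψ j

theorem integral_conj_mul_amp_self {φ : E3 → ℂ} {ψ : (ι → E3) → ℂ} (hφ : BddMeas φ)
    (hψ : BddMeas ψ) (j : ι) :
    ∫ x : ι → E3, starRingEnd ℂ (starRingEnd ℂ (φ (x j)) * amp φ ψ j x) * ψ x =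
      ∫ x in unitSlab j, ((‖amp φ ψ j x‖ ^ 2 : ℝ) : ℂ) := by
  rw [integral_eq_integral_update j
    (((bddMeas_conj_mul_amp hφ hψ j).star.mul hψ.1 hψ.2.1).integrable volume)]
  congr 1 with x
  have e : ∀ z, starRingEnd ℂ (starRingEnd ℂ (φ (Function.update x j z j)) *
      amp φ ψ j (Function.update x j z)) * ψ (Function.update x j z) =
      starRingEnd ℂ (amp φ ψ j x) * (φ z * ψ (Function.update x j z)) := fun z => by
    rw [amp_update, Function.update_self, map_mul, Complex.conj_conj]; ring
  simp_rw [e]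
  rw [integral_const_mul]
  change _ * amp φ ψ j x = _
  rw [← Complex.normSq_eq_conj_mul_self, Complex.normSq_eq_norm_sq]

theorem integral_normSq_conj_mul_amp {φ : E3 → ℂ} {ψ : (ι → E3) → ℂ} (hφ : BddMeas φ)
    (hψ : BddMeas ψ) (j : ι) :
    ∫ x : ι → E3, starRingEnd ℂ (starRingEnd ℂ (φ (x j)) * amp φ ψ j x) *
      (starRingEnd ℂ (φ (x j)) * amp φ ψ j x) =
      ((∫ z, ‖φ z‖ ^ 2 : ℝ) : ℂ) * ∫ x in unitSlab j, ((‖amp φ ψ j x‖ ^ 2 : ℝ) : ℂ) := by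
  have hb := bddMeas_conj_mul_amp hφ hψ j
  rw [integral_eq_integral_update j ((hb.star.mul hb.1 hb.2.1).integrable volume),
    ← integral_const_mul]
  congr 1 with x
  have e : ∀ z, starRingEnd ℂ (starRingEnd ℂ (φ (Function.update x j z j)) *
      amp φ ψ j (Function.update x j z)) * (starRingEnd ℂ (φ (Function.update x j z j)) *
      amp φ ψ j (Function.update x j z)) =
      ((‖φ z‖ ^ 2 : ℝ) : ℂ) * ((‖amp φ ψ j x‖ ^ 2 : ℝ) : ℂ) := fun z => by
    rw [amp_update, Function.update_self, ← Complex.normSq_eq_norm_sq,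
      ← Complex.normSq_eq_norm_sq, Complex.normSq_eq_conj_mul_self,
      Complex.normSq_eq_conj_mul_self, map_mul, Complex.conj_conj]; ring
  simp_rw [e]
  rw [integral_mul_const, integral_complex_ofReal]

theorem integral_conj_mul_amp_ne {φ : E3 → ℂ} {ψ : (ι → E3) → ℂ} (hφ : BddMeas φ)
    (hψ : BddMeas ψ) {i j : ι} (hij : i ≠ j)
    (hanti : ∀ x : ι → E3, ψ (fun k => x (Equiv.swap i j k)) = -ψ x) :
    ∫ x : ι → E3, starRingEnd ℂ (starRingEnd ℂ (φ (x i)) * amp φ ψ i x) *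
      (starRingEnd ℂ (φ (x j)) * amp φ ψ j x) = 0 := by
  have hbi := bddMeas_conj_mul_amp hφ hψ i
  have hbj := bddMeas_conj_mul_amp hφ hψ j
  rw [integral_eq_integral_update i ((hbi.star.mul hbj.1 hbj.2.1).integrable volume)]
  rw [integral_eq_zero_of_ae]
  refine Filter.Eventually.of_forall fun x => ?_
  have e : ∀ z, starRingEnd ℂ (starRingEnd ℂ (φ (Function.update x i z i)) *
      amp φ ψ i (Function.update x i z)) * (starRingEnd ℂ (φ (Function.update x i z j)) *
      amp φ ψ j (Function.update x i z)) =
      (starRingEnd ℂ (amp φ ψ i x) * starRingEnd ℂ (φ (x j))) *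
        (φ z * amp φ ψ j (Function.update x i z)) := fun z => by
    rw [amp_update, Function.update_self, Function.update_of_ne hij.symm, map_mul,
      Complex.conj_conj]; ring
  simp_rw [e]
  rw [integral_const_mul]
  set h : E3 → E3 → ℂ := fun z w =>
    φ z * (φ w * ψ (Function.update (Function.update x i z) j w)) with hh
  have h1 : ∀ z, φ z * amp φ ψ j (Function.update x i z) = ∫ w, h z w := fun z => by
    rw [amp, ← integral_const_mul]
  have h2 : ∀ z w, h w z = -h z w := fun z w => by
    have := hanti (Function.update (Function.update x i z) j w)
    rw [update_comp_swap x hij] at this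
    simp only [hh, this]
    ring
  have hinteg : Integrable (Function.uncurry h) := by
    have m1 : Measurable fun p : E3 × E3 =>
        ψ (Function.update (Function.update x i p.1) j p.2) := by
      refine hψ.1.comp ((measurable_update_prod j).comp (Measurable.prodMk ?_ measurable_snd))
      exact (measurable_update_prod i).comp (measurable_const.prodMk measurable_fst)
    obtain ⟨f1, ⟨b, f2⟩, R, f3⟩ := hφ
    obtain ⟨b', hb'⟩ := hψ.2.1
    have hB : BddMeas fun p : E3 × E3 => φ p.1 * φ p.2 := by
      refine ⟨(f1.comp measurable_fst).mul (f1.comp measurable_snd), ⟨b * b, fun p => ?_⟩, R,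
        fun p hp => ?_⟩
      · rw [norm_mul]
        exact mul_le_mul (f2 _) (f2 _) (norm_nonneg _) ((norm_nonneg _).trans (f2 0))
      · rw [Prod.norm_def, lt_max_iff] at hp
        rcases hp with hp | hp
        · simp only [f3 _ hp, zero_mul]
        · simp only [f3 _ hp, mul_zero]
    refine ((hB.mul m1 ⟨b', fun p => hb' _⟩).integrable volume).congr
      (Filter.Eventually.of_forall fun p => ?_)
    simp only [Function.uncurry, hh]
    ring
  have h3 : ∫ z, ∫ w, h z w = -∫ z, ∫ w, h z w := by
    conv_lhs => rw [integral_integral_swap hinteg]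
    rw [← integral_neg]
    refine integral_congr_ae (Filter.Eventually.of_forall fun w => ?_)
    simp only
    rw [← integral_neg]
    exact integral_congr_ae (Filter.Eventually.of_forall fun z => h2 w z)
  have h4 : ∫ z, ∫ w, h z w = 0 := self_eq_neg.1 h3
  simp_rw [h1]
  rw [h4, mul_zero]
  rfl

theorem BddMeas.integrable_norm_sq {V : Type*} [NormedAddCommGroup V] [MeasurableSpace V]
    [ProperSpace V] [BorelSpace V] {f : V → ℂ} (hf : BddMeas f) (μ : Measure V)
    [IsFiniteMeasureOnCompacts μ] : Integrable (fun x => ‖f x‖ ^ 2) μ := by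
  refine ((hf.star.mul hf.1 hf.2.1).integrable μ).norm.congr
    (Filter.Eventually.of_forall fun x => ?_)
  simp only [norm_mul, RCLike.norm_conj]
  ring

theorem lintegral_enorm_sq_eq {V : Type*} [MeasurableSpace V] {f : V → ℂ} {μ : Measure V}
    (hf : Integrable (fun x => ‖f x‖ ^ 2) μ) :
    ∫⁻ x, ‖f x‖ₑ ^ 2 ∂μ = ENNReal.ofReal (∫ x, ‖f x‖ ^ 2 ∂μ) := by
  rw [ofReal_integral_eq_lintegral_ofReal hf
    (Filter.Eventually.of_forall fun x => by positivity)]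
  refine lintegral_congr fun x => ?_
  rw [← ofReal_norm, ENNReal.ofReal_pow (norm_nonneg _)]

theorem integrable_norm_sq_amp {φ : E3 → ℂ} {ψ : (ι → E3) → ℂ} (hφ : BddMeas φ)
    (hψ : BddMeas ψ) (j : ι) :
    Integrable (fun x => ‖amp φ ψ j x‖ ^ 2) (volume.restrict (unitSlab j)) := by
  have hχ : BddMeas ((ball (0 : E3) (1 / 2)).indicator fun _ => (1 : ℂ)) := by
    refine ⟨measurable_const.indicator measurableSet_ball, ⟨1, fun x => ?_⟩, 1 / 2, fun x hx => ?_⟩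
    · by_cases h : x ∈ ball (0 : E3) (1 / 2)
      · rw [Set.indicator_of_mem h, norm_one]
      · rw [Set.indicator_of_notMem h, norm_zero]; exact zero_le_one
    · refine Set.indicator_of_notMem ?_ _
      rw [mem_ball_zero_iff]; exact hx.le.not_gt
  refine ((bddMeas_mul_amp hχ hφ hψ j).integrable_norm_sq volume).restrict.congr ?_
  filter_upwards [ae_restrict_mem (measurableSet_unitSlab j)] with x hx
  have hx' : x j ∈ ball (0 : E3) (1 / 2) := hx
  rw [Set.indicator_of_mem hx', one_mul]

/-- The Pauli principle: at most one of the particles permuted antisymmetrically occupies a given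
one-particle state. -/
theorem sum_lintegral_amp_le (J : Finset ι) {φ : E3 → ℂ} {ψ : (ι → E3) → ℂ} (hφ : BddMeas φ)
    (hψ : BddMeas ψ) (hφ1 : ∫⁻ z, ‖φ z‖ₑ ^ 2 ≤ 1)
    (hanti : ∀ i ∈ J, ∀ j ∈ J, i ≠ j →
      ∀ x : ι → E3, ψ (fun k => x (Equiv.swap i j k)) = -ψ x) :
    ∑ j ∈ J, ∫⁻ x in unitSlab j, ‖amp φ ψ j x‖ₑ ^ 2 ≤ ∫⁻ x, ‖ψ x‖ₑ ^ 2 := by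
  set P : ι → ℝ := fun j => ∫ x in unitSlab j, ‖amp φ ψ j x‖ ^ 2 with hP
  have hP0 : ∀ j, 0 ≤ P j := fun j => integral_nonneg fun x => by positivity
  have e1 : ∀ j, ∫⁻ x in unitSlab j, ‖amp φ ψ j x‖ₑ ^ 2 = ENNReal.ofReal (P j) := fun j =>
    lintegral_enorm_sq_eq (integrable_norm_sq_amp hφ hψ j)
  rw [lintegral_enorm_sq_eq (hψ.integrable_norm_sq volume)]
  rw [lintegral_enorm_sq_eq (hφ.integrable_norm_sq volume), ENNReal.ofReal_le_one] at hφ1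
  simp_rw [e1]
  rw [← ENNReal.ofReal_sum_of_nonneg fun j _ => hP0 j]
  refine ENNReal.ofReal_le_ofReal ?_
  set n : ℝ := ∫ z, ‖φ z‖ ^ 2 with hn
  set Φ : ι → (ι → E3) → ℂ := fun j x => starRingEnd ℂ (φ (x j)) * amp φ ψ j x with hΦ
  have hb : ∀ j, BddMeas (Φ j) := fun j => bddMeas_conj_mul_amp hφ hψ j
  have i1 : ∀ j, Integrable fun x => starRingEnd ℂ (Φ j x) * ψ x := fun j =>
    ((hb j).star.mul hψ.1 hψ.2.1).integrable volume
  have i2 : ∀ j, Integrable fun x => starRingEnd ℂ (ψ x) * Φ j x := fun j =>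
    (hψ.star.mul (hb j).1 (hb j).2.1).integrable volume
  have i3 : ∀ i j, Integrable fun x => starRingEnd ℂ (Φ i x) * Φ j x := fun i j =>
    ((hb i).star.mul (hb j).1 (hb j).2.1).integrable volume
  have i4 : Integrable fun x => starRingEnd ℂ (ψ x) * ψ x :=
    (hψ.star.mul hψ.1 hψ.2.1).integrable volume
  have v1 : ∀ j, ∫ x, starRingEnd ℂ (Φ j x) * ψ x = (P j : ℂ) := fun j => by
    rw [hΦ, integral_conj_mul_amp_self hφ hψ j, integral_complex_ofReal]
  have v2 : ∀ j, ∫ x, starRingEnd ℂ (ψ x) * Φ j x = (P j : ℂ) := fun j => by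
    have : ∀ x, starRingEnd ℂ (ψ x) * Φ j x = starRingEnd ℂ (starRingEnd ℂ (Φ j x) * ψ x) :=
      fun x => by rw [map_mul, Complex.conj_conj, mul_comm]
    simp_rw [this]
    rw [integral_conj, v1, Complex.conj_ofReal]
  have v3 : ∀ i ∈ J, ∀ j ∈ J, ∫ x, starRingEnd ℂ (Φ i x) * Φ j x =
      if i = j then ((n * P j : ℝ) : ℂ) else 0 := fun i hi j hj => by
    split_ifs with h
    · subst h
      rw [hΦ, integral_normSq_conj_mul_amp hφ hψ i, integral_complex_ofReal]
      push_cast; rfl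
    · exact integral_conj_mul_amp_ne hφ hψ h (hanti i hi j hj h)
  have v4 : ∫ x, starRingEnd ℂ (ψ x) * ψ x = ((∫ x, ‖ψ x‖ ^ 2 : ℝ) : ℂ) := by
    rw [← integral_complex_ofReal]
    congr 1 with x
    rw [← Complex.normSq_eq_conj_mul_self, Complex.normSq_eq_norm_sq]
  have key : ((∫ x, ‖ψ x - ∑ j ∈ J, Φ j x‖ ^ 2 : ℝ) : ℂ) =
      (((∫ x, ‖ψ x‖ ^ 2) - 2 * (∑ j ∈ J, P j) + n * (∑ j ∈ J, P j) : ℝ) : ℂ) := by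
    rw [← integral_complex_ofReal]
    have e : ∀ x, ((‖ψ x - ∑ j ∈ J, Φ j x‖ ^ 2 : ℝ) : ℂ) =
        starRingEnd ℂ (ψ x) * ψ x - (∑ j ∈ J, starRingEnd ℂ (Φ j x) * ψ x) -
          (∑ j ∈ J, starRingEnd ℂ (ψ x) * Φ j x) +
          ∑ i ∈ J, ∑ j ∈ J, starRingEnd ℂ (Φ i x) * Φ j x := fun x => by
      rw [← Complex.normSq_eq_norm_sq, Complex.normSq_eq_conj_mul_self, map_sub, map_sum,
        ← Finset.sum_mul, ← Finset.mul_sum, ← Finset.sum_mul_sum]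
      ring
    simp_rw [e]
    have j1 : Integrable fun x => ∑ j ∈ J, starRingEnd ℂ (Φ j x) * ψ x :=
      integrable_finsetSum _ fun j _ => i1 j
    have j2 : Integrable fun x => ∑ j ∈ J, starRingEnd ℂ (ψ x) * Φ j x :=
      integrable_finsetSum _ fun j _ => i2 j
    have j3 : ∀ i, Integrable fun x => ∑ j ∈ J, starRingEnd ℂ (Φ i x) * Φ j x := fun i =>
      integrable_finsetSum _ fun j _ => i3 i j
    have j4 : Integrable fun x => ∑ i ∈ J, ∑ j ∈ J, starRingEnd ℂ (Φ i x) * Φ j x :=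
      integrable_finsetSum _ fun i _ => j3 i
    have k1 : Integrable fun x =>
        starRingEnd ℂ (ψ x) * ψ x - ∑ j ∈ J, starRingEnd ℂ (Φ j x) * ψ x := i4.sub j1
    have k2 : Integrable fun x => starRingEnd ℂ (ψ x) * ψ x -
        (∑ j ∈ J, starRingEnd ℂ (Φ j x) * ψ x) - ∑ j ∈ J, starRingEnd ℂ (ψ x) * Φ j x := k1.sub j2
    rw [integral_add k2 j4, integral_sub k1 j2, integral_sub i4 j1,
      integral_finsetSum _ fun j _ => i1 j, integral_finsetSum _ fun j _ => i2 j,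
      integral_finsetSum _ fun i _ => j3 i, v4]
    simp_rw [v1, v2]
    have : ∑ i ∈ J, ∫ x, ∑ j ∈ J, starRingEnd ℂ (Φ i x) * Φ j x =
        ∑ i ∈ J, ((n * P i : ℝ) : ℂ) := by
      refine Finset.sum_congr rfl fun i hi => ?_
      rw [integral_finsetSum _ fun j _ => i3 i j, Finset.sum_congr rfl fun j hj => v3 i hi j hj,
        Finset.sum_ite_eq, if_pos hi]
    rw [this]
    push_cast
    rw [← Finset.mul_sum]
    ring
  have key' := Complex.ofReal_injective key
  have hpos : 0 ≤ ∫ x, ‖ψ x - ∑ j ∈ J, Φ j x‖ ^ 2 := integral_nonneg fun x => by positivity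
  have hS : 0 ≤ ∑ j ∈ J, P j := Finset.sum_nonneg fun j _ => hP0 j
  rw [key'] at hpos
  nlinarith

end ManyBody

section Marginals

variable {N : ℕ}

theorem sum_sum_update {M : Type*} [AddCommMonoid M] (j : Fin N) (h : (Fin N → Fin 2) → M) :
    ∑ s, ∑ t, h (Function.update s j t) = 2 • ∑ s, h s := by
  let e : (Fin N → Fin 2) × Fin 2 ≃ (Fin N → Fin 2) × Fin 2 :=
    { toFun := fun p => (Function.update p.1 j p.2, p.1 j)
      invFun := fun p => (Function.update p.1 j p.2, p.1 j)
      left_inv := fun p => by simp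
      right_inv := fun p => by simp }
  calc ∑ s, ∑ t, h (Function.update s j t) = ∑ p : (Fin N → Fin 2) × Fin 2, h (e p).1 := by
        rw [Fintype.sum_prod_type]; rfl
    _ = ∑ p : (Fin N → Fin 2) × Fin 2, h p.1 := e.sum_comp fun p => h p.1
    _ = 2 • ∑ s, h s := by
        rw [Fintype.sum_prod_type, Finset.smul_sum]
        simp

theorem sum_update_const {M : Type*} [AddCommMonoid M] (j : Fin N) (t : Fin 2)
    (h : (Fin N → Fin 2) → M) :
    ∑ s, h (Function.update s j t) = 2 • ∑ s, if s j = t then h s else 0 := by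
  rw [← sum_sum_update j fun s => if s j = t then h s else 0]
  refine Finset.sum_congr rfl fun s _ => ?_
  simp

/-- The sum of the one-particle marginals of a family of densities on spin-configuration space. -/
def margSum (w : Fin N → (Fin N → Fin 2) → (Fin N → E3) → ℝ≥0∞) : Measure E3 :=
  ∑ j, ∑ s, Measure.map (fun x : Fin N → E3 => x j) (volume.withDensity (w j s))

theorem lintegral_margSum {w : Fin N → (Fin N → Fin 2) → (Fin N → E3) → ℝ≥0∞}
    (hw : ∀ j s, Measurable (w j s)) {f : E3 → ℝ≥0∞} (hf : Measurable f) :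
    ∫⁻ y, f y ∂margSum w = ∑ j, ∑ s, ∫⁻ x, w j s x * f (x j) := by
  simp only [margSum, lintegral_finsetSum_measure]
  refine Finset.sum_congr rfl fun j _ => Finset.sum_congr rfl fun s _ => ?_
  rw [lintegral_map hf (measurable_pi_apply j), lintegral_withDensity_eq_lintegral_mul _ (hw j s)]
  · rfl
  · exact hf.comp (measurable_pi_apply j)

theorem two_mul_lintegral_margSum {w : Fin N → (Fin N → Fin 2) → (Fin N → E3) → ℝ≥0∞}
    (hw : ∀ j s, Measurable (w j s)) {f : E3 → ℝ≥0∞} (hf : Measurable f) :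
    2 * ∫⁻ y, f y ∂margSum w = ∑ j, ∑ s, ∫⁻ x in unitSlab j, ∫⁻ z,
      f z * ∑ t, w j (Function.update s j t) (Function.update x j z) := by
  rw [lintegral_margSum hw hf, Finset.mul_sum]
  refine Finset.sum_congr rfl fun j _ => ?_
  have hu : ∀ s, Measurable fun p : (Fin N → E3) × E3 =>
      f p.2 * w j s (Function.update p.1 j p.2) := fun s =>
    (hf.comp measurable_snd).mul ((hw j s).comp (measurable_update_prod j))
  have e : ∀ s, ∫⁻ x in unitSlab j, ∫⁻ z,
      f z * ∑ t, w j (Function.update s j t) (Function.update x j z) =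
      ∑ t, ∫⁻ x, w j (Function.update s j t) x * f (x j) := by
    intro s
    have e1 : ∀ x : Fin N → E3, ∫⁻ z,
        f z * ∑ t, w j (Function.update s j t) (Function.update x j z) =
        ∑ t, ∫⁻ z, f z * w j (Function.update s j t) (Function.update x j z) := fun x => by
      simp_rw [Finset.mul_sum]
      exact lintegral_finsetSum _ fun t _ => (hu (Function.update s j t)).comp measurable_prodMk_left
    simp_rw [e1]
    have hm : ∀ t, Measurable fun x : Fin N → E3 =>
        ∫⁻ z, f z * w j (Function.update s j t) (Function.update x j z) := fun t =>
      (hu (Function.update s j t)).lintegral_prod_right'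
    rw [lintegral_finsetSum _ fun t _ => hm t]
    refine Finset.sum_congr rfl fun t _ => ?_
    rw [lintegral_eq_lintegral_update j]
    · refine lintegral_congr fun x => lintegral_congr fun z => ?_
      rw [Function.update_self, mul_comm]
    · exact (hw j _).mul (hf.comp (measurable_pi_apply j))
  simp_rw [e]
  rw [sum_sum_update j fun s => ∫⁻ x, w j s x * f (x j), nsmul_eq_mul]
  rfl

end Marginals

section Slices

variable {N : ℕ}

theorem fderiv_comp_update {F : (Fin N → E3) → ℂ} (hF : Differentiable ℝ F) (x : Fin N → E3)
    (j : Fin N) (z v : E3) :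
    fderiv ℝ (fun z => F (Function.update x j z)) z v =
      fderiv ℝ F (Function.update x j z) (Pi.single j v) := by
  have h := ((hF (Function.update x j z)).hasFDerivAt.comp z (hasFDerivAt_update x z)).fderiv
  change fderiv ℝ (F ∘ Function.update x j) z v = _
  rw [h, ContinuousLinearMap.comp_apply]
  congr 1
  ext i
  by_cases hi : i = j
  · subst hi; simp
  · simp [hi]

/-- The integrand of the Pauli kinetic energy of the `j`-th particle. -/
def pauliDensity (A : E3 → E3) (Φ : (Fin N → E3) → (Fin N → Fin 2) → ℂ) (j : Fin N)
    (s : Fin N → Fin 2) (x : Fin N → E3) : ℂ :=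
  ∑ k : Fin 3, ∑ t : Fin 2, pauli k (s j) t *
      (-Complex.I * fderiv ℝ (fun y => Φ y (Function.update s j t)) x (eVec N j k)
        + (A (x j) k : ℂ) * Φ x (Function.update s j t))

theorem pauliDensity_update {A : E3 → E3} {Φ : (Fin N → E3) → (Fin N → Fin 2) → ℂ}
    (hΦ : ∀ s, Differentiable ℝ fun x => Φ x s) (j : Fin N) (s : Fin N → Fin 2) (t : Fin 2)
    (x : Fin N → E3) (z : E3) :
    pauliDensity A Φ j (Function.update s j t) (Function.update x j z) =
      pauliField A (fun t z => Φ (Function.update x j z) (Function.update s j t)) t z := by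
  simp only [pauliDensity, pauliField, Function.update_self, Function.update_idem, eVec]
  refine Finset.sum_congr rfl fun k _ => Finset.sum_congr rfl fun t' _ => ?_
  rw [fderiv_comp_update (hΦ (Function.update s j t'))]

theorem continuous_pauliDensity {A : E3 → E3} (hA : Continuous A)
    {Φ : (Fin N → E3) → (Fin N → Fin 2) → ℂ} (hΦ : ∀ s, ContDiff ℝ 2 fun x => Φ x s) (j : Fin N)
    (s : Fin N → Fin 2) : Continuous (pauliDensity A Φ j s) := by
  refine continuous_finsetSum _ fun k _ => continuous_finsetSum _ fun t _ => ?_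
  have h1 := ((hΦ (Function.update s j t)).continuous_fderiv (by norm_num)).clm_apply
    (continuous_const (y := eVec N j k))
  have h2 := (hΦ (Function.update s j t)).continuous
  have h3 : Continuous fun x : Fin N → E3 => (A (x j) k : ℂ) :=
    Complex.continuous_ofReal.comp ((continuous_apply k).comp (hA.comp (continuous_apply j)))
  exact continuous_const.mul ((continuous_const.mul h1).add (h3.mul h2))

theorem hasCompactSupport_pauliDensity {A : E3 → E3}
    {Φ : (Fin N → E3) → (Fin N → Fin 2) → ℂ} (hΦ : ∀ s, HasCompactSupport fun x => Φ x s)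
    (j : Fin N) (s : Fin N → Fin 2) : HasCompactSupport (pauliDensity A Φ j s) := by
  have hK : IsCompact (⋃ t : Fin 2, tsupport fun x => Φ x (Function.update s j t)) :=
    isCompact_iUnion fun t => (hΦ _).isCompact
  refine HasCompactSupport.intro hK fun x hx => ?_
  simp only [Set.mem_iUnion, not_exists] at hx
  refine Finset.sum_eq_zero fun k _ => Finset.sum_eq_zero fun t _ => ?_
  rw [image_eq_zero_of_notMem_tsupport (hx t), ]
  have : fderiv ℝ (fun y => Φ y (Function.update s j t)) x = 0 :=
    image_eq_zero_of_notMem_tsupport fun h => hx t (tsupport_fderiv_subset ℝ h)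
  simp [this]

theorem HasCompactSupport.comp_update {F : (Fin N → E3) → ℂ} (hF : HasCompactSupport F)
    (x : Fin N → E3) (j : Fin N) : HasCompactSupport fun z => F (Function.update x j z) := by
  obtain ⟨R, hR⟩ := hF.isCompact.isBounded.subset_closedBall 0
  refine HasCompactSupport.intro (isCompact_closedBall (0 : E3) R) fun z hz => ?_
  by_contra h
  have := hR (subset_tsupport F h)
  rw [mem_closedBall_zero_iff] at this hz
  have h2 := norm_le_pi_norm (Function.update x j z) j
  rw [Function.update_self] at h2
  exact hz (h2.trans this)

end Slices

theorem sum_lintegral_amp_waveFun_le {N : ℕ} {Ψ : (Fin N → E3) → (Fin N → Fin 2) → ℂ}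
    (hΨ : IsWaveFun N Ψ) {φ : E3 → ℂ} (hφ : BddMeas φ) (hφ1 : ∫⁻ z, ‖φ z‖ₑ ^ 2 ≤ 1) (t : Fin 2) :
    ∑ j, ∑ s, ∫⁻ x in unitSlab j,
      ‖amp φ (fun x => Ψ x (Function.update s j t)) j x‖ₑ ^ 2 ≤ 2 := by
  have hb : ∀ s, BddMeas fun x => Ψ x s := fun s =>
    (hΨ.smooth s).continuous.bddMeas (hΨ.compactSupport s)
  have h1 : ∀ j, ∑ s, ∫⁻ x in unitSlab j,
      ‖amp φ (fun x => Ψ x (Function.update s j t)) j x‖ₑ ^ 2 =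
      2 * ∑ s, if s j = t then ∫⁻ x in unitSlab j, ‖amp φ (fun x => Ψ x s) j x‖ₑ ^ 2 else 0 := by
    intro j
    rw [sum_update_const j t fun s => ∫⁻ x in unitSlab j, ‖amp φ (fun x => Ψ x s) j x‖ₑ ^ 2,
      nsmul_eq_mul]
    rfl
  simp_rw [h1]
  rw [← Finset.mul_sum, Finset.sum_comm]
  have h2 : ∀ s : Fin N → Fin 2,
      (∑ j, if s j = t then ∫⁻ x in unitSlab j, ‖amp φ (fun x => Ψ x s) j x‖ₑ ^ 2 else 0) ≤
      ENNReal.ofReal (∫ x, ‖Ψ x s‖ ^ 2) := by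
    intro s
    rw [← Finset.sum_filter, ← lintegral_enorm_sq_eq ((hb s).integrable_norm_sq volume)]
    refine sum_lintegral_amp_le _ hφ (hb s) hφ1 fun i hi j hj hij x => ?_
    have h := hΨ.antisymm (Equiv.swap i j) x s
    have hs : (fun k => s (Equiv.swap i j k)) = s := by
      ext1 k
      simp only [Finset.mem_filter, Finset.mem_univ, true_and] at hi hj
      by_cases hki : k = i
      · subst hki; rw [Equiv.swap_apply_left, hi, hj]
      · by_cases hkj : k = j
        · subst hkj; rw [Equiv.swap_apply_right, hi, hj]
        · rw [Equiv.swap_apply_of_ne_of_ne hki hkj]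
    rw [hs, Equiv.Perm.sign_swap hij] at h
    simpa using h
  calc _ ≤ 2 * ∑ s, ENNReal.ofReal (∫ x, ‖Ψ x s‖ ^ 2) := by
        gcongr with s
        exact h2 s
    _ = 2 := by
        rw [← ENNReal.ofReal_sum_of_nonneg fun s _ => integral_nonneg fun x => by positivity,
          hΨ.normalized, ENNReal.ofReal_one, mul_one]

/-- The position density and the kinetic energy density of a localized wave function, as measures
on one-particle space, and the local estimates they satisfy. -/
theorem exists_one_particle_measures : ∃ C ε : ℝ, 0 < C ∧ 0 < ε ∧ ∀ (A : E3 → E3) (θ : E3 → ℝ)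
    (N : ℕ) (Ψ : (Fin N → E3) → (Fin N → Fin 2) → ℂ), ContDiff ℝ (⊤ : ℕ∞) A →
    ContDiff ℝ (⊤ : ℕ∞) θ → (∀ x, θ x ∈ Set.Icc (0 : ℝ) 1) → IsWaveFun N Ψ →
    ∃ ρ τ : Measure E3, ρ Set.univ ≠ ∞ ∧ τ Set.univ ≠ ∞ ∧ ρ {x | θ x = 0} = 0 ∧
      ENNReal.ofReal (∑ j, pauliKin N A j (cutMul N θ j Ψ)) = τ Set.univ ∧
      (∀ W : E3 → ℝ, Measurable W → (∀ x, 0 ≤ W x) →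
        ENNReal.ofReal (∑ j, potInt N (fun x => W (x j) * θ (x j) ^ 2) Ψ) ≤
          ∫⁻ x, ENNReal.ofReal (W x) ∂ρ) ∧
      ∀ (y : E3) (l : ℝ), 0 < l →
        ∫⁻ x in ball y (4 * l), ENNReal.ofReal (gradSq A x) ≤ ENNReal.ofReal (ε / l) →
        (∀ K : ℕ, 0 < K → ρ (ball y l) ≤ 32 * K ^ 3 + ENNReal.ofReal (C / K ^ 2) *
          (ENNReal.ofReal (l ^ 2) * τ (ball y (2 * l)) + ρ (ball y (2 * l)))) ∧
        (y = 0 → ∫⁻ x in ball y l, ENNReal.ofReal ‖x‖⁻¹ ∂ρ ≤ ENNReal.ofReal (C * l) *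
          (τ (ball y (2 * l)) + ENNReal.ofReal (l⁻¹ ^ 2) * ρ (ball y (2 * l)))) := by
  obtain ⟨C, ε, hC, hε, hone⟩ := exists_one_body_estimate
  refine ⟨C, ε, hC, hε, fun A θ N Ψ hA hθ hθ1 hΨ => ?_⟩
  have hc : ∀ j s, ContDiff ℝ (⊤ : ℕ∞) fun x => cutMul N θ j Ψ x s := fun j s =>
    (Complex.ofRealCLM.contDiff.comp (hθ.comp (contDiff_apply ℝ E3 j))).mul (hΨ.smooth s)
  have hc2 : ∀ j s, ContDiff ℝ 2 fun x => cutMul N θ j Ψ x s := fun j s =>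
    contDiff_infty.1 (hc j s) 2
  have hcs : ∀ j s, HasCompactSupport fun x => cutMul N θ j Ψ x s := fun j s =>
    (hΨ.compactSupport s).mul_left
  have hbc : ∀ j s, BddMeas fun x => cutMul N θ j Ψ x s := fun j s =>
    (hc j s).continuous.bddMeas (hcs j s)
  have hbp : ∀ j s, BddMeas (pauliDensity A (cutMul N θ j Ψ) j s) := fun j s =>
    (continuous_pauliDensity hA.continuous (hc2 j) j s).bddMeas
      (hasCompactSupport_pauliDensity (hcs j) j s)
  set wρ : Fin N → (Fin N → Fin 2) → (Fin N → E3) → ℝ≥0∞ := fun j s x =>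
    ‖cutMul N θ j Ψ x s‖ₑ ^ 2 with hwρ
  set wτ : Fin N → (Fin N → Fin 2) → (Fin N → E3) → ℝ≥0∞ := fun j s x =>
    ‖pauliDensity A (cutMul N θ j Ψ) j s x‖ₑ ^ 2 with hwτ
  have mρ : ∀ j s, Measurable (wρ j s) := fun j s => (hbc j s).1.enorm.pow_const 2
  have mτ : ∀ j s, Measurable (wτ j s) := fun j s => (hbp j s).1.enorm.pow_const 2
  have univ_eq : ∀ {w : Fin N → (Fin N → Fin 2) → (Fin N → E3) → ℝ≥0∞},
      (∀ j s, Measurable (w j s)) → margSum w Set.univ = ∑ j, ∑ s, ∫⁻ x, w j s x := fun hw => by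
    rw [← lintegral_one, lintegral_margSum hw measurable_const]
    simp
  set g : (j : Fin N) → (Fin N → Fin 2) → (Fin N → E3) → Fin 2 → E3 → ℂ := fun j s x t z =>
    cutMul N θ j Ψ (Function.update x j z) (Function.update s j t) with hg
  have hg2 : ∀ j s x t, ContDiff ℝ 2 (g j s x t) := fun j s x t =>
    (hc2 j (Function.update s j t)).comp (contDiff_update 2 x j)
  have hgc : ∀ j s x t, HasCompactSupport (g j s x t) := fun j s x t =>
    (hcs j (Function.update s j t)).comp_update x j
  have sρ : ∀ f : E3 → ℝ≥0∞, Measurable f → 2 * ∫⁻ y, f y ∂margSum wρ =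
      ∑ j, ∑ s, ∫⁻ x in unitSlab j, ∫⁻ z, f z * ∑ t, ‖g j s x t z‖ₑ ^ 2 := fun f hf =>
    two_mul_lintegral_margSum mρ hf
  have sτ : ∀ f : E3 → ℝ≥0∞, Measurable f → 2 * ∫⁻ y, f y ∂margSum wτ =
      ∑ j, ∑ s, ∫⁻ x in unitSlab j, ∫⁻ z, f z * ∑ t, ‖pauliField A (g j s x) t z‖ₑ ^ 2 := by
    intro f hf
    rw [two_mul_lintegral_margSum mτ hf]
    refine Finset.sum_congr rfl fun j _ => Finset.sum_congr rfl fun s _ =>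
      lintegral_congr fun x => lintegral_congr fun z => ?_
    simp only [hwτ]
    simp_rw [pauliDensity_update fun s => (hc2 j s).differentiable (by norm_num)]
    rfl
  have bρ : ∀ y l, 2 * margSum wρ (ball y l) =
      ∑ j, ∑ s, ∫⁻ x in unitSlab j, ∫⁻ z in ball y l, ∑ t, ‖g j s x t z‖ₑ ^ 2 := fun y l => by
    rw [← lintegral_indicator_one measurableSet_ball,
      sρ _ (measurable_one.indicator measurableSet_ball)]
    refine Finset.sum_congr rfl fun j _ => Finset.sum_congr rfl fun s _ =>
      lintegral_congr fun x => ?_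
    rw [← lintegral_indicator measurableSet_ball]
    refine lintegral_congr fun z => ?_
    by_cases hz : z ∈ ball y l
    · simp [Set.indicator_of_mem hz]
    · simp [Set.indicator_of_notMem hz]
  have bτ : ∀ y l, 2 * margSum wτ (ball y l) =
      ∑ j, ∑ s, ∫⁻ x in unitSlab j, ∫⁻ z in ball y l,
        ∑ t, ‖pauliField A (g j s x) t z‖ₑ ^ 2 := fun y l => by
    rw [← lintegral_indicator_one measurableSet_ball,
      sτ _ (measurable_one.indicator measurableSet_ball)]
    refine Finset.sum_congr rfl fun j _ => Finset.sum_congr rfl fun s _ =>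
      lintegral_congr fun x => ?_
    rw [← lintegral_indicator measurableSet_ball]
    refine lintegral_congr fun z => ?_
    by_cases hz : z ∈ ball y l
    · simp [Set.indicator_of_mem hz]
    · simp [Set.indicator_of_notMem hz]
  have hmτ : ∀ j s y l, Measurable fun x : Fin N → E3 =>
      ∫⁻ z in ball y l, ∑ t, ‖pauliField A (g j s x) t z‖ₑ ^ 2 := by
    intro j s y l
    have : Measurable fun p : (Fin N → E3) × E3 =>
        ∑ t, ‖pauliField A (g j s p.1) t p.2‖ₑ ^ 2 := by
      have e : (fun p : (Fin N → E3) × E3 => ∑ t, ‖pauliField A (g j s p.1) t p.2‖ₑ ^ 2) =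
          fun p => ∑ t, wτ j (Function.update s j t) (Function.update p.1 j p.2) := by
        ext p
        simp only [hwτ]
        simp_rw [pauliDensity_update fun s => (hc2 j s).differentiable (by norm_num)]
        rfl
      rw [e]
      exact Finset.measurable_fun_sum _ fun t _ => (mτ j _).comp (measurable_update_prod j)
    exact this.lintegral_prod_right'
  have hmρ : ∀ j s y l, Measurable fun x : Fin N → E3 =>
      ∫⁻ z in ball y l, ∑ t, ‖g j s x t z‖ₑ ^ 2 := by
    intro j s y l
    have : Measurable fun p : (Fin N → E3) × E3 => ∑ t, ‖g j s p.1 t p.2‖ₑ ^ 2 :=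
      Finset.measurable_fun_sum _ fun t _ => (mρ j _).comp (measurable_update_prod j)
    exact this.lintegral_prod_right'
  have cancel : ∀ {a b : ℝ≥0∞}, 2 * a ≤ 2 * b → a ≤ b := fun {a b} h =>
    (ENNReal.mul_le_mul_iff_right (by norm_num) (by norm_num)).1 h
  refine ⟨margSum wρ, margSum wτ, ?_, ?_, ?_, ?_, fun W hW hW0 => ?_, fun y l hl hsmall => ⟨?_, ?_⟩⟩
  · rw [univ_eq mρ]
    refine ENNReal.sum_ne_top.2 fun j _ => ENNReal.sum_ne_top.2 fun s _ => ?_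
    rw [hwρ, lintegral_enorm_sq_eq ((hbc j s).integrable_norm_sq volume)]
    exact ENNReal.ofReal_ne_top
  · rw [univ_eq mτ]
    refine ENNReal.sum_ne_top.2 fun j _ => ENNReal.sum_ne_top.2 fun s _ => ?_
    rw [hwτ, lintegral_enorm_sq_eq ((hbp j s).integrable_norm_sq volume)]
    exact ENNReal.ofReal_ne_top
  · have hm : MeasurableSet {x | θ x = 0} := hθ.continuous.measurable (measurableSet_singleton 0)
    rw [← lintegral_indicator_one hm, lintegral_margSum mρ (measurable_one.indicator hm)]
    refine Finset.sum_eq_zero fun j _ => Finset.sum_eq_zero fun s _ => ?_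
    rw [lintegral_eq_zero_of_ae_eq_zero]
    refine Filter.Eventually.of_forall fun x => ?_
    by_cases h : θ (x j) = 0
    · simp [hwρ, cutMul, h]
    · have : x j ∉ {x | θ x = 0} := h
      simp [Set.indicator_of_notMem this]
  · rw [univ_eq mτ, ENNReal.ofReal_sum_of_nonneg]
    · refine Finset.sum_congr rfl fun j _ => ?_
      rw [pauliKin, ENNReal.ofReal_sum_of_nonneg fun s _ => integral_nonneg fun x => by positivity]
      refine Finset.sum_congr rfl fun s _ => ?_
      exact (lintegral_enorm_sq_eq ((hbp j s).integrable_norm_sq volume)).symm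
    · exact fun j _ => Finset.sum_nonneg fun s _ => integral_nonneg fun x => by positivity
  · rw [lintegral_margSum mρ hW.ennreal_ofReal]
    have h0 : ∀ j s (x : Fin N → E3), 0 ≤ W (x j) * θ (x j) ^ 2 * ‖Ψ x s‖ ^ 2 := fun j s x =>
      mul_nonneg (mul_nonneg (hW0 _) (sq_nonneg _)) (sq_nonneg _)
    simp only [potInt]
    rw [ENNReal.ofReal_sum_of_nonneg fun j _ => Finset.sum_nonneg fun s _ =>
      integral_nonneg (h0 j s)]
    refine Finset.sum_le_sum fun j _ => ?_
    rw [ENNReal.ofReal_sum_of_nonneg fun s _ => integral_nonneg (h0 j s)]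
    refine Finset.sum_le_sum fun s _ => ?_
    refine (Real.ofReal_le_enorm _).trans ((enorm_integral_le_lintegral_enorm _).trans_eq ?_)
    refine lintegral_congr fun x => ?_
    rw [Real.enorm_of_nonneg (h0 j s x)]
    simp only [hwρ, cutMul]
    rw [← ofReal_norm, ← ENNReal.ofReal_pow (norm_nonneg _), ← ENNReal.ofReal_mul (by positivity),
      norm_mul, Complex.norm_real, Real.norm_eq_abs, mul_pow, sq_abs]
    congr 1
    ring
  · intro K hK
    obtain ⟨φ, hφm, hφb, hφz, hφ1, hest⟩ := (hone A hA y l hl hsmall).1 K hK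
    refine cancel ?_
    have hθm : Measurable fun x => (θ x : ℂ) :=
      Complex.measurable_ofReal.comp hθ.continuous.measurable
    have hθn : ∀ x, ‖(θ x : ℂ)‖ ≤ 1 := fun x => by
      rw [Complex.norm_real, Real.norm_eq_abs, abs_of_nonneg (hθ1 x).1]; exact (hθ1 x).2
    have hB : ∀ i, BddMeas fun x => φ i x * (θ x : ℂ) := fun i =>
      BddMeas.mul ⟨hφm i, hφb i, ‖y‖ + 2 * l, fun x hx => hφz i x fun h => by
        have h1 := mem_ball_iff_norm.1 h
        have h2 := norm_add_le (x - y) y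
        rw [sub_add_cancel] at h2
        linarith⟩ hθm ⟨1, hθn⟩
    have hB1 : ∀ i, ∫⁻ z, ‖φ i z * (θ z : ℂ)‖ₑ ^ 2 ≤ 1 := fun i => by
      refine (lintegral_mono fun z => ?_).trans (hφ1 i)
      rw [enorm_mul]
      have : ‖(θ z : ℂ)‖ₑ ≤ 1 := by
        rw [← ofReal_norm]; exact ENNReal.ofReal_le_one.2 (hθn z)
      calc (‖φ i z‖ₑ * ‖(θ z : ℂ)‖ₑ) ^ 2 ≤ (‖φ i z‖ₑ * 1) ^ 2 := by gcongr
        _ = _ := by rw [mul_one]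
    have hamp : ∀ i j s x t, ∫ z, φ i z * g j s x t z =
        amp (fun x => φ i x * (θ x : ℂ)) (fun x => Ψ x (Function.update s j t)) j x := by
      intro i j s x t
      refine integral_congr_ae (Filter.Eventually.of_forall fun z => ?_)
      simp only [hg, cutMul, Function.update_self]
      ring
    have hma : ∀ i j s t, Measurable fun x : Fin N → E3 =>
        ‖∫ z, φ i z * g j s x t z‖ₑ ^ 2 := fun i j s t => by
      simp_rw [hamp]
      exact (measurable_amp (hB i).1 (hΨ.smooth _).continuous.measurable j).enorm.pow_const 2
    rw [bρ]
    calc _ ≤ ∑ j, ∑ s, ∫⁻ x in unitSlab j, (2 * (∑ i, ∑ t, ‖∫ z, φ i z * g j s x t z‖ₑ ^ 2) +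
          ENNReal.ofReal (C / K ^ 2) * (ENNReal.ofReal (l ^ 2) *
            (∫⁻ z in ball y (2 * l), ∑ t, ‖pauliField A (g j s x) t z‖ₑ ^ 2) +
              ∫⁻ z in ball y (2 * l), ∑ t, ‖g j s x t z‖ₑ ^ 2)) := by
          gcongr with j _ s _ x
          exact hest (g j s x) (hg2 j s x) (hgc j s x)
      _ = 2 * (∑ i, ∑ t, ∑ j, ∑ s, ∫⁻ x in unitSlab j, ‖∫ z, φ i z * g j s x t z‖ₑ ^ 2) +
          ENNReal.ofReal (C / K ^ 2) * (ENNReal.ofReal (l ^ 2) *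
            (2 * margSum wτ (ball y (2 * l))) + 2 * margSum wρ (ball y (2 * l))) := by
          rw [bρ, bτ]
          have e : ∀ j s, ∫⁻ x in unitSlab j, (2 * (∑ i, ∑ t, ‖∫ z, φ i z * g j s x t z‖ₑ ^ 2) +
            ENNReal.ofReal (C / K ^ 2) * (ENNReal.ofReal (l ^ 2) *
            (∫⁻ z in ball y (2 * l), ∑ t, ‖pauliField A (g j s x) t z‖ₑ ^ 2) +
              ∫⁻ z in ball y (2 * l), ∑ t, ‖g j s x t z‖ₑ ^ 2)) =
              2 * (∑ i, ∑ t, ∫⁻ x in unitSlab j, ‖∫ z, φ i z * g j s x t z‖ₑ ^ 2) +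
              ENNReal.ofReal (C / K ^ 2) * (ENNReal.ofReal (l ^ 2) *
            (∫⁻ x in unitSlab j, ∫⁻ z in ball y (2 * l),
              ∑ t, ‖pauliField A (g j s x) t z‖ₑ ^ 2) +
              ∫⁻ x in unitSlab j, ∫⁻ z in ball y (2 * l), ∑ t, ‖g j s x t z‖ₑ ^ 2) := by
            intro j s
            have n1 : Measurable fun x : Fin N → E3 =>
                ∑ i, ∑ t, ‖∫ z, φ i z * g j s x t z‖ₑ ^ 2 :=
              Finset.measurable_fun_sum _ fun i _ =>
                Finset.measurable_fun_sum _ fun t _ => hma i j s t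
            have n2 : Measurable fun x : Fin N → E3 =>
                2 * ∑ i, ∑ t, ‖∫ z, φ i z * g j s x t z‖ₑ ^ 2 := n1.const_mul 2
            have n3 : Measurable fun x : Fin N → E3 => ENNReal.ofReal (l ^ 2) *
                ∫⁻ z in ball y (2 * l), ∑ t, ‖pauliField A (g j s x) t z‖ₑ ^ 2 :=
              (hmτ j s y _).const_mul _
            rw [lintegral_add_left n2, lintegral_const_mul _ n1, lintegral_const_mul' _ _
              ENNReal.ofReal_ne_top, lintegral_add_left n3, lintegral_const_mul _ (hmτ j s y _)]
            congr 2
            rw [lintegral_finsetSum _ fun i _ =>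
              Finset.measurable_fun_sum _ fun t _ => hma i j s t]
            exact Finset.sum_congr rfl fun i _ => lintegral_finsetSum _ fun t _ => hma i j s t
          simp_rw [e]
          simp only [Finset.sum_add_distrib, ← Finset.mul_sum]
          congr 2
          have r1 : ∀ F : Fin N → (Fin N → Fin 2) → (Fin 3 → Fin (2 * K)) → Fin 2 → ℝ≥0∞,
              ∑ j, ∑ s, ∑ i, ∑ t, F j s i t = ∑ i, ∑ t, ∑ j, ∑ s, F j s i t := fun F => by
            calc _ = ∑ j, ∑ i, ∑ s, ∑ t, F j s i t :=
                  Finset.sum_congr rfl fun j _ => Finset.sum_comm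
              _ = ∑ i, ∑ j, ∑ s, ∑ t, F j s i t := Finset.sum_comm
              _ = ∑ i, ∑ j, ∑ t, ∑ s, F j s i t := Finset.sum_congr rfl fun i _ =>
                  Finset.sum_congr rfl fun j _ => Finset.sum_comm
              _ = _ := Finset.sum_congr rfl fun i _ => Finset.sum_comm
          exact r1 _
      _ ≤ 2 * (∑ i : Fin 3 → Fin (2 * K), ∑ t : Fin 2, 2) +
          ENNReal.ofReal (C / K ^ 2) * (ENNReal.ofReal (l ^ 2) *
            (2 * margSum wτ (ball y (2 * l))) + 2 * margSum wρ (ball y (2 * l))) := by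
          gcongr with i _ t _
          simp_rw [hamp]
          exact sum_lintegral_amp_waveFun_le hΨ (hB i) (hB1 i) t
      _ = _ := by
          simp only [Finset.sum_const, Finset.card_univ, Fintype.card_fun, Fintype.card_fin,
            nsmul_eq_mul]
          push_cast
          ring
  · rintro rfl
    have hest := (hone A hA 0 l hl hsmall).2 rfl
    refine cancel ?_
    have hfm : Measurable fun x : E3 => ENNReal.ofReal ‖x‖⁻¹ := by fun_prop
    have e0 : ∀ j s x, ∫⁻ z, (ball (0 : E3) l).indicator (fun x => ENNReal.ofReal ‖x‖⁻¹) z *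
        ∑ t, ‖g j s x t z‖ₑ ^ 2 =
        ∫⁻ z in ball 0 l, ENNReal.ofReal ‖z‖⁻¹ * ∑ t, ‖g j s x t z‖ₑ ^ 2 := fun j s x => by
      rw [← lintegral_indicator measurableSet_ball]
      refine lintegral_congr fun z => ?_
      by_cases hz : z ∈ ball (0 : E3) l
      · simp [Set.indicator_of_mem hz]
      · simp [Set.indicator_of_notMem hz]
    rw [← lintegral_indicator measurableSet_ball, sρ _ (hfm.indicator measurableSet_ball)]
    simp_rw [e0]
    calc _ ≤ ∑ j, ∑ s, ∫⁻ x in unitSlab j, ENNReal.ofReal (C * l) *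
          ((∫⁻ z in ball 0 (2 * l), ∑ t, ‖pauliField A (g j s x) t z‖ₑ ^ 2) +
            ENNReal.ofReal (l⁻¹ ^ 2) * ∫⁻ z in ball 0 (2 * l), ∑ t, ‖g j s x t z‖ₑ ^ 2) := by
          gcongr with j _ s _ x
          exact hest (g j s x) (hg2 j s x) (hgc j s x)
      _ = ENNReal.ofReal (C * l) * (2 * margSum wτ (ball 0 (2 * l)) +
            ENNReal.ofReal (l⁻¹ ^ 2) * (2 * margSum wρ (ball 0 (2 * l)))) := by
          rw [bρ, bτ]
          have e : ∀ j s, ∫⁻ x in unitSlab j, ENNReal.ofReal (C * l) *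
              ((∫⁻ z in ball 0 (2 * l), ∑ t, ‖pauliField A (g j s x) t z‖ₑ ^ 2) +
              ENNReal.ofReal (l⁻¹ ^ 2) * ∫⁻ z in ball 0 (2 * l), ∑ t, ‖g j s x t z‖ₑ ^ 2) =
              ENNReal.ofReal (C * l) *
              ((∫⁻ x in unitSlab j, ∫⁻ z in ball 0 (2 * l),
                ∑ t, ‖pauliField A (g j s x) t z‖ₑ ^ 2) +
              ENNReal.ofReal (l⁻¹ ^ 2) * ∫⁻ x in unitSlab j,
                ∫⁻ z in ball 0 (2 * l), ∑ t, ‖g j s x t z‖ₑ ^ 2) := by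
            intro j s
            rw [lintegral_const_mul' _ _ ENNReal.ofReal_ne_top, lintegral_add_left (hmτ j s 0 _),
              lintegral_const_mul' _ _ ENNReal.ofReal_ne_top]
          simp_rw [e]
          simp only [Finset.sum_add_distrib, ← Finset.mul_sum]
      _ = _ := by ring

section StopScale

/-- The set of scales `t ≤ m` at which `γ` has small scaled mass around `y`. -/
def stopSet (γ : Measure E3) (ε m : ℝ) (y : E3) : Set ℝ :=
  {t | 0 ≤ t ∧ t ≤ m ∧ ENNReal.ofReal t * γ (ball y (8 * t)) ≤ ENNReal.ofReal ε}

/-- The largest scale `t ≤ m` at which `γ` has small scaled mass around `y`. -/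
def stopScale (γ : Measure E3) (ε m : ℝ) (y : E3) : ℝ := sSup (stopSet γ ε m y)

variable {γ : Measure E3} {ε m : ℝ} {y : E3}

theorem bddAbove_stopSet : BddAbove (stopSet γ ε m y) := ⟨m, fun _ ht => ht.2.1⟩

theorem zero_mem_stopSet (hm : 0 ≤ m) : (0 : ℝ) ∈ stopSet γ ε m y := by
  refine ⟨le_rfl, hm, ?_⟩
  rw [ENNReal.ofReal_zero, zero_mul]
  exact zero_le

theorem stopScale_le (hm : 0 ≤ m) : stopScale γ ε m y ≤ m :=
  csSup_le ⟨0, zero_mem_stopSet hm⟩ fun _ ht => ht.2.1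

theorem le_stopScale {t : ℝ} (ht : t ∈ stopSet γ ε m y) : t ≤ stopScale γ ε m y :=
  le_csSup bddAbove_stopSet ht

theorem stopSet_of_le {t t' : ℝ} (ht : t ∈ stopSet γ ε m y) (h0 : 0 ≤ t') (h : t' ≤ t) :
    t' ∈ stopSet γ ε m y := by
  refine ⟨h0, h.trans ht.2.1, le_trans ?_ ht.2.2⟩
  exact mul_le_mul' (ENNReal.ofReal_le_ofReal h)
    (measure_mono (ball_subset_ball (by linarith)))

theorem stopScale_pos (hm : 0 < m) (hε : 0 < ε) {B : ℝ}
    (hB : ∀ r : ℝ, 0 < r → γ (ball y r) ≤ ENNReal.ofReal (B * r ^ 3)) :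
    0 < stopScale γ ε m y := by
  set B' := |B| + 1 with hB'
  have hB0 : 0 < B' := by positivity
  set t := min m (min 1 (ε / (512 * B'))) with ht
  have ht0 : 0 < t := lt_min hm (lt_min one_pos (by positivity))
  have ht1 : t ≤ 1 := (min_le_right _ _).trans (min_le_left _ _)
  have ht2 : t ≤ ε / (512 * B') := (min_le_right _ _).trans (min_le_right _ _)
  refine ht0.trans_le (le_stopScale ⟨ht0.le, min_le_left _ _, ?_⟩)
  calc _ ≤ ENNReal.ofReal t * ENNReal.ofReal (B * (8 * t) ^ 3) := by
        gcongr
        exact hB _ (by positivity)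
    _ = ENNReal.ofReal (t * (B * (8 * t) ^ 3)) := (ENNReal.ofReal_mul ht0.le).symm
    _ ≤ _ := by
        refine ENNReal.ofReal_le_ofReal ?_
        rw [le_div_iff₀ (by positivity)] at ht2
        have h1 : B ≤ B' := (le_abs_self B).trans (by linarith)
        have h2 : t ^ 3 ≤ 1 := pow_le_one₀ ht0.le ht1
        calc t * (B * (8 * t) ^ 3) ≤ t * (B' * (8 * t) ^ 3) := by gcongr
          _ = t * (512 * B') * t ^ 3 := by ring
          _ ≤ t * (512 * B') * 1 := by gcongr
          _ ≤ ε := by linarith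

theorem measure_ball_half_stopScale_le (h0 : 0 < stopScale γ ε m y) (hm : 0 ≤ m) :
    γ (ball y (4 * (stopScale γ ε m y / 2))) ≤
      ENNReal.ofReal (ε / (stopScale γ ε m y / 2)) := by
  set l := stopScale γ ε m y / 2 with hl
  have hl0 : 0 < l := by positivity
  obtain ⟨t, ht, hlt⟩ := exists_lt_of_lt_csSup ⟨0, zero_mem_stopSet hm⟩
    (show l < sSup (stopSet γ ε m y) by change l < stopScale γ ε m y; linarith)
  have h := (stopSet_of_le ht hl0.le hlt.le).2.2
  rw [ENNReal.ofReal_div_of_pos hl0, ENNReal.le_div_iff_mul_le (Or.inl (by simpa using hl0))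
    (Or.inl ENNReal.ofReal_ne_top), mul_comm]
  refine le_trans ?_ h
  gcongr
  linarith

theorem stopScale_eq_or_le (h0 : 0 < stopScale γ ε m y) (hm : 0 ≤ m) :
    stopScale γ ε m y = m ∨ ENNReal.ofReal ε ≤
      ENNReal.ofReal (2 * stopScale γ ε m y) * γ (ball y (16 * stopScale γ ε m y)) := by
  set l := stopScale γ ε m y with hl
  rcases (stopScale_le (γ := γ) (ε := ε) (y := y) hm).lt_or_eq with h | h
  · right
    by_contra hc
    rw [not_le] at hc
    have ht : min (2 * l) m ∈ stopSet γ ε m y := by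
      refine ⟨le_min (by positivity) hm, min_le_right _ _, le_trans ?_ hc.le⟩
      refine mul_le_mul' (ENNReal.ofReal_le_ofReal (min_le_left _ _))
        (measure_mono (ball_subset_ball ?_))
      have := min_le_left (2 * l) m
      linarith
    have h1 := le_stopScale ht
    rw [← hl] at h1
    exact absurd h1 (not_le.2 (lt_min (by linarith) h))
  · exact Or.inl h

theorem stopScale_le_add {m' : ℝ} {y' : E3} (hm : 0 ≤ m) (hm' : 0 ≤ m')
    (h : m ≤ m' + dist y y' / 8) :
    stopScale γ ε m y ≤ stopScale γ ε m' y' + dist y y' / 8 := by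
  refine csSup_le ⟨0, zero_mem_stopSet hm⟩ fun t ht => ?_
  rcases le_total t (dist y y' / 8) with h1 | h1
  · have := le_stopScale (zero_mem_stopSet (γ := γ) (ε := ε) (y := y') hm')
    linarith
  · have : t - dist y y' / 8 ∈ stopSet γ ε m' y' := by
      refine ⟨by linarith, by linarith [ht.2.1], le_trans ?_ ht.2.2⟩
      refine mul_le_mul' (ENNReal.ofReal_le_ofReal ?_) (measure_mono (ball_subset_ball' ?_))
      · have := dist_nonneg (x := y) (y := y'); linarith
      · rw [dist_comm y' y]; linarith
    have := le_stopScale this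
    linarith

end StopScale

/-- Exchanging the order of integration for weighted averages of measures of balls. -/
theorem setLIntegral_mul_measure_ball (μ : Measure E3) [SFinite μ] {Y : Set E3}
    {w : E3 → ℝ≥0∞} (hw : Measurable w) {r : E3 → ℝ} (hr : Measurable r) :
    ∫⁻ y in Y, w y * μ (ball y (r y)) =
      ∫⁻ x, (∫⁻ y in Y ∩ {y | dist x y < r y}, w y) ∂μ := by
  have hS : MeasurableSet {p : E3 × E3 | dist p.2 p.1 < r p.1} :=
    measurableSet_lt (by fun_prop) (hr.comp measurable_fst)
  have hm : Measurable fun p : E3 × E3 =>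
      Set.indicator {p : E3 × E3 | dist p.2 p.1 < r p.1} (fun p => w p.1) p :=
    (hw.comp measurable_fst).indicator hS
  calc _ = ∫⁻ y in Y, ∫⁻ x, Set.indicator {p : E3 × E3 | dist p.2 p.1 < r p.1}
        (fun p => w p.1) (y, x) ∂μ := by
        refine lintegral_congr fun y => ?_
        have e : ∀ x, Set.indicator {p : E3 × E3 | dist p.2 p.1 < r p.1} (fun p => w p.1) (y, x) =
            (ball y (r y)).indicator (fun _ => w y) x := fun x => rfl
        simp_rw [e]
        rw [lintegral_indicator measurableSet_ball, setLIntegral_const]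
    _ = ∫⁻ x, (∫⁻ y in Y, Set.indicator {p : E3 × E3 | dist p.2 p.1 < r p.1}
        (fun p => w p.1) (y, x)) ∂μ := lintegral_lintegral_swap hm.aemeasurable
    _ = _ := by
        refine lintegral_congr fun x => ?_
        have hx : MeasurableSet {y | dist x y < r y} := measurableSet_lt (by fun_prop) hr
        rw [Set.inter_comm, ← Measure.restrict_restrict hx, ← lintegral_indicator hx]
        rfl

theorem enorm3_eq_norm (x : E3) : enorm3 x = ‖WithLp.toLp 2 x‖ := by
  rw [enorm3, EuclideanSpace.norm_eq]
  simp

theorem enorm3_nonneg (x : E3) : 0 ≤ enorm3 x := Real.sqrt_nonneg _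

theorem enorm3_add_le (x y : E3) : enorm3 (x + y) ≤ enorm3 x + enorm3 y := by
  simp only [enorm3_eq_norm, WithLp.toLp_add]
  exact norm_add_le _ _

theorem continuous_enorm3 : Continuous enorm3 := by
  unfold enorm3
  fun_prop

theorem norm_le_enorm3 (x : E3) : ‖x‖ ≤ enorm3 x := by
  refine (pi_norm_le_iff_of_nonneg (enorm3_nonneg x)).2 fun i => ?_
  rw [Real.norm_eq_abs, ← Real.sqrt_sq_eq_abs]
  exact Real.sqrt_le_sqrt
    (Finset.single_le_sum (f := fun k => x k ^ 2) (fun k _ => sq_nonneg _) (Finset.mem_univ i))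

theorem enorm3_le_two_mul_norm (x : E3) : enorm3 x ≤ 2 * ‖x‖ := by
  refine Real.sqrt_le_iff.2 ⟨by positivity, ?_⟩
  have h : ∀ i, x i ^ 2 ≤ ‖x‖ ^ 2 := fun i => by
    rw [← sq_abs, ← Real.norm_eq_abs]
    exact pow_le_pow_left₀ (norm_nonneg _) (norm_le_pi_norm x i) 2
  rw [Fin.sum_univ_three]
  nlinarith [h 0, h 1, h 2, sq_nonneg ‖x‖]

theorem enorm3_le_add_dist (x y : E3) : enorm3 x ≤ enorm3 y + 2 * dist x y := by
  have h := enorm3_add_le y (x - y)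
  rw [add_sub_cancel] at h
  rw [dist_eq_norm]
  linarith [enorm3_le_two_mul_norm (x - y)]

/-- Scaling of the integral of `(‖x‖ + s) ^ (-4)` over space. -/
theorem lintegral_norm_add_rpow_neg_four_le :
    ∃ C : ℝ, 0 < C ∧ ∀ s : ℝ, 0 < s →
      ∫⁻ x : E3, ENNReal.ofReal ((‖x‖ + s) ^ (-4 : ℝ)) ≤ ENNReal.ofReal (C / s) := by
  set I := ∫⁻ x : E3, ENNReal.ofReal ((1 + ‖x‖) ^ (-4 : ℝ)) with hI
  have hfin : I < ∞ := finite_integral_one_add_norm (by simp; norm_num)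
  refine ⟨I.toReal + 1, by positivity, fun s hs => ?_⟩
  have hmap := Measure.map_addHaar_smul (volume : Measure E3) hs.ne'
  have hm : Measurable fun x : E3 => ENNReal.ofReal ((‖x‖ + s) ^ (-4 : ℝ)) := by fun_prop
  have h1 : ∫⁻ x : E3, ENNReal.ofReal ((‖s • x‖ + s) ^ (-4 : ℝ)) =
      ENNReal.ofReal (|(s ^ 3)⁻¹|) * ∫⁻ x : E3, ENNReal.ofReal ((‖x‖ + s) ^ (-4 : ℝ)) := by
    rw [← lintegral_map hm (measurable_const_smul s), hmap, lintegral_smul_measure]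
    simp
  have h2 : ∀ x : E3, ENNReal.ofReal ((‖s • x‖ + s) ^ (-4 : ℝ)) =
      ENNReal.ofReal (s ^ (-4 : ℝ)) * ENNReal.ofReal ((1 + ‖x‖) ^ (-4 : ℝ)) := fun x => by
    rw [← ENNReal.ofReal_mul (by positivity), ← Real.mul_rpow hs.le (by positivity),
      norm_smul, Real.norm_of_nonneg hs.le]
    congr 2
    ring
  simp_rw [h2] at h1
  rw [lintegral_const_mul' _ _ ENNReal.ofReal_ne_top, ← hI] at h1
  have h3 : ENNReal.ofReal (s ^ 3) * ENNReal.ofReal (|(s ^ 3)⁻¹|) = 1 := by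
    rw [← ENNReal.ofReal_mul (by positivity), abs_of_pos (by positivity),
      mul_inv_cancel₀ (by positivity), ENNReal.ofReal_one]
  calc _ = ENNReal.ofReal (s ^ 3) * (ENNReal.ofReal (|(s ^ 3)⁻¹|) *
        ∫⁻ x : E3, ENNReal.ofReal ((‖x‖ + s) ^ (-4 : ℝ))) := by rw [← mul_assoc, h3, one_mul]
    _ = ENNReal.ofReal (s ^ 3) * (ENNReal.ofReal (s ^ (-4 : ℝ)) * I) := by rw [← h1]
    _ = ENNReal.ofReal (s ^ 3) * (ENNReal.ofReal (s ^ (-4 : ℝ)) * ENNReal.ofReal I.toReal) := by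
        rw [ENNReal.ofReal_toReal hfin.ne]
    _ = ENNReal.ofReal (I.toReal / s) := by
        rw [← ENNReal.ofReal_mul (by positivity), ← ENNReal.ofReal_mul (by positivity)]
        congr 1
        have : s ^ (-4 : ℝ) = (s ^ 4)⁻¹ := by
          rw [Real.rpow_neg hs.le]; norm_cast
        rw [this]
        field_simp
    _ ≤ _ := ENNReal.ofReal_le_ofReal (by gcongr; linarith)

/-- The radial integral bound around an arbitrary centre. -/
theorem lintegral_dist_rpow_neg_ball_le {p : ℝ} (hp3 : p < 3) : ∃ C : ℝ, 0 < C ∧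
    ∀ (x : E3) (R : ℝ), 0 < R → ∫⁻ y in ball x R, ENNReal.ofReal (dist x y ^ (-p)) ≤
      ENNReal.ofReal (C * R ^ (3 - p)) := by
  obtain ⟨C, hC, h⟩ := lintegral_norm_rpow_neg_ball_le hp3
  refine ⟨C, hC, fun x R hR => le_trans (le_of_eq ?_) (h R hR)⟩
  rw [← lintegral_indicator measurableSet_ball, ← lintegral_indicator measurableSet_ball,
    ← lintegral_sub_right_eq_self
      ((ball (0 : E3) R).indicator fun y => ENNReal.ofReal (‖y‖ ^ (-p))) x]
  refine lintegral_congr fun y => ?_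
  simp only [Set.indicator, mem_ball, dist_eq_norm, sub_zero]
  rw [norm_sub_rev x y]

/-- A positive slowly varying length scale, small compared with `‖y‖ + s` and with the
Coulomb length. -/
structure IsLengthScale (Z s : ℝ) (L : E3 → ℝ) : Prop where
  pos_charge : 0 < Z
  pos_shift : 0 < s
  pos : ∀ y, 0 < L y
  le_add : ∀ y x, L y ≤ L x + dist y x / 8
  le_norm : ∀ y, L y ≤ (‖y‖ + s) / 256
  sq_mul_le : ∀ y, L y ^ 2 * (Z / (‖y‖ + s)) ≤ 1

namespace IsLengthScale

variable {Z s : ℝ} {L : E3 → ℝ}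

theorem continuous (h : IsLengthScale Z s L) : Continuous L := by
  refine (LipschitzWith.of_le_add_mul 1 fun x y => ?_).continuous
  have := h.le_add x y
  simp only [NNReal.coe_one, one_mul]
  linarith [dist_nonneg (x := x) (y := y)]

theorem shift_pos (h : IsLengthScale Z s L) (y : E3) : 0 < ‖y‖ + s :=
  add_pos_of_nonneg_of_pos (norm_nonneg y) h.pos_shift

theorem pot_pos (h : IsLengthScale Z s L) (y : E3) : 0 < Z / (‖y‖ + s) :=
  div_pos h.pos_charge (h.shift_pos y)

theorem pot_le_two_mul (h : IsLengthScale Z s L) {x y : E3} (hxy : dist x y < 16 * L y) :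
    Z / (‖y‖ + s) ≤ 2 * (Z / (‖x‖ + s)) := by
  have h1 := h.shift_pos x
  have h2 := h.shift_pos y
  have h3 := h.le_norm y
  have h4 : ‖x‖ ≤ ‖y‖ + dist x y := by
    rw [dist_eq_norm]; linarith [norm_sub_norm_le x y]
  have h5 := h.pos_charge
  rw [← mul_div_assoc, div_le_div_iff₀ h2 h1]
  nlinarith

theorem norm_add_le_two_mul (h : IsLengthScale Z s L) {x y : E3} (hxy : dist x y < 16 * L y) :
    ‖y‖ + s ≤ 2 * (‖x‖ + s) := by
  have h1 := h.shift_pos x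
  have h2 := h.shift_pos y
  have h3 := h.le_norm y
  have h4 : ‖y‖ ≤ ‖x‖ + dist x y := by
    rw [dist_comm, dist_eq_norm]; linarith [norm_sub_norm_le y x]
  linarith

theorem le_lintegral_of_subset (h : IsLengthScale Z s L) {Y : Set E3} {x : E3}
    (hY : ball x (L x / 4) ⊆ Y) :
    ENNReal.ofReal (Z / (‖x‖ + s) / 16) ≤ ∫⁻ y in Y ∩ {y | dist x y < L y / 2},
      ENNReal.ofReal (Z / (‖y‖ + s) / L y ^ 3) := by
  have hL := h.pos x
  have hV := h.pot_pos x
  have hsub : ball x (L x / 4) ⊆ Y ∩ {y | dist x y < L y / 2} := fun y hy => by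
    refine ⟨hY hy, ?_⟩
    rw [mem_ball] at hy
    have := h.le_add x y
    rw [dist_comm] at hy
    change dist x y < L y / 2
    linarith
  calc _ = ∫⁻ y in ball x (L x / 4), ENNReal.ofReal (Z / (‖x‖ + s) / (2 * L x ^ 3)) := by
        rw [setLIntegral_const, volume_ball_E3 x (by positivity),
          ← ENNReal.ofReal_mul (by positivity)]
        congr 1
        field_simp
        ring
    _ ≤ ∫⁻ y in ball x (L x / 4), ENNReal.ofReal (Z / (‖y‖ + s) / L y ^ 3) := by
        refine setLIntegral_mono' measurableSet_ball fun y hy => ENNReal.ofReal_le_ofReal ?_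
        rw [mem_ball] at hy
        have h1 := h.le_add y x
        have h2 := h.pos y
        have h3 := h.pot_pos y
        have h4 := h.shift_pos y
        have h5 := h.shift_pos x
        have h6 : L y ^ 3 ≤ (33 / 32 * L x) ^ 3 := by gcongr; linarith
        have h7 : ‖y‖ ≤ ‖x‖ + dist y x := by
          rw [dist_eq_norm]; linarith [norm_sub_norm_le y x]
        have h8 := h.le_norm x
        have hZ := h.pos_charge
        have h9 : Z / (‖x‖ + s) ≤ 17 / 16 * (Z / (‖y‖ + s)) := by
          rw [← mul_div_assoc, div_le_div_iff₀ h5 h4]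
          nlinarith
        rw [div_le_div_iff₀ (by positivity) (by positivity)]
        calc Z / (‖x‖ + s) * L y ^ 3 ≤ (17 / 16 * (Z / (‖y‖ + s))) * (33 / 32 * L x) ^ 3 := by
              gcongr
          _ ≤ _ := by
              have : 0 < Z / (‖y‖ + s) * L x ^ 3 := by positivity
              nlinarith
    _ ≤ _ := lintegral_mono_set hsub

theorem setLIntegral_le (h : IsLengthScale Z s L) (Y : Set E3) (x : E3) {f : E3 → ℝ} {b : ℝ}
    (hb : 0 ≤ b) (hf : ∀ y, dist x y < L y → f y ≤ b / L y ^ 3) :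
    ∫⁻ y in Y ∩ {y | dist x y < L y}, ENNReal.ofReal (f y) ≤ ENNReal.ofReal (32 * b) := by
  have hL := h.pos x
  have hm : MeasurableSet {y | dist x y < L y} :=
    measurableSet_lt (by fun_prop) h.continuous.measurable
  have hsub : {y | dist x y < L y} ⊆ ball x (8 / 7 * L x) := fun y hy => by
    have hy' : dist x y < L y := hy
    have := h.le_add y x
    rw [dist_comm] at this
    rw [mem_ball, dist_comm]
    linarith
  calc _ ≤ ∫⁻ y in {y | dist x y < L y}, ENNReal.ofReal (f y) :=
        lintegral_mono_set Set.inter_subset_right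
    _ ≤ ∫⁻ y in {y | dist x y < L y}, ENNReal.ofReal (2 * b / L x ^ 3) := by
        refine setLIntegral_mono' hm fun y hy => ENNReal.ofReal_le_ofReal ((hf y hy).trans ?_)
        have hy' : dist x y < L y := hy
        have h1 := h.le_add x y
        have h2 := h.pos y
        have h3 : L x ^ 3 ≤ (9 / 8 * L y) ^ 3 := by gcongr; linarith
        rw [div_le_div_iff₀ (by positivity) (by positivity)]
        have h4 : L x ^ 3 ≤ 2 * L y ^ 3 := by nlinarith [pow_pos h2 3]
        nlinarith
    _ ≤ ∫⁻ y in ball x (8 / 7 * L x), ENNReal.ofReal (2 * b / L x ^ 3) :=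
        lintegral_mono_set hsub
    _ ≤ _ := by
        rw [setLIntegral_const, volume_ball_E3 x (by positivity),
          ← ENNReal.ofReal_mul (by positivity)]
        refine ENNReal.ofReal_le_ofReal ?_
        field_simp
        nlinarith

theorem setLIntegral_sq_le (h : IsLengthScale Z s L) (Y : Set E3) (x : E3) :
    ∫⁻ y in Y ∩ {y | dist x y < L y}, ENNReal.ofReal (Z / (‖y‖ + s) / L y ^ 3 * (L y / 2) ^ 2) ≤
      ENNReal.ofReal 8 := by
  have := h.setLIntegral_le Y x (f := fun y => Z / (‖y‖ + s) / L y ^ 3 * (L y / 2) ^ 2)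
    (b := 1 / 4) (by norm_num) fun y _ => by
      have h1 := h.sq_mul_le y
      have h2 := h.pos y
      rw [div_mul_eq_mul_div]
      gcongr
      linarith
  refine this.trans (ENNReal.ofReal_le_ofReal (by norm_num))

theorem setLIntegral_pot_le (h : IsLengthScale Z s L) (Y : Set E3) (x : E3) :
    ∫⁻ y in Y ∩ {y | dist x y < L y}, ENNReal.ofReal (Z / (‖y‖ + s) / L y ^ 3) ≤
      ENNReal.ofReal (64 * (Z / (‖x‖ + s))) := by
  have := h.setLIntegral_le Y x (f := fun y => Z / (‖y‖ + s) / L y ^ 3)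
    (b := 2 * (Z / (‖x‖ + s))) (mul_nonneg two_pos.le (h.pot_pos x).le) fun y hy => by
      have h2 := h.pos y
      gcongr
      exact h.pot_le_two_mul (by linarith)
  refine this.trans (ENNReal.ofReal_le_ofReal (by linarith))

end IsLengthScale

namespace IsLengthScale

variable {Z s : ℝ} {L : E3 → ℝ}

theorem lintegral_pot_lt_top (h : IsLengthScale Z s L) (ρ : Measure E3) [IsFiniteMeasure ρ] :
    ∫⁻ x, ENNReal.ofReal (Z / (‖x‖ + s)) ∂ρ < ∞ := by
  refine lt_of_le_of_lt (lintegral_mono (g := fun _ => ENNReal.ofReal (Z / s)) fun x =>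
    ENNReal.ofReal_le_ofReal ?_) ?_
  · exact div_le_div_of_nonneg_left h.pos_charge.le h.pos_shift
      (by linarith [norm_nonneg x])
  · rw [lintegral_const]
    exact ENNReal.mul_lt_top ENNReal.ofReal_lt_top (measure_lt_top _ _)

/-- Averaging a local bound over all balls of a slowly varying radius. -/
theorem lintegral_pot_le (h : IsLengthScale Z s L) (ρ τ : Measure E3) [IsFiniteMeasure ρ]
    [IsFiniteMeasure τ] {Y : Set E3} (hY : ∀ᵐ x ∂ρ, ball x (L x / 4) ⊆ Y) {M : ℝ≥0∞} {η : ℝ}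
    (hη : η ≤ 1 / 2048)
    (hloc : ∀ y, ρ (ball y (L y / 2)) ≤ M + ENNReal.ofReal η *
      (ENNReal.ofReal ((L y / 2) ^ 2) * τ (ball y (L y)) + ρ (ball y (L y)))) :
    ∫⁻ x, ENNReal.ofReal (Z / (‖x‖ + s)) ∂ρ ≤
      32 * (M * (∫⁻ y in Y, ENNReal.ofReal (Z / (‖y‖ + s) / L y ^ 3)) +
        ENNReal.ofReal η * (8 * τ Set.univ)) := by
  have hLm := h.continuous.measurable
  have hw : Measurable fun y => ENNReal.ofReal (Z / (‖y‖ + s) / L y ^ 3) := by fun_prop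
  have hw2 : Measurable fun y =>
    ENNReal.ofReal (Z / (‖y‖ + s) / L y ^ 3 * (L y / 2) ^ 2) := by fun_prop
  set I := ∫⁻ x, ENNReal.ofReal (Z / (‖x‖ + s)) ∂ρ with hI
  set J := ∫⁻ y in Y, ENNReal.ofReal (Z / (‖y‖ + s) / L y ^ 3) with hJ
  set w := fun y => ENNReal.ofReal (Z / (‖y‖ + s) / L y ^ 3) with hw_def
  have e1 := setLIntegral_mul_measure_ball ρ (Y := Y) hw (hLm.div_const 2)
  have e2 := setLIntegral_mul_measure_ball τ (Y := Y) hw2 hLm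
  have e3 := setLIntegral_mul_measure_ball ρ (Y := Y) hw hLm
  have b1 : ENNReal.ofReal (1 / 16) * I ≤ ∫⁻ y in Y, w y * ρ (ball y (L y / 2)) := by
    rw [e1, hI, ← lintegral_const_mul' _ _ ENNReal.ofReal_ne_top]
    refine lintegral_mono_ae (hY.mono fun x hx => le_trans (le_of_eq ?_)
      (h.le_lintegral_of_subset hx))
    rw [← ENNReal.ofReal_mul (by norm_num)]
    congr 1
    ring
  have b2 : ∫⁻ y in Y, ENNReal.ofReal (Z / (‖y‖ + s) / L y ^ 3 * (L y / 2) ^ 2) *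
      τ (ball y (L y)) ≤ 8 * τ Set.univ := by
    rw [e2]
    calc _ ≤ ∫⁻ _, ENNReal.ofReal 8 ∂τ := lintegral_mono fun x => h.setLIntegral_sq_le Y x
      _ = _ := by rw [lintegral_const]; simp
  have b3 : ∫⁻ y in Y, w y * ρ (ball y (L y)) ≤ 64 * I := by
    rw [e3]
    calc _ ≤ ∫⁻ x, ENNReal.ofReal (64 * (Z / (‖x‖ + s))) ∂ρ :=
          lintegral_mono fun x => h.setLIntegral_pot_le Y x
      _ = ∫⁻ x, 64 * ENNReal.ofReal (Z / (‖x‖ + s)) ∂ρ := by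
          refine lintegral_congr fun x => ?_
          rw [ENNReal.ofReal_mul (by norm_num)]
          simp
      _ = _ := by rw [lintegral_const_mul' _ _ (by simp)]
  have hball : ∀ {r : E3 → ℝ}, Measurable r → ∀ μ : Measure E3, SFinite μ →
      Measurable fun y => μ (ball y (r y)) := fun {r} hr μ _ => by
    have hS : MeasurableSet {p : E3 × E3 | dist p.2 p.1 < r p.1} :=
      measurableSet_lt (by fun_prop) (hr.comp measurable_fst)
    exact measurable_measure_prodMk_left hS
  have hm2 : Measurable fun y => ENNReal.ofReal (Z / (‖y‖ + s) / L y ^ 3 * (L y / 2) ^ 2) *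
      τ (ball y (L y)) := hw2.mul (hball hLm τ inferInstance)
  have key : ENNReal.ofReal (1 / 16) * I ≤
      M * J + ENNReal.ofReal η * (8 * τ Set.univ + 64 * I) := by
    calc _ ≤ ∫⁻ y in Y, w y * ρ (ball y (L y / 2)) := b1
      _ ≤ ∫⁻ y in Y, (w y * M + ENNReal.ofReal η *
          (ENNReal.ofReal (Z / (‖y‖ + s) / L y ^ 3 * (L y / 2) ^ 2) * τ (ball y (L y)) +
            w y * ρ (ball y (L y)))) := by
          refine lintegral_mono fun y => (mul_le_mul' le_rfl (hloc y)).trans (le_of_eq ?_)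
          have hp : 0 ≤ Z / (‖y‖ + s) / L y ^ 3 :=
            div_nonneg (h.pot_pos y).le (pow_nonneg (h.pos y).le 3)
          rw [ENNReal.ofReal_mul hp]
          ring
      _ = M * J + ENNReal.ofReal η * ((∫⁻ y in Y,
          ENNReal.ofReal (Z / (‖y‖ + s) / L y ^ 3 * (L y / 2) ^ 2) * τ (ball y (L y))) +
            ∫⁻ y in Y, w y * ρ (ball y (L y))) := by
          rw [lintegral_add_left (hw.mul_const M), lintegral_mul_const _ hw,
            lintegral_const_mul' _ _ ENNReal.ofReal_ne_top,
            lintegral_add_left hm2, mul_comm M]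
      _ ≤ _ := by gcongr
  have hIfin : I ≠ ∞ := (h.lintegral_pot_lt_top ρ).ne
  have hη' : ENNReal.ofReal η * (64 * I) ≤ ENNReal.ofReal (1 / 32) * I := by
    calc _ = ENNReal.ofReal η * 64 * I := by ring
      _ ≤ ENNReal.ofReal (1 / 2048) * 64 * I := by gcongr
      _ = _ := by
          congr 1
          rw [show (64 : ℝ≥0∞) = ENNReal.ofReal 64 by simp, ← ENNReal.ofReal_mul (by norm_num)]
          norm_num
  have key2 : 2 * I ≤ 32 * (M * J + ENNReal.ofReal η * (8 * τ Set.univ)) + I := by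
    calc 2 * I = 32 * (ENNReal.ofReal (1 / 16) * I) := by
          rw [← mul_assoc, show (32 : ℝ≥0∞) = ENNReal.ofReal 32 by simp,
            ← ENNReal.ofReal_mul (by norm_num)]
          norm_num
      _ ≤ 32 * (M * J + ENNReal.ofReal η * (8 * τ Set.univ) + ENNReal.ofReal (1 / 32) * I) := by
          refine mul_le_mul' le_rfl (key.trans ?_)
          rw [mul_add, ← add_assoc]
          gcongr
      _ = _ := by
          rw [mul_add, ← mul_assoc 32 (ENNReal.ofReal (1 / 32)),
            show (32 : ℝ≥0∞) = ENNReal.ofReal 32 by simp, ← ENNReal.ofReal_mul (by norm_num)]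
          norm_num
  rw [two_mul] at key2
  exact ENNReal.le_of_add_le_add_right hIfin key2

/-- The contribution of the balls in which the field carries substantial energy. -/
theorem exists_setLIntegral_mul_measure_le : ∃ C : ℝ, 0 < C ∧ ∀ (Z s : ℝ) (L : E3 → ℝ),
    IsLengthScale Z s L → ∀ (γ : Measure E3) [SFinite γ] (Y G : Set E3), MeasurableSet G →
      (∀ y ∈ Y, ball y (16 * L y) ⊆ G) →
      ∫⁻ y in Y, ENNReal.ofReal (Z / (‖y‖ + s) / L y ^ 2) * γ (ball y (16 * L y)) ≤
        ENNReal.ofReal (C * Z) * γ G := by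
  obtain ⟨C, hC, hrad⟩ := lintegral_dist_rpow_neg_ball_le (p := 2) (by norm_num)
  refine ⟨648 * C, by positivity, fun Z s L h γ _ Y G hG hYG => ?_⟩
  have hLm := h.continuous.measurable
  have hw : Measurable fun y => ENNReal.ofReal (Z / (‖y‖ + s) / L y ^ 2) := by fun_prop
  rw [setLIntegral_mul_measure_ball γ (Y := Y) hw (hLm.const_mul 16), ← lintegral_indicator_const hG]
  refine lintegral_mono fun x => ?_
  by_cases hx : x ∈ G
  · rw [Set.indicator_of_mem hx]
    have hs := h.shift_pos x
    have hV := h.pot_pos x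
    have hm : MeasurableSet {y | dist x y < 16 * L y} :=
      measurableSet_lt (by fun_prop) (hLm.const_mul 16)
    calc _ ≤ ∫⁻ y in {y | dist x y < 16 * L y}, ENNReal.ofReal (Z / (‖y‖ + s) / L y ^ 2) :=
          lintegral_mono_set Set.inter_subset_right
      _ ≤ ∫⁻ y in {y | dist x y < 16 * L y},
          ENNReal.ofReal (648 * (Z / (‖x‖ + s))) * ENNReal.ofReal (dist x y ^ (-2 : ℝ)) := by
          refine setLIntegral_mono_ae' hm ?_
          filter_upwards [Measure.ae_ne volume x] with y hyx hy
          have hy' : dist x y < 16 * L y := hy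
          have hd : 0 < dist x y := dist_pos.2 hyx.symm
          have h1 := h.pos y
          have h2 := h.pot_le_two_mul hy'
          rw [← ENNReal.ofReal_mul (by positivity)]
          refine ENNReal.ofReal_le_ofReal ?_
          rw [show dist x y ^ (-2 : ℝ) = (dist x y ^ 2)⁻¹ by
            rw [Real.rpow_neg hd.le]; norm_cast, ← div_eq_mul_inv,
            div_le_div_iff₀ (by positivity) (by positivity)]
          have h3 : dist x y ^ 2 ≤ (16 * L y) ^ 2 := by gcongr
          calc _ ≤ 2 * (Z / (‖x‖ + s)) * (16 * L y) ^ 2 := by gcongr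
            _ ≤ _ := by nlinarith [mul_pos hV (pow_pos h1 2)]
      _ ≤ ∫⁻ y in ball x (‖x‖ + s),
          ENNReal.ofReal (648 * (Z / (‖x‖ + s))) * ENNReal.ofReal (dist x y ^ (-2 : ℝ)) := by
          refine lintegral_mono_set fun y hy => ?_
          have hy' : dist x y < 16 * L y := hy
          have h1 := h.norm_add_le_two_mul hy'
          have h2 := h.le_norm y
          rw [mem_ball, dist_comm]
          linarith
      _ ≤ ENNReal.ofReal (648 * (Z / (‖x‖ + s))) * ENNReal.ofReal (C * (‖x‖ + s) ^ (3 - 2 : ℝ)) := by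
          rw [lintegral_const_mul' _ _ ENNReal.ofReal_ne_top]
          gcongr
          exact hrad x _ hs
      _ = _ := by
          rw [← ENNReal.ofReal_mul (by positivity), show (3 - 2 : ℝ) = 1 by norm_num, Real.rpow_one]
          congr 1
          field_simp
  · rw [Set.indicator_of_notMem hx]
    refine le_of_eq ?_
    have : Y ∩ {y | dist x y < 16 * L y} = ∅ := by
      ext y
      simp only [Set.mem_inter_iff, Set.mem_ofPred_eq, Set.mem_empty_iff_false, iff_false, not_and]
      exact fun hy hxy => hx (hYG y hy hxy)
    rw [this]
    simp

end IsLengthScale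

/-- The Coulomb length scale, capped by the distance to the nucleus. -/
def coulombScale (c a s : ℝ) (y : E3) : ℝ := c * min (√(a * (‖y‖ + a))) (‖y‖ + s)

theorem exists_setLIntegral_coulombScale_le : ∃ C : ℝ, 0 < C ∧ ∀ c Z s R : ℝ,
    0 < c → 0 < Z → 0 < s → 0 < R →
      ∫⁻ y in ball (0 : E3) R, ENNReal.ofReal (Z / (‖y‖ + s) / coulombScale c Z⁻¹ s y ^ 3) ≤
        ENNReal.ofReal (C * (c ^ 3)⁻¹ * (Z ^ (5 / 2 : ℝ) * R ^ (1 / 2 : ℝ))) +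
          ENNReal.ofReal (C * (c ^ 3)⁻¹ * (Z / s)) := by
  obtain ⟨C₁, hC₁, h₁⟩ := lintegral_norm_rpow_neg_ball_le (p := 5 / 2) (by norm_num)
  obtain ⟨C₂, hC₂, h₂⟩ := lintegral_norm_add_rpow_neg_four_le
  refine ⟨max C₁ C₂, lt_max_of_lt_left hC₁, fun c Z s R hc hZ hs hR => ?_⟩
  have hm : Measurable fun y : E3 => ENNReal.ofReal ((c ^ 3)⁻¹ * Z ^ (5 / 2 : ℝ)) *
      ENNReal.ofReal (‖y‖ ^ (-(5 / 2) : ℝ)) := by fun_prop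
  calc _ ≤ ∫⁻ y in ball (0 : E3) R, (ENNReal.ofReal ((c ^ 3)⁻¹ * Z ^ (5 / 2 : ℝ)) *
        ENNReal.ofReal (‖y‖ ^ (-(5 / 2) : ℝ)) +
        ENNReal.ofReal ((c ^ 3)⁻¹ * Z) * ENNReal.ofReal ((‖y‖ + s) ^ (-4 : ℝ))) := by
        refine setLIntegral_mono_ae' measurableSet_ball ?_
        filter_upwards [Measure.ae_ne volume (0 : E3)] with y hy0 _
        have hy : 0 < ‖y‖ := norm_pos_iff.2 hy0
        rw [← ENNReal.ofReal_mul (by positivity), ← ENNReal.ofReal_mul (by positivity),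
          ← ENNReal.ofReal_add (by positivity) (by positivity)]
        refine ENNReal.ofReal_le_ofReal ?_
        have hT1 : 0 ≤ (c ^ 3)⁻¹ * Z ^ (5 / 2 : ℝ) * ‖y‖ ^ (-(5 / 2) : ℝ) := by positivity
        have hT2 : 0 ≤ (c ^ 3)⁻¹ * Z * (‖y‖ + s) ^ (-4 : ℝ) := by positivity
        rcases min_choice (√(Z⁻¹ * (‖y‖ + Z⁻¹))) (‖y‖ + s) with hmin | hmin
        · refine le_trans ?_ (le_add_of_nonneg_right hT2)
          rw [coulombScale, hmin]
          have hq : (Z⁻¹ * ‖y‖) ^ (1 / 2 : ℝ) ≤ √(Z⁻¹ * (‖y‖ + Z⁻¹)) := by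
            rw [← Real.sqrt_eq_rpow]
            refine Real.sqrt_le_sqrt ?_
            gcongr
            linarith [inv_pos.2 hZ]
          calc _ ≤ Z / ‖y‖ / (c * (Z⁻¹ * ‖y‖) ^ (1 / 2 : ℝ)) ^ 3 := by
                gcongr
                linarith
            _ = _ := by
                have e1 : ((Z⁻¹ * ‖y‖) ^ (1 / 2 : ℝ)) ^ 3 = (Z ^ (3 / 2 : ℝ))⁻¹ * ‖y‖ ^ (3 / 2 : ℝ) := by
                  rw [← Real.rpow_natCast, ← Real.rpow_mul (by positivity),
                    Real.mul_rpow (by positivity) (by positivity), Real.inv_rpow hZ.le]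
                  norm_num
                have e2 : Z ^ (5 / 2 : ℝ) = Z * Z ^ (3 / 2 : ℝ) := by
                  rw [show (5 / 2 : ℝ) = 1 + 3 / 2 by norm_num, Real.rpow_add hZ, Real.rpow_one]
                have e3 : ‖y‖ ^ (-(5 / 2) : ℝ) = (‖y‖ * ‖y‖ ^ (3 / 2 : ℝ))⁻¹ := by
                  rw [Real.rpow_neg hy.le, show (5 / 2 : ℝ) = 1 + 3 / 2 by norm_num,
                    Real.rpow_add hy, Real.rpow_one]
                rw [mul_pow, e1, e2, e3]
                have : 0 < Z ^ (3 / 2 : ℝ) := by positivity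
                have : 0 < ‖y‖ ^ (3 / 2 : ℝ) := by positivity
                field_simp
        · refine le_trans (le_of_eq ?_) (le_add_of_nonneg_left hT1)
          rw [coulombScale, hmin, show (‖y‖ + s) ^ (-4 : ℝ) = ((‖y‖ + s) ^ 4)⁻¹ by
            rw [Real.rpow_neg (by positivity)]; norm_cast]
          field_simp
    _ = ENNReal.ofReal ((c ^ 3)⁻¹ * Z ^ (5 / 2 : ℝ)) *
          (∫⁻ y in ball (0 : E3) R, ENNReal.ofReal (‖y‖ ^ (-(5 / 2) : ℝ))) +
        ENNReal.ofReal ((c ^ 3)⁻¹ * Z) *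
          ∫⁻ y in ball (0 : E3) R, ENNReal.ofReal ((‖y‖ + s) ^ (-4 : ℝ)) := by
        rw [lintegral_add_left hm, lintegral_const_mul' _ _ ENNReal.ofReal_ne_top,
          lintegral_const_mul' _ _ ENNReal.ofReal_ne_top]
    _ ≤ ENNReal.ofReal ((c ^ 3)⁻¹ * Z ^ (5 / 2 : ℝ)) *
          ENNReal.ofReal (C₁ * R ^ (3 - 5 / 2 : ℝ)) +
        ENNReal.ofReal ((c ^ 3)⁻¹ * Z) * ENNReal.ofReal (C₂ / s) := by
        refine add_le_add (mul_le_mul' le_rfl (h₁ R hR)) (mul_le_mul' le_rfl ?_)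
        exact (setLIntegral_le_lintegral _ _).trans (h₂ s hs)
    _ ≤ _ := by
        rw [← ENNReal.ofReal_mul (by positivity), ← ENNReal.ofReal_mul (by positivity)]
        refine add_le_add (ENNReal.ofReal_le_ofReal ?_) (ENNReal.ofReal_le_ofReal ?_)
        · rw [show (3 - 5 / 2 : ℝ) = 1 / 2 by norm_num]
          calc _ = C₁ * ((c ^ 3)⁻¹ * (Z ^ (5 / 2 : ℝ) * R ^ (1 / 2 : ℝ))) := by ring
            _ ≤ max C₁ C₂ * ((c ^ 3)⁻¹ * (Z ^ (5 / 2 : ℝ) * R ^ (1 / 2 : ℝ))) := by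
                gcongr; exact le_max_left _ _
            _ = _ := by ring
        · calc _ = C₂ * ((c ^ 3)⁻¹ * (Z / s)) := by ring
            _ ≤ max C₁ C₂ * ((c ^ 3)⁻¹ * (Z / s)) := by gcongr; exact le_max_right _ _
            _ = _ := by ring

theorem sqrt_mul_add_le_add_dist {a : ℝ} (ha : 0 < a) (y x : E3) :
    √(a * (‖y‖ + a)) ≤ √(a * (‖x‖ + a)) + dist y x := by
  have hd := dist_nonneg (x := y) (y := x)
  refine Real.sqrt_le_iff.2 ⟨by positivity, ?_⟩
  have h1 : a ≤ √(a * (‖x‖ + a)) := Real.le_sqrt_of_sq_le (by nlinarith [norm_nonneg x])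
  have h2 : √(a * (‖x‖ + a)) ^ 2 = a * (‖x‖ + a) := Real.sq_sqrt (by positivity)
  have h3 : ‖y‖ ≤ ‖x‖ + dist y x := by
    rw [dist_eq_norm]; linarith [norm_sub_norm_le y x]
  nlinarith [mul_le_mul_of_nonneg_right h1 hd]

section Scale

variable {c a s : ℝ}

theorem coulombScale_pos (hc : 0 < c) (ha : 0 < a) (hs : 0 < s) (y : E3) :
    0 < coulombScale c a s y := by
  have := norm_nonneg y
  exact mul_pos hc (lt_min (Real.sqrt_pos.2 (by positivity)) (by positivity))

theorem coulombScale_le_norm (hc : 0 < c) (y : E3) : coulombScale c a s y ≤ c * (‖y‖ + s) :=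
  mul_le_mul_of_nonneg_left (min_le_right _ _) hc.le

theorem coulombScale_le_add (hc : 0 < c) (hc8 : c ≤ 1 / 256) (ha : 0 < a) (y x : E3) :
    coulombScale c a s y ≤ coulombScale c a s x + dist y x / 8 := by
  have h1 := sqrt_mul_add_le_add_dist ha y x
  have h3 : ‖y‖ ≤ ‖x‖ + dist y x := by
    rw [dist_eq_norm]; linarith [norm_sub_norm_le y x]
  have h2 : min (√(a * (‖y‖ + a))) (‖y‖ + s) ≤
      min (√(a * (‖x‖ + a))) (‖x‖ + s) + dist y x := by
    rw [← min_add_add_right]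
    exact min_le_min h1 (by linarith)
  have hd := dist_nonneg (x := y) (y := x)
  unfold coulombScale
  nlinarith

theorem sq_coulombScale_mul_le (hc : 0 < c) (hc8 : c ≤ 1 / 256) (ha : 0 < a) (hs : 0 < s)
    (y : E3) : coulombScale c a s y ^ 2 * (a⁻¹ / (‖y‖ + s)) ≤ 1 := by
  have hy := norm_nonneg y
  have hS : 0 ≤ √(a * (‖y‖ + a)) := Real.sqrt_nonneg _
  have hsq : √(a * (‖y‖ + a)) ^ 2 = a * (‖y‖ + a) := Real.sq_sqrt (by positivity)
  have hmin : min (√(a * (‖y‖ + a))) (‖y‖ + s) ^ 2 ≤ 2 * a * (‖y‖ + s) := by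
    have h0 : 0 ≤ min (√(a * (‖y‖ + a))) (‖y‖ + s) := le_min hS (by positivity)
    have h1 := min_le_left (√(a * (‖y‖ + a))) (‖y‖ + s)
    have h2 := min_le_right (√(a * (‖y‖ + a))) (‖y‖ + s)
    rcases le_total ‖y‖ a with h | h
    · have h3 : √(a * (‖y‖ + a)) ≤ 2 * a := by
        refine Real.sqrt_le_iff.2 ⟨by positivity, by nlinarith⟩
      rw [pow_two]
      exact mul_le_mul (h1.trans h3) h2 h0 (by positivity)
    · calc _ ≤ √(a * (‖y‖ + a)) ^ 2 := pow_le_pow_left₀ h0 h1 2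
        _ ≤ _ := by rw [hsq]; nlinarith
  have hpos : 0 < ‖y‖ + s := by positivity
  rw [coulombScale, mul_pow]
  have h4 : c ^ 2 ≤ 1 / 2 := by nlinarith
  calc _ ≤ 1 / 2 * (2 * a * (‖y‖ + s)) * (a⁻¹ / (‖y‖ + s)) := by gcongr
    _ = 1 := by field_simp

theorem isLengthScale_stopScale {γ : Measure E3} {ε Z B : ℝ} (hc : 0 < c) (hc8 : c ≤ 1 / 256)
    (hZ : 0 < Z) (hs : 0 < s) (hε : 0 < ε)
    (hB : ∀ (y : E3) (r : ℝ), 0 < r → γ (ball y r) ≤ ENNReal.ofReal (B * r ^ 3)) :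
    IsLengthScale Z s fun y => stopScale γ ε (coulombScale c Z⁻¹ s y) y where
  pos_charge := hZ
  pos_shift := hs
  pos y := stopScale_pos (coulombScale_pos hc (inv_pos.2 hZ) hs y) hε (hB y)
  le_add y x := stopScale_le_add (coulombScale_pos hc (inv_pos.2 hZ) hs y).le
    (coulombScale_pos hc (inv_pos.2 hZ) hs x).le (coulombScale_le_add hc hc8 (inv_pos.2 hZ) y x)
  le_norm y := by
    have h1 := stopScale_le (γ := γ) (ε := ε) (y := y)
      (coulombScale_pos hc (inv_pos.2 hZ) hs y).le
    have h2 := coulombScale_le_norm (a := Z⁻¹) (s := s) hc y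
    have h3 : c * (‖y‖ + s) ≤ 1 / 256 * (‖y‖ + s) := by gcongr
    linarith
  sq_mul_le y := by
    have h0 := coulombScale_pos hc (inv_pos.2 hZ) hs y
    have h1 := stopScale_le (γ := γ) (ε := ε) (y := y) h0.le
    have h2 := stopScale_pos h0 hε (hB y)
    have h3 := sq_coulombScale_mul_le hc hc8 (inv_pos.2 hZ) hs y
    rw [inv_inv] at h3
    refine le_trans ?_ h3
    gcongr

theorem exists_setLIntegral_stopScale_le {c ε : ℝ} (hc : 0 < c) (hc8 : c ≤ 1 / 256)
    (hε : 0 < ε) : ∃ C : ℝ, 0 < C ∧ ∀ (Z d B : ℝ) (γ : Measure E3) [SFinite γ],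
      0 < Z → 1 ≤ Z * d →
      (∀ (y : E3) (r : ℝ), 0 < r → γ (ball y r) ≤ ENNReal.ofReal (B * r ^ 3)) →
      ∀ (s : ℝ) (L : E3 → ℝ), s = stopScale γ ε (c * Z⁻¹) 0 →
      (L = fun y => stopScale γ ε (coulombScale c Z⁻¹ s y) y) →
      ∫⁻ y in {y | enorm3 y < 5 / 2 * d}, ENNReal.ofReal (Z / (‖y‖ + s) / L y ^ 3) ≤
        ENNReal.ofReal (C * (Z ^ (5 / 2 : ℝ) * d ^ (1 / 2 : ℝ))) +
          ENNReal.ofReal (C * Z) * γ {y | enorm3 y ≤ 3 * d} := by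
  obtain ⟨C₁, hC₁, h₁⟩ := exists_setLIntegral_coulombScale_le
  obtain ⟨C₂, hC₂, h₂⟩ := IsLengthScale.exists_setLIntegral_mul_measure_le
  set k := C₁ * (c ^ 3)⁻¹ with hk
  have hk0 : 0 < k := by positivity
  refine ⟨(5 / 2) ^ (1 / 2 : ℝ) * k + k / c + 2 * k / ε + 2 / ε * C₂, by positivity, ?_⟩
  intro Z d B γ _ hZ hZd hB s L hs_def hL_def
  have ha : 0 < Z⁻¹ := inv_pos.2 hZ
  have hd : 0 < d := pos_of_mul_pos_right (by linarith) hZ.le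
  have had : Z⁻¹ ≤ d := by
    rw [inv_le_iff_one_le_mul₀' hZ]; exact hZd
  have hca : 0 < c * Z⁻¹ := by positivity
  have hs : 0 < s := hs_def ▸ stopScale_pos hca hε (hB 0)
  have hsca : s ≤ c * Z⁻¹ := hs_def ▸ stopScale_le hca.le
  have hsd : s ≤ d / 256 := by
    calc s ≤ c * Z⁻¹ := hsca
      _ ≤ 1 / 256 * d := by gcongr
      _ = _ := by ring
  have hLS : IsLengthScale Z s L := hL_def ▸ isLengthScale_stopScale hc hc8 hZ hs hε hB
  have hLm := hLS.continuous.measurable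
  set G := {y : E3 | enorm3 y ≤ 3 * d} with hG
  set Y := {y : E3 | enorm3 y < 5 / 2 * d} with hY
  have hGm : MeasurableSet G := measurableSet_le continuous_enorm3.measurable measurable_const
  have hYG : ∀ y ∈ Y, ball y (16 * L y) ⊆ G := fun y hy x hx => by
    have hy' : enorm3 y < 5 / 2 * d := hy
    rw [mem_ball] at hx
    have h1 := hLS.le_norm y
    have h2 := enorm3_le_add_dist x y
    have h3 := norm_le_enorm3 y
    change enorm3 x ≤ 3 * d
    linarith
  have h0G : ball (0 : E3) (16 * s) ⊆ G := fun x hx => by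
    rw [mem_ball] at hx
    have h2 := enorm3_le_add_dist x 0
    have h3 : enorm3 (0 : E3) = 0 := by simp [enorm3]
    change enorm3 x ≤ 3 * d
    linarith
  have hpt : ∀ y, ENNReal.ofReal (Z / (‖y‖ + s) / L y ^ 3) ≤
      ENNReal.ofReal (Z / (‖y‖ + s) / coulombScale c Z⁻¹ s y ^ 3) +
        ENNReal.ofReal (2 / ε) *
          (ENNReal.ofReal (Z / (‖y‖ + s) / L y ^ 2) * γ (ball y (16 * L y))) := fun y => by
    have hLy := hLS.pos y
    have hV := hLS.pot_pos y
    have h := stopScale_eq_or_le (γ := γ) (ε := ε) (m := coulombScale c Z⁻¹ s y) (y := y)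
      (by have := hLS.pos y; rw [hL_def] at this; exact this) (coulombScale_pos hc ha hs y).le
    have e : stopScale γ ε (coulombScale c Z⁻¹ s y) y = L y := by rw [hL_def]
    rw [e] at h
    rcases h with h | h
    · rw [h]
      exact le_self_add
    · refine le_trans ?_ le_add_self
      calc _ = ENNReal.ofReal (Z / (‖y‖ + s) / L y ^ 3 / ε) * ENNReal.ofReal ε := by
            rw [← ENNReal.ofReal_mul (by positivity)]
            congr 1
            field_simp
        _ ≤ ENNReal.ofReal (Z / (‖y‖ + s) / L y ^ 3 / ε) *
            (ENNReal.ofReal (2 * L y) * γ (ball y (16 * L y))) := mul_le_mul' le_rfl h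
        _ = _ := by
            rw [← mul_assoc, ← mul_assoc, ← ENNReal.ofReal_mul (by positivity),
              ← ENNReal.ofReal_mul (by positivity)]
            congr 2
            field_simp
  have hm1 : Measurable fun y : E3 =>
      ENNReal.ofReal (Z / (‖y‖ + s) / coulombScale c Z⁻¹ s y ^ 3) := by
    unfold coulombScale
    fun_prop
  have hYb : Y ⊆ ball 0 (5 / 2 * d) := fun y hy => by
    have hy' : enorm3 y < 5 / 2 * d := hy
    rw [mem_ball, dist_zero_right]
    exact (norm_le_enorm3 y).trans_lt hy'
  have hZd2 : Z ^ 2 ≤ Z ^ (5 / 2 : ℝ) * d ^ (1 / 2 : ℝ) := by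
    have h1 : Z ^ (5 / 2 : ℝ) = Z ^ 2 * Z ^ (1 / 2 : ℝ) := by
      rw [show (5 / 2 : ℝ) = 2 + 1 / 2 by norm_num, Real.rpow_add hZ]
      norm_cast
    rw [h1, mul_assoc, ← Real.mul_rpow hZ.le hd.le]
    exact le_mul_of_one_le_right (by positivity) (Real.one_le_rpow hZd (by norm_num))
  have hs2 : ENNReal.ofReal (k * (Z / s)) ≤
      ENNReal.ofReal (k / c * (Z ^ (5 / 2 : ℝ) * d ^ (1 / 2 : ℝ))) +
        ENNReal.ofReal (2 * k / ε * Z) * γ G := by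
    have h := stopScale_eq_or_le (γ := γ) (ε := ε) (m := c * Z⁻¹) (y := 0)
      (hs_def ▸ hs) hca.le
    rw [← hs_def] at h
    rcases h with h | h
    · refine le_trans (ENNReal.ofReal_le_ofReal ?_) le_self_add
      calc _ = k / c * Z ^ 2 := by rw [h]; field_simp
        _ ≤ _ := by gcongr
    · refine le_trans ?_ le_add_self
      calc _ = ENNReal.ofReal (k * (Z / s) / ε) * ENNReal.ofReal ε := by
            rw [← ENNReal.ofReal_mul (by positivity)]
            congr 1
            field_simp
        _ ≤ ENNReal.ofReal (k * (Z / s) / ε) * (ENNReal.ofReal (2 * s) * γ G) :=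
            mul_le_mul' le_rfl (h.trans (mul_le_mul' le_rfl (measure_mono h0G)))
        _ = _ := by
            rw [← mul_assoc, ← ENNReal.ofReal_mul (by positivity)]
            congr 2
            field_simp
  set P := Z ^ (5 / 2 : ℝ) * d ^ (1 / 2 : ℝ) with hP
  have hP0 : 0 < P := by positivity
  calc _ ≤ ∫⁻ y in Y, (ENNReal.ofReal (Z / (‖y‖ + s) / coulombScale c Z⁻¹ s y ^ 3) +
        ENNReal.ofReal (2 / ε) *
          (ENNReal.ofReal (Z / (‖y‖ + s) / L y ^ 2) * γ (ball y (16 * L y)))) :=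
        lintegral_mono hpt
    _ = (∫⁻ y in Y, ENNReal.ofReal (Z / (‖y‖ + s) / coulombScale c Z⁻¹ s y ^ 3)) +
        ENNReal.ofReal (2 / ε) * ∫⁻ y in Y,
          ENNReal.ofReal (Z / (‖y‖ + s) / L y ^ 2) * γ (ball y (16 * L y)) := by
        rw [lintegral_add_left hm1, lintegral_const_mul' _ _ ENNReal.ofReal_ne_top]
    _ ≤ (ENNReal.ofReal (k * (Z ^ (5 / 2 : ℝ) * (5 / 2 * d) ^ (1 / 2 : ℝ))) +
          ENNReal.ofReal (k * (Z / s))) +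
        ENNReal.ofReal (2 / ε) * (ENNReal.ofReal (C₂ * Z) * γ G) := by
        refine add_le_add ?_ (mul_le_mul' le_rfl (h₂ Z s L hLS γ Y G hGm hYG))
        exact (lintegral_mono_set hYb).trans (h₁ c Z s (5 / 2 * d) hc hZ hs (by positivity))
    _ ≤ (ENNReal.ofReal ((5 / 2) ^ (1 / 2 : ℝ) * k * P) +
          (ENNReal.ofReal (k / c * P) + ENNReal.ofReal (2 * k / ε * Z) * γ G)) +
        ENNReal.ofReal (2 / ε * C₂ * Z) * γ G := by
        refine add_le_add (add_le_add (le_of_eq ?_) hs2) (le_of_eq ?_)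
        · congr 1
          rw [Real.mul_rpow (by norm_num) hd.le]
          ring
        · rw [← mul_assoc, ← ENNReal.ofReal_mul (by positivity), mul_assoc (2 / ε)]
    _ = ENNReal.ofReal (((5 / 2) ^ (1 / 2 : ℝ) * k + k / c) * P) +
        ENNReal.ofReal ((2 * k / ε + 2 / ε * C₂) * Z) * γ G := by
        rw [add_mul _ _ P, add_mul _ _ Z, ENNReal.ofReal_add (by positivity) (by positivity),
          ENNReal.ofReal_add (by positivity) (by positivity)]
        ring
    _ ≤ _ := by
        refine add_le_add (ENNReal.ofReal_le_ofReal ?_)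
          (mul_le_mul' (ENNReal.ofReal_le_ofReal ?_) le_rfl)
        · refine mul_le_mul_of_nonneg_right ?_ hP0.le
          have : 0 ≤ 2 * k / ε + 2 / ε * C₂ := by positivity
          linarith
        · refine mul_le_mul_of_nonneg_right ?_ hZ.le
          have : 0 ≤ (5 / 2 : ℝ) ^ (1 / 2 : ℝ) * k + k / c := by positivity
          linarith

end Scale

/-- Local bounds on one-particle density and kinetic energy measures, valid on balls where the
field energy measure `γ` is small, imply a bound on the total Coulomb attraction. -/
theorem exists_lintegral_coulomb_le {C₀ ε c₁ : ℝ} (hC₀ : 0 < C₀) (hε : 0 < ε) (hc₁ : 0 < c₁) :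
    ∃ C : ℝ, 0 < C ∧ ∀ (Z d B : ℝ) (γ ρ τ : Measure E3) [SFinite γ] [IsFiniteMeasure ρ]
      [IsFiniteMeasure τ], 1 ≤ Z → 0 < d → C ≤ Z * d →
      (∀ (y : E3) (r : ℝ), 0 < r → γ (ball y r) ≤ ENNReal.ofReal (B * r ^ 3)) →
      ρ {x | 2 * d < enorm3 x} = 0 →
      (∀ (y : E3) (l : ℝ), 0 < l → γ (ball y (4 * l)) ≤ ENNReal.ofReal (ε / l) →
        (∀ K : ℕ, 0 < K → ρ (ball y l) ≤ 32 * K ^ 3 + ENNReal.ofReal (C₀ / K ^ 2) *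
          (ENNReal.ofReal (l ^ 2) * τ (ball y (2 * l)) + ρ (ball y (2 * l)))) ∧
        (y = 0 → ∫⁻ x in ball y l, ENNReal.ofReal ‖x‖⁻¹ ∂ρ ≤ ENNReal.ofReal (C₀ * l) *
          (τ (ball y (2 * l)) + ENNReal.ofReal (l⁻¹ ^ 2) * ρ (ball y (2 * l))))) →
      ∫⁻ x, ENNReal.ofReal (Z / enorm3 x + 2 * (c₁ / d) ^ 2) ∂ρ ≤
        τ Set.univ + ENNReal.ofReal (C * (Z ^ (5 / 2 : ℝ) * d ^ (1 / 2 : ℝ))) +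
          ENNReal.ofReal (C * Z) * γ {y | enorm3 y ≤ 3 * d} := by
  set c := min (1 / 256) (1 / C₀) with hc_def
  have hc : 0 < c := lt_min (by norm_num) (by positivity)
  have hc8 : c ≤ 1 / 256 := min_le_left _ _
  have hcC : C₀ * c ≤ 1 := by
    calc C₀ * c ≤ C₀ * (1 / C₀) := by gcongr; exact min_le_right _ _
      _ = 1 := by field_simp
  obtain ⟨K, hK⟩ := exists_nat_ge (2048 * C₀ * (C₀ + 1) + 1)
  have hK1 : (1 : ℝ) ≤ K := by nlinarith
  have hKpos : 0 < K := by exact_mod_cast (by linarith : (0 : ℝ) < K)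
  set η := C₀ / (K : ℝ) ^ 2 with hη_def
  have hη0 : 0 < η := by positivity
  have hηC : η * (2048 * (C₀ + 1)) ≤ 1 := by
    rw [hη_def, div_mul_eq_mul_div, div_le_one (by positivity)]
    nlinarith
  have hη : η ≤ 1 / 2048 := by nlinarith
  obtain ⟨C₁, hC₁, h₁⟩ := exists_setLIntegral_stopScale_le hc hc8 hε
  set k := 4 * (C₀ + 1) * (32 * (32 * K ^ 3)) with hk
  have hk0 : 0 < k := by positivity
  refine ⟨k * C₁ + 6 * c₁ ^ 2 + 1, by positivity, ?_⟩
  intro Z d B γ ρ τ _ _ _ hZ1 hd hZd hB hρ hloc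
  have hZ : 0 < Z := by linarith
  have hkC : 0 < k * C₁ := by positivity
  have hZd1 : 1 ≤ Z * d := by nlinarith [sq_nonneg c₁]
  have hZd6 : 6 * c₁ ^ 2 ≤ Z * d := by linarith
  have hca : 0 < c * Z⁻¹ := by positivity
  have had : Z⁻¹ ≤ d := by
    rw [inv_le_iff_one_le_mul₀' hZ]; exact hZd1
  obtain ⟨s, hs_def⟩ : ∃ s, s = stopScale γ ε (c * Z⁻¹) 0 := ⟨_, rfl⟩
  obtain ⟨L, hL_def⟩ : ∃ L, L = fun y => stopScale γ ε (coulombScale c Z⁻¹ s y) y := ⟨_, rfl⟩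
  have hs : 0 < s := hs_def ▸ stopScale_pos hca hε (hB 0)
  have hsca : s ≤ c * Z⁻¹ := hs_def ▸ stopScale_le hca.le
  have hsd : s ≤ d / 256 := by
    calc s ≤ c * Z⁻¹ := hsca
      _ ≤ 1 / 256 * d := by gcongr
      _ = _ := by ring
  have hLS : IsLengthScale Z s L := hL_def ▸ isLengthScale_stopScale hc hc8 hZ hs hε hB
  have hρ2 : ∀ᵐ x ∂ρ, enorm3 x ≤ 2 * d := by
    rw [ae_iff]
    simpa only [not_le] using hρ
  set I := ∫⁻ x, ENNReal.ofReal (Z / (‖x‖ + s)) ∂ρ with hI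
  have hJ := h₁ Z d B γ hZ hZd1 hB s L hs_def hL_def
  set J := ∫⁻ y in {y | enorm3 y < 5 / 2 * d}, ENNReal.ofReal (Z / (‖y‖ + s) / L y ^ 3) with hJ_def
  have hIJ : I ≤ 32 * (32 * K ^ 3 * J + ENNReal.ofReal η * (8 * τ Set.univ)) := by
    refine hLS.lintegral_pot_le ρ τ (hρ2.mono fun x hx y hy => ?_) hη fun y => ?_
    · have h1 := hLS.le_norm x
      have h2 := norm_le_enorm3 x
      have h3 := enorm3_le_add_dist y x
      rw [mem_ball] at hy
      change enorm3 y < 5 / 2 * d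
      linarith
    · have hLy := hLS.pos y
      have hm := coulombScale_pos hc (inv_pos.2 hZ) hs y
      have e : stopScale γ ε (coulombScale c Z⁻¹ s y) y = L y := by rw [hL_def]
      have hsmall := measure_ball_half_stopScale_le (γ := γ) (ε := ε) (y := y)
        (m := coulombScale c Z⁻¹ s y) (by rw [e]; exact hLy) hm.le
      rw [e] at hsmall
      have h := (hloc y (L y / 2) (by positivity) hsmall).1 K hKpos
      rwa [mul_div_cancel₀ _ (two_ne_zero' ℝ)] at h
  have hcore : ∫⁻ x in ball (0 : E3) (s / 2), ENNReal.ofReal ‖x‖⁻¹ ∂ρ ≤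
      ENNReal.ofReal (C₀ * (s / 2)) *
        (τ Set.univ + ENNReal.ofReal ((s / 2)⁻¹ ^ 2) * ρ (ball 0 s)) := by
    have hsmall := measure_ball_half_stopScale_le (γ := γ) (ε := ε) (y := 0) (m := c * Z⁻¹)
      (hs_def ▸ hs) hca.le
    rw [← hs_def] at hsmall
    have h := (hloc 0 (s / 2) (by positivity) hsmall).2 rfl
    rw [mul_div_cancel₀ _ (two_ne_zero' ℝ)] at h
    refine h.trans ?_
    gcongr
    exact Set.subset_univ _
  have hball : ENNReal.ofReal (Z / (2 * s)) * ρ (ball 0 s) ≤ I := by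
    rw [← setLIntegral_const]
    refine le_trans (setLIntegral_mono' measurableSet_ball fun x hx => ?_)
      (setLIntegral_le_lintegral (ball 0 s) _)
    rw [mem_ball, dist_zero_right] at hx
    refine ENNReal.ofReal_le_ofReal ?_
    gcongr
    linarith
  have hcoul : ENNReal.ofReal Z * ∫⁻ x in ball (0 : E3) (s / 2), ENNReal.ofReal ‖x‖⁻¹ ∂ρ ≤
      ENNReal.ofReal (1 / 2) * τ Set.univ + ENNReal.ofReal (4 * C₀) * I := by
    calc _ ≤ ENNReal.ofReal Z * (ENNReal.ofReal (C₀ * (s / 2)) *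
          (τ Set.univ + ENNReal.ofReal ((s / 2)⁻¹ ^ 2) * ρ (ball 0 s))) :=
          mul_le_mul' le_rfl hcore
      _ = ENNReal.ofReal (Z * (C₀ * (s / 2))) * τ Set.univ +
          ENNReal.ofReal (Z * (C₀ * (s / 2)) * (s / 2)⁻¹ ^ 2) * ρ (ball 0 s) := by
          rw [← mul_assoc, ← ENNReal.ofReal_mul hZ.le, mul_add, ← mul_assoc (ENNReal.ofReal _),
            ← ENNReal.ofReal_mul (by positivity)]
      _ ≤ _ := by
          refine add_le_add (mul_le_mul' (ENNReal.ofReal_le_ofReal ?_) le_rfl) ?_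
          · calc Z * (C₀ * (s / 2)) ≤ Z * (C₀ * (c * Z⁻¹ / 2)) := by gcongr
              _ = C₀ * c / 2 := by field_simp
              _ ≤ _ := by linarith
          · calc _ = ENNReal.ofReal (4 * C₀) * (ENNReal.ofReal (Z / (2 * s)) * ρ (ball 0 s)) := by
                  rw [← mul_assoc (ENNReal.ofReal _), ← ENNReal.ofReal_mul (by positivity)]
                  congr 2
                  field_simp
                  ring
              _ ≤ _ := mul_le_mul' le_rfl hball
  have hpt : ∀ x : E3, enorm3 x ≤ 2 * d → ENNReal.ofReal (Z / enorm3 x + 2 * (c₁ / d) ^ 2) ≤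
      (ball (0 : E3) (s / 2)).indicator (fun x => ENNReal.ofReal Z * ENNReal.ofReal ‖x‖⁻¹) x +
        4 * ENNReal.ofReal (Z / (‖x‖ + s)) := fun x hx => by
    have hxs := hLS.shift_pos x
    have hV := hLS.pot_pos x
    have hxn := norm_le_enorm3 x
    have hgrad : 2 * (c₁ / d) ^ 2 ≤ Z / (‖x‖ + s) := by
      rw [div_pow, ← mul_div_assoc, div_le_div_iff₀ (by positivity) hxs]
      have h1 : ‖x‖ + s ≤ 3 * d := by linarith
      calc 2 * c₁ ^ 2 * (‖x‖ + s) ≤ 2 * c₁ ^ 2 * (3 * d) := by gcongr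
        _ = 6 * c₁ ^ 2 * d := by ring
        _ ≤ Z * d * d := by gcongr
        _ = _ := by ring
    have hn : 0 ≤ ‖x‖ := norm_nonneg x
    have h4 : (4 : ℝ≥0∞) * ENNReal.ofReal (Z / (‖x‖ + s)) =
        ENNReal.ofReal (4 * (Z / (‖x‖ + s))) := by
      rw [ENNReal.ofReal_mul (by norm_num)]; simp
    rw [h4]
    by_cases hxb : x ∈ ball (0 : E3) (s / 2)
    · rw [Set.indicator_of_mem hxb, ← ENNReal.ofReal_mul hZ.le,
        ← ENNReal.ofReal_add (by positivity) (by positivity)]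
      refine ENNReal.ofReal_le_ofReal (add_le_add ?_ (by linarith))
      rcases hn.eq_or_lt with h0 | h0
      · have : x = 0 := norm_eq_zero.1 h0.symm
        subst this
        simp [enorm3]
      · rw [← div_eq_mul_inv]
        gcongr
    · rw [Set.indicator_of_notMem hxb, zero_add]
      rw [mem_ball, dist_zero_right, not_lt] at hxb
      refine ENNReal.ofReal_le_ofReal ?_
      have h1 : Z / enorm3 x ≤ 3 * (Z / (‖x‖ + s)) := by
        have h0 : 0 < enorm3 x := by linarith
        rw [← mul_div_assoc, div_le_div_iff₀ h0 hxs]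
        nlinarith
      linarith
  have hmV : Measurable fun x : E3 => 4 * ENNReal.ofReal (Z / (‖x‖ + s)) := by fun_prop
  set T := τ Set.univ with hT
  set P := Z ^ (5 / 2 : ℝ) * d ^ (1 / 2 : ℝ) with hP
  have hP0 : 0 < P := by positivity
  calc _ ≤ ∫⁻ x, ((ball (0 : E3) (s / 2)).indicator
        (fun x => ENNReal.ofReal Z * ENNReal.ofReal ‖x‖⁻¹) x +
        4 * ENNReal.ofReal (Z / (‖x‖ + s))) ∂ρ := lintegral_mono_ae (hρ2.mono hpt)
    _ = ENNReal.ofReal Z * (∫⁻ x in ball (0 : E3) (s / 2), ENNReal.ofReal ‖x‖⁻¹ ∂ρ) + 4 * I := by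
        rw [lintegral_add_right _ hmV, lintegral_indicator measurableSet_ball,
          lintegral_const_mul' _ _ ENNReal.ofReal_ne_top, lintegral_const_mul' _ _ (by simp)]
    _ ≤ ENNReal.ofReal (1 / 2) * T + ENNReal.ofReal (4 * C₀) * I + 4 * I :=
        add_le_add hcoul le_rfl
    _ = ENNReal.ofReal (1 / 2) * T + ENNReal.ofReal (4 * (C₀ + 1)) * I := by
        rw [mul_add 4 C₀, ENNReal.ofReal_add (by positivity) (by positivity), add_mul, add_assoc]
        simp
    _ ≤ ENNReal.ofReal (1 / 2) * T + ENNReal.ofReal (4 * (C₀ + 1)) *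
        (32 * (32 * K ^ 3 * J + ENNReal.ofReal η * (8 * T))) := by gcongr
    _ = ENNReal.ofReal (1 / 2) * T + ENNReal.ofReal (4 * (C₀ + 1) * 256 * η) * T +
        ENNReal.ofReal k * J := by
        have e1 : ENNReal.ofReal (4 * (C₀ + 1) * 256 * η) =
            ENNReal.ofReal (4 * (C₀ + 1)) * 256 * ENNReal.ofReal η := by
          rw [ENNReal.ofReal_mul (by positivity), ENNReal.ofReal_mul (by positivity)]
          simp
        have e2 : ENNReal.ofReal k = ENNReal.ofReal (4 * (C₀ + 1)) * (32 * (32 * K ^ 3)) := by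
          rw [hk, ENNReal.ofReal_mul (by positivity)]
          congr 1
          rw [ENNReal.ofReal_mul (by positivity), ENNReal.ofReal_mul (by positivity),
            ENNReal.ofReal_pow (by positivity)]
          simp
        rw [e1, e2]
        ring
    _ ≤ ENNReal.ofReal (1 / 2) * T + ENNReal.ofReal (1 / 2) * T + ENNReal.ofReal k *
        (ENNReal.ofReal (C₁ * P) + ENNReal.ofReal (C₁ * Z) * γ {y | enorm3 y ≤ 3 * d}) := by
        refine add_le_add (add_le_add le_rfl
          (mul_le_mul' (ENNReal.ofReal_le_ofReal ?_) le_rfl)) (mul_le_mul' le_rfl hJ)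
        linarith
    _ = T + ENNReal.ofReal (k * C₁ * P) +
        ENNReal.ofReal (k * C₁ * Z) * γ {y | enorm3 y ≤ 3 * d} := by
        rw [← add_mul, ← ENNReal.ofReal_add (by norm_num) (by norm_num), mul_add,
          ← mul_assoc (ENNReal.ofReal k), ← ENNReal.ofReal_mul hk0.le,
          ← ENNReal.ofReal_mul hk0.le, mul_assoc k, mul_assoc k, ← add_assoc]
        norm_num
    _ ≤ _ := by
        have h6 : k * C₁ ≤ k * C₁ + 6 * c₁ ^ 2 + 1 := by nlinarith [sq_nonneg c₁]
        exact add_le_add (add_le_add le_rfl (ENNReal.ofReal_le_ofReal (by gcongr)))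
          (mul_le_mul' (ENNReal.ofReal_le_ofReal (by gcongr)) le_rfl)

theorem continuous_pdVec {A : E3 → E3} (hA : ContDiff ℝ (⊤ : ℕ∞) A) (i j : Fin 3) :
    Continuous (pdVec A i j) := by
  have h : Continuous (fderiv ℝ A) := hA.continuous_fderiv (by simp)
  unfold pdVec
  fun_prop

theorem continuous_gradSq {A : E3 → E3} (hA : ContDiff ℝ (⊤ : ℕ∞) A) :
    Continuous (gradSq A) := by
  have h := fun i j => continuous_pdVec hA i j
  unfold gradSq
  fun_prop

theorem gradSq_nonneg (A : E3 → E3) (x : E3) : 0 ≤ gradSq A x :=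
  Finset.sum_nonneg fun _ _ => Finset.sum_nonneg fun _ _ => sq_nonneg _

theorem hasCompactSupport_gradSq {A : E3 → E3} (hA : HasCompactSupport A) :
    HasCompactSupport (gradSq A) := by
  refine (hA.fderiv (𝕜 := ℝ)).mono fun x hx hx0 => hx ?_
  simp [gradSq, pdVec, hx0]

theorem pauliKin_nonneg (N : ℕ) (A : E3 → E3) (j : Fin N)
    (Ψ : (Fin N → Fin 3 → ℝ) → (Fin N → Fin 2) → ℂ) : 0 ≤ pauliKin N A j Ψ :=
  Finset.sum_nonneg fun _ _ => integral_nonneg fun _ => sq_nonneg _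

theorem sum_grad3_sq_le {f : E3 → ℝ} {x : E3} {b : ℝ} (h : enorm3 (grad3 f x) ≤ b) :
    ∑ k, grad3 f x k ^ 2 ≤ b ^ 2 := by
  rw [← Real.sq_sqrt (Finset.sum_nonneg fun k _ => sq_nonneg (grad3 f x k))]
  exact pow_le_pow_left₀ (Real.sqrt_nonneg _) h 2

theorem measurable_Wloc {θ₀ θ₁ : E3 → ℝ} (h₀ : ContDiff ℝ (⊤ : ℕ∞) θ₀)
    (h₁ : ContDiff ℝ (⊤ : ℕ∞) θ₁) (Z : ℝ) : Measurable (Wloc Z θ₀ θ₁) := by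
  have hg : ∀ {f : E3 → ℝ}, ContDiff ℝ (⊤ : ℕ∞) f →
      Measurable fun x => ∑ k, grad3 f x k ^ 2 := fun {f} hf => by
    have h : Continuous (fderiv ℝ f) := hf.continuous_fderiv (by simp)
    have : Continuous fun x => ∑ k, grad3 f x k ^ 2 := by
      unfold grad3
      fun_prop
    exact this.measurable
  exact ((measurable_const.div continuous_enorm3.measurable).add (hg h₀)).add (hg h₁)

/-- The Coulomb tooth is negligible: 𝓔¹_N[Ψ,A] ≥ −C Z^{7/3} δ^{1/2} − C Z^{2/3} δ⁻²
for Zα² ≤ κ and C Z^{−2/3} ≤ δ ≤ D. -/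
theorem coulomb_tooth_bound (c₁ : ℝ) (hc₁ : 0 < c₁) :
    ∃ κ C : ℝ, 0 < κ ∧ 0 < C ∧ ∀ Z α D δ : ℝ, 1 ≤ Z → 0 < α → Z * α ^ 2 ≤ κ →
      1 ≤ D → C * Z ^ (-(2 : ℝ) / 3) ≤ δ → δ ≤ D →
      ∀ θ₀ θ₁, AdmissibleCutoffs (δ * Z ^ (-(1 : ℝ) / 3)) c₁ θ₀ θ₁ →
      ∀ N : ℕ, 1 ≤ N → ∀ A, IsVecPot A → ∀ Ψ, IsWaveFun N Ψ →
        toothEnergy N Z α (D * Z ^ (-(1 : ℝ) / 3)) θ₀ θ₁ A Ψ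
          ≥ -C * Z ^ ((7 : ℝ) / 3) * δ ^ ((1 : ℝ) / 2)
            - C * Z ^ ((2 : ℝ) / 3) * (δ ^ 2)⁻¹ := by
  obtain ⟨C₀, ε, hC₀, hε, hone⟩ := exists_one_particle_measures
  obtain ⟨C, hC, hmain⟩ := exists_lintegral_coulomb_le hC₀ hε hc₁
  have hπ := Real.pi_pos
  refine ⟨(16 * Real.pi * C)⁻¹, C, by positivity, hC, ?_⟩
  intro Z α D δ hZ1 hα hZα _ hCδ hδD θ₀ θ₁ hθ N _ A hA Ψ hΨ
  have hZ : 0 < Z := by linarith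
  have hδ : 0 < δ := lt_of_lt_of_le (by positivity) hCδ
  set d := δ * Z ^ (-(1 : ℝ) / 3) with hd_def
  have hd : 0 < d := by positivity
  have hCd : C ≤ Z * d := by
    have e : Z ^ (-(2 : ℝ) / 3) * (Z * Z ^ (-(1 : ℝ) / 3)) = 1 := by
      nth_rw 2 [← Real.rpow_one Z]
      rw [← Real.rpow_add hZ, ← Real.rpow_add hZ]
      norm_num
    calc C = C * Z ^ (-(2 : ℝ) / 3) * (Z * Z ^ (-(1 : ℝ) / 3)) := by rw [mul_assoc, e, mul_one]
      _ ≤ δ * (Z * Z ^ (-(1 : ℝ) / 3)) := by gcongr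
      _ = _ := by rw [hd_def]; ring
  obtain ⟨ρ, τ, hρfin, hτfin, hρ0, hτ, hpot, hloc⟩ :=
    hone A θ₁ N Ψ hA.1 hθ.smooth₁ hθ.mem₁ hΨ
  have : IsFiniteMeasure ρ := ⟨hρfin.lt_top⟩
  have : IsFiniteMeasure τ := ⟨hτfin.lt_top⟩
  have hgc := continuous_gradSq hA.1
  have hgs := hasCompactSupport_gradSq hA.2.1
  obtain ⟨b, hb⟩ := hgs.exists_bound_of_continuous hgc
  set γ : Measure E3 := volume.withDensity fun x => ENNReal.ofReal (gradSq A x) with hγ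
  have hγball : ∀ y r, γ (ball y r) = ∫⁻ x in ball y r, ENNReal.ofReal (gradSq A x) :=
    fun y r => withDensity_apply _ measurableSet_ball
  have hγB : ∀ (y : E3) (r : ℝ), 0 < r → γ (ball y r) ≤ ENNReal.ofReal (8 * b * r ^ 3) := by
    intro y r hr
    have hb0 : 0 ≤ b := (norm_nonneg _).trans (hb 0)
    rw [hγball]
    calc _ ≤ ∫⁻ _ in ball y r, ENNReal.ofReal b := lintegral_mono fun x =>
          ENNReal.ofReal_le_ofReal ((le_abs_self _).trans (hb x))
      _ = _ := by
          rw [setLIntegral_const, volume_ball_E3 y hr, ← ENNReal.ofReal_mul hb0]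
          congr 1
          ring
  have hρd : ρ {x | 2 * d < enorm3 x} = 0 :=
    measure_mono_null (fun x hx => hθ.support₁ x hx) hρ0
  have hest := hmain Z d (8 * b) γ ρ τ hZ1 hd hCd hγB hρd fun y l hl hs =>
    hloc y l hl (by rwa [← hγball])
  set T := ∑ j, pauliKin N A j (cutMul N θ₁ j Ψ) with hT
  set P := ∑ j, potInt N (fun x => Wloc Z θ₀ θ₁ (x j) * θ₁ (x j) ^ 2) Ψ with hP
  set r := D * Z ^ (-(1 : ℝ) / 3) with hr
  have hdr : d ≤ r := by rw [hd_def, hr]; gcongr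
  set g := ∫ x in ball3 (3 * r), gradSq A x with hg
  have hg0 : 0 ≤ g := integral_nonneg fun x => gradSq_nonneg A x
  have hT0 : 0 ≤ T := Finset.sum_nonneg fun j _ => pauliKin_nonneg N A j _
  have hγg : γ {y | enorm3 y ≤ 3 * d} ≤ ENNReal.ofReal g := by
    have hmeas : MeasurableSet {y : E3 | enorm3 y ≤ 3 * d} :=
      measurableSet_le continuous_enorm3.measurable measurable_const
    rw [hγ, withDensity_apply _ hmeas, hg, ofReal_integral_eq_lintegral_ofReal
      (hgc.integrable_of_hasCompactSupport hgs).integrableOn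
      (Filter.Eventually.of_forall fun x => gradSq_nonneg A x)]
    refine lintegral_mono_set fun x hx => ?_
    have hx' : enorm3 x ≤ 3 * d := hx
    change enorm3 x ≤ 3 * r
    linarith
  have hW0 : ∀ x, 0 ≤ Wloc Z θ₀ θ₁ x := fun x =>
    add_nonneg (add_nonneg (div_nonneg hZ.le (enorm3_nonneg x))
      (Finset.sum_nonneg fun _ _ => sq_nonneg _)) (Finset.sum_nonneg fun _ _ => sq_nonneg _)
  have hWle : ∀ x, Wloc Z θ₀ θ₁ x ≤ Z / enorm3 x + 2 * (c₁ / d) ^ 2 := fun x => by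
    have h0 := sum_grad3_sq_le (hθ.grad₀ x)
    have h1 := sum_grad3_sq_le (hθ.grad₁ x)
    unfold Wloc
    linarith
  set Q := Z ^ (5 / 2 : ℝ) * d ^ (1 / 2 : ℝ) with hQ
  have hQ0 : 0 < Q := by positivity
  have hPle : P ≤ T + C * Q + C * Z * g := by
    refine (ENNReal.ofReal_le_ofReal_iff (by positivity)).1 ?_
    calc _ ≤ ∫⁻ x, ENNReal.ofReal (Wloc Z θ₀ θ₁ x) ∂ρ :=
          hpot _ (measurable_Wloc hθ.smooth₀ hθ.smooth₁ Z) hW0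
      _ ≤ ∫⁻ x, ENNReal.ofReal (Z / enorm3 x + 2 * (c₁ / d) ^ 2) ∂ρ :=
          lintegral_mono fun x => ENNReal.ofReal_le_ofReal (hWle x)
      _ ≤ _ := hest
      _ ≤ ENNReal.ofReal T + ENNReal.ofReal (C * Q) +
          ENNReal.ofReal (C * Z) * ENNReal.ofReal g := by
          rw [hτ]
          exact add_le_add le_rfl (mul_le_mul' le_rfl hγg)
      _ = _ := by
          rw [← ENNReal.ofReal_mul (by positivity), ← ENNReal.ofReal_add hT0 (by positivity),
            ← ENNReal.ofReal_add (by positivity) (by positivity)]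
  have hfield : C * Z * g ≤ (16 * Real.pi * α ^ 2)⁻¹ * g := by
    refine mul_le_mul_of_nonneg_right ?_ hg0
    rw [← one_div, le_div_iff₀ (by positivity)]
    rw [← one_div, le_div_iff₀ (by positivity)] at hZα
    linarith
  have hQe : Q = Z ^ ((7 : ℝ) / 3) * δ ^ ((1 : ℝ) / 2) := by
    rw [hQ, hd_def, Real.mul_rpow hδ.le (by positivity), ← Real.rpow_mul hZ.le,
      mul_comm (δ ^ _), ← mul_assoc, ← Real.rpow_add hZ]
    norm_num
  have hlast : 0 ≤ C * Z ^ ((2 : ℝ) / 3) * (δ ^ 2)⁻¹ := by positivity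
  have hE : toothEnergy N Z α r θ₀ θ₁ A Ψ = T - P + (16 * Real.pi * α ^ 2)⁻¹ * g := by
    rw [toothEnergy, Finset.sum_sub_distrib]
  rw [hE]
  have hCQ : -C * Z ^ ((7 : ℝ) / 3) * δ ^ ((1 : ℝ) / 2) = -(C * Q) := by rw [hQe]; ring
  rw [hCQ]
  linarith
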